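/- For every integer d ≥ 3 and every ε ∈ (0,1) there exist δ = δ(d,ε) > 0 and N = N(d,ε) such that for all n ≥ N, every integer ℓ with 2 ≤ ℓ ≤ exp(n^δ), and every transitive abelian subgroup H of Sym(ℓ), there exist a d-regular graph G₀ on n' vertices with n ≤ n' ≤ 2n and an (H,ℓ)-signing s of G₀ such that the lifted graph G = G₀(s) is d-regular on n'·ℓ vertices and satisfies λ(G) ≤ 2√(d−1) + ε. -/

import Mathlib

open scoped Classical

noncomputable section

/-- The `(H,ℓ)`-lift of a graph `G` under an edge-signing `s` valued in permutations of
`Fin ℓ`: the vertex `(u, i)` is joined to `(v, s u v • i)` for each edge `{u, v}` of `G`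
(the signing is extended to both orientations by `s v u = (s u v)⁻¹`). -/
def liftGraph {V : Type*} {ℓ : ℕ} (G : SimpleGraph V) (s : V → V → Equiv.Perm (Fin ℓ)) :
    SimpleGraph (V × Fin ℓ) :=
  SimpleGraph.fromRel (fun p q => G.Adj p.1 q.1 ∧ q.2 = s p.1 q.1 p.2)

/-- `λ(G) ≤ b` for a `d`-regular graph with adjacency matrix `A`: every eigenvalue other
than the trivial one (on the constant vectors) has absolute value at most `b`, expressed
via the Rayleigh quotient of `A` on mean-zero vectors. -/
def SndEigLE {V : Type*} [Fintype V] (A : Matrix V V ℝ) (b : ℝ) : Prop :=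
  ∀ f : V → ℝ, (∑ v, f v) = 0 →
    |dotProduct f (A.mulVec f)| ≤ b * (∑ v, (f v) ^ 2)

set_option linter.all false
namespace W
open Finset
local notation "PF" n:max => Equiv.Perm (Fin n)
local notation "KK" n:max => (⊤ : SimpleGraph n)


variable {V : Type*}

def vs (f : ℕ → V) (T : ℕ) : Finset V := (range (T+1)).image f
def ds (f : ℕ → V) (T : ℕ) : Finset (V × V) :=
  (range T).biUnion fun i => {(f i, f (i+1)), (f (i+1), f i)}
def exc (f : ℕ → V) : ℕ → ℕ
  | 0 => 0
  | T+1 => exc f T + if (f T, f (T+1)) ∉ ds f T ∧ f (T+1) ∈ vs f T then 1 else 0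

lemma mem_vs {f : ℕ → V} {T : ℕ} {x : V} : x ∈ vs f T ↔ ∃ i, i ≤ T ∧ f i = x := by
  simp [vs]

lemma mem_vs_self {f : ℕ → V} {T i : ℕ} (h : i ≤ T) : f i ∈ vs f T := mem_vs.2 ⟨i, h, rfl⟩

lemma mem_ds {f : ℕ → V} {T : ℕ} {p : V × V} :
    p ∈ ds f T ↔ ∃ i, i < T ∧ (p = (f i, f (i+1)) ∨ p = (f (i+1), f i)) := by
  simp [ds]

lemma mem_ds_swap {f : ℕ → V} {T : ℕ} {a b : V} (h : (a, b) ∈ ds f T) : (b, a) ∈ ds f T := by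
  rw [mem_ds] at *
  grind

lemma vs_zero (f : ℕ → V) : vs f 0 = {f 0} := by simp [vs]

lemma vs_succ (f : ℕ → V) (T : ℕ) : vs f (T+1) = insert (f (T+1)) (vs f T) := by
  simp [vs, range_add_one, image_insert]

lemma ds_zero (f : ℕ → V) : ds f 0 = ∅ := by simp [ds]

lemma ds_succ (f : ℕ → V) (T : ℕ) :
    ds f (T+1) = insert (f T, f (T+1)) (insert (f (T+1), f T) (ds f T)) := by
  ext p; simp only [ds, range_add_one, biUnion_insert, mem_union,
    mem_insert, mem_singleton]; tauto

lemma ds_mono (f : ℕ → V) {S T : ℕ} (h : S ≤ T) : ds f S ⊆ ds f T := by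
  intro x; simp only [mem_ds]; grind

lemma fst_mem_of_ds {f : ℕ → V} {T : ℕ} {p : V × V} (h : p ∈ ds f T) : p.1 ∈ vs f T := by
  rw [mem_ds] at h
  obtain ⟨i, hi, rfl | rfl⟩ := h
  · exact mem_vs_self (by omega)
  · exact mem_vs_self (by omega)

lemma snd_mem_of_ds {f : ℕ → V} {T : ℕ} {p : V × V} (h : p ∈ ds f T) : p.2 ∈ vs f T := by
  rw [mem_ds] at h
  obtain ⟨i, hi, rfl | rfl⟩ := h
  · exact mem_vs_self (by omega)
  · exact mem_vs_self (by omega)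

lemma card_vs_le (f : ℕ → V) (T : ℕ) : (vs f T).card ≤ T+1 := by
  simpa [vs] using card_image_le (s := range (T+1)) (f := f)

lemma vs_congr {f g : ℕ → V} {T : ℕ} (h : ∀ i ≤ T, f i = g i) : vs f T = vs g T := by
  apply image_congr
  intro i hi
  grind

lemma ds_congr {f g : ℕ → V} {T : ℕ} (h : ∀ i ≤ T, f i = g i) : ds f T = ds g T := by
  apply biUnion_congr rfl
  grind

lemma exc_congr {f g : ℕ → V} : ∀ {T : ℕ}, (∀ i ≤ T, f i = g i) → exc f T = exc g T
  | 0, _ => rfl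
  | T+1, h => by
    have h' : ∀ i ≤ T, f i = g i := fun i hi => h i (by omega)
    simp only [exc, exc_congr h', ds_congr h', vs_congr h', h T (by omega), h (T+1) le_rfl]

lemma exc_mono (f : ℕ → V) {S T : ℕ} (h : S ≤ T) : exc f S ≤ exc f T := by
  induction T, h using Nat.le_induction with
  | base => rfl
  | succ T _ ih => simp only [exc]; omega

lemma card_ds (f : ℕ → V) (T : ℕ) (h : ∀ i < T, f i ≠ f (i+1)) :
    (ds f T).card + 2 = 2 * ((vs f T).card + exc f T) := by
  induction T with
  | zero => simp [ds_zero, vs_zero, exc]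
  | succ T ih =>
    have ih := ih (fun i hi => h i (by omega))
    have hne := h T (by omega)
    rw [ds_succ, vs_succ, exc]
    by_cases h1 : (f T, f (T+1)) ∈ ds f T
    · have h2 := mem_ds_swap h1
      have h3 := snd_mem_of_ds h1
      grind
    · have h2 : (f (T+1), f T) ∉ ds f T := fun h => h1 (mem_ds_swap h)
      grind

lemma fresh_exc (f : ℕ → V) (i : ℕ) (h1 : f (i+1) ∉ vs f i) (h2 : f (i+2) ∈ vs f (i+1))
    (h3 : f (i+2) ≠ f i) (h4 : f (i+2) ≠ f (i+1)) : exc f (i+2) = exc f (i+1) + 1 := by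
  have : (f (i+1), f (i+2)) ∉ ds f (i+1) := by
    rw [ds_succ]
    simp only [mem_insert, Prod.mk.injEq, not_or, not_and]
    refine ⟨fun _ => h4, fun _ => h3, fun h => h1 (fst_mem_of_ds h)⟩
  rw [exc]; grind

lemma card_vs_inj (f : ℕ → V) (T : ℕ) (h : ∀ i < T, f (i+1) ∉ vs f i) :
    (vs f T).card = T+1 := by
  induction T with
  | zero => simp [vs_zero]
  | succ T ih =>
    rw [vs_succ, card_insert_of_notMem (h T (by omega)), ih (fun i hi => h i (by omega))]

lemma card_vs_fresh (f : ℕ → V) (S T : ℕ) (hST : S ≤ T) (h : ∀ i < T, S ≤ i → f (i+1) ∉ vs f i) :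
    (vs f T).card = (vs f S).card + (T - S) := by
  induction T, hST using Nat.le_induction with
  | base => simp
  | succ T hT ih =>
    rw [vs_succ, card_insert_of_notMem (h T (by omega) hT),
      ih (fun i hi => h i (by omega))]; omega

lemma struct (f : ℕ → V) (j : ℕ) (hne : ∀ i < j, f i ≠ f (i+1))
    (hnb : ∀ i, i+2 ≤ j → f (i+2) ≠ f i) (he : exc f j ≤ 1) :
    (∀ i < j, f (i+1) ∉ vs f i) ∨
    ∃ t s, 1 ≤ t ∧ t < s ∧ s ≤ j ∧ (∀ i < t, f (i+1) ∉ vs f i) ∧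
      (∀ i, t < i → i ≤ s → f i ∈ vs f t) ∧ (∀ i, s ≤ i → i < j → f (i+1) ∉ vs f i) ∧
      (vs f j).card = (t+1) + (j - s) ∧ exc f (t+1) = 1 := by
  by_cases hall : ∀ i < j, f (i+1) ∉ vs f i
  · grind
  right
  push Not at hall
  obtain ⟨t, ⟨htj, htold⟩, htmin⟩ : ∃ t, (t < j ∧ f (t+1) ∈ vs f t) ∧
      ∀ i < t, ¬ (i < j ∧ f (i+1) ∈ vs f i) :=
    ⟨Nat.find hall, Nat.find_spec hall, fun i hi => Nat.find_min hall hi⟩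
  have hfr : ∀ i < t, f (i+1) ∉ vs f i := fun i hi h => htmin i hi ⟨by omega, h⟩
  have ht1 : 1 ≤ t := by
    by_contra h
    have : t = 0 := by omega
    subst this
    rw [vs_zero] at htold
    simp at htold
    exact hne 0 htj htold.symm
  have hexc : exc f (t+1) ≥ 1 := by
    obtain ⟨u, rfl⟩ : ∃ u, t = u+1 := ⟨t-1, by omega⟩
    rw [fresh_exc f u (hfr u (by omega)) htold (hnb u (by omega)) (hne _ htj).symm]
    omega
  have hexc1 : exc f (t+1) = 1 := le_antisymm ((exc_mono f (by omega)).trans he) hexc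
  have hprop : ∀ i, t < i → i + 2 ≤ j → f (i+1) ∉ vs f i → f (i+2) ∉ vs f (i+1) := by
    intro i hti hij h1 h2
    have := fresh_exc f i h1 h2 (hnb i hij) (hne _ (by omega)).symm
    have h3 := exc_mono f (show t+1 ≤ i+1 by omega)
    have h4 := exc_mono f (show i+2 ≤ j by omega)
    omega
  have hcardt : (vs f t).card = t+1 := card_vs_inj f t hfr
  by_cases hex : ∃ s, t < s ∧ s < j ∧ f (s+1) ∉ vs f s
  · obtain ⟨s, ⟨hts, hsj, hs⟩, hmin⟩ : ∃ s, (t < s ∧ s < j ∧ f (s+1) ∉ vs f s) ∧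
      ∀ i < s, ¬ (t < i ∧ i < j ∧ f (i+1) ∉ vs f i) :=
      ⟨Nat.find hex, Nat.find_spec hex, fun i hi => Nat.find_min hex hi⟩
    have hvs : ∀ i, t ≤ i → i ≤ s → vs f i = vs f t := by
      intro i hti
      induction i, hti using Nat.le_induction with
      | base => intro _; rfl
      | succ i hti ih =>
        intro his
        have hh := hmin i (by omega)
        have : f (i+1) ∈ vs f i := by
          rcases hti.eq_or_lt with rfl | hti
          · exact htold
          · grind
        rw [vs_succ, insert_eq_of_mem this, ih (by omega)]
    have hfs : ∀ i, s ≤ i → i < j → f (i+1) ∉ vs f i := by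
      intro i hsi
      induction i, hsi using Nat.le_induction with
      | base => grind
      | succ i hsi ih => grind
    refine ⟨t, s, ht1, hts, hsj.le, hfr, ?_, hfs, ?_, hexc1⟩
    · intro i hti his
      rw [← hvs i hti.le his]; exact mem_vs_self le_rfl
    · rw [card_vs_fresh f s j hsj.le (fun i h1 h2 => hfs i h2 h1), hvs s hts.le le_rfl, hcardt]
  · push Not at hex
    have hvs : ∀ i, t ≤ i → i ≤ j → vs f i = vs f t := by
      intro i hti
      induction i, hti using Nat.le_induction with
      | base => intro _; rfl
      | succ i hti ih =>
        intro his
        have : f (i+1) ∈ vs f i := by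
          rcases hti.eq_or_lt with rfl | hti
          · exact htold
          · grind
        rw [vs_succ, insert_eq_of_mem this, ih (by omega)]
    refine ⟨t, j, ht1, htj, le_rfl, hfr, ?_, fun i h1 h2 => absurd h1 (by omega), ?_, hexc1⟩
    · intro i hti his
      rw [← hvs i hti.le his]; exact mem_vs_self le_rfl
    grind

def IsW (G : SimpleGraph V) (T : ℕ) (f : ℕ → V) : Prop := ∀ i < T, G.Adj (f i) (f (i+1))
def NB (G : SimpleGraph V) (T : ℕ) (f : ℕ → V) : Prop :=
  IsW G T f ∧ ∀ i, i+2 ≤ T → f (i+2) ≠ f i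
def TF (G : SimpleGraph V) (L : ℕ) : Prop := ∀ T ≤ L, ∀ f : ℕ → V, IsW G T f → exc f T ≤ 1

lemma IsW.mono {G : SimpleGraph V} {S T : ℕ} {f : ℕ → V} (h : IsW G T f) (hST : S ≤ T) :
    IsW G S f := fun i hi => h i (by omega)
lemma NB.mono {G : SimpleGraph V} {S T : ℕ} {f : ℕ → V} (h : NB G T f) (hST : S ≤ T) :
    NB G S f := ⟨h.1.mono hST, fun i hi => h.2 i (by omega)⟩
lemma NB.shift {G : SimpleGraph V} {S T : ℕ} {f : ℕ → V} (h : NB G (S+T) f) :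
    NB G T (fun i => f (S+i)) :=
  ⟨fun i hi => h.1 (S+i) (by omega), fun i hi => h.2 (S+i) (by omega)⟩
lemma NB.congr {G : SimpleGraph V} {T : ℕ} {f g : ℕ → V} (h : NB G T f)
    (hfg : ∀ i ≤ T, f i = g i) : NB G T g :=
  ⟨fun i hi => by rw [← hfg i (by omega), ← hfg (i+1) (by omega)]; exact h.1 i hi,
   fun i hi => by rw [← hfg i (by omega), ← hfg (i+2) (by omega)]; exact h.2 i hi⟩

set_option maxHeartbeats 1000000 in
lemma two_walks (G : SimpleGraph V) (K : ℕ) (hTF : TF G (3*K)) :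
    ∀ j ≤ K, ∀ X Y Z : ℕ → V, NB G j X → NB G j Y → NB G j Z →
      X 0 = Y 0 → X 0 = Z 0 → X j = Y j → X j = Z j →
      (∀ i ≤ j, X i = Y i) ∨ (∀ i ≤ j, X i = Z i) ∨ (∀ i ≤ j, Y i = Z i) := by
  intro j
  induction j with
  | zero =>
    grind
  | succ j ih =>
    intro hjK X Y Z hX hY hZ hXY0 hXZ0 hXYj hXZj
    have sh : ∀ {A B : ℕ → V}, A 0 = B 0 → (∀ i ≤ j, A (1+i) = B (1+i)) → ∀ i ≤ j+1, A i = B i := by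
      intro A B h0 h i hi
      rcases i with _ | i
      · exact h0
      · grind
    have tr : ∀ {A B : ℕ → V}, A (j+1) = B (j+1) → (∀ i ≤ j, A i = B i) → ∀ i ≤ j+1, A i = B i := by
      intro A B h0 h i hi
      rcases Nat.lt_or_ge i (j+1) with h1 | h1
      · grind
      · grind
    by_cases hfirst : X 1 = Y 1 ∧ X 1 = Z 1
    · have hs : ∀ {A : ℕ → V}, NB G (j+1) A → NB G j (fun i => A (1+i)) := by
        intro A hA; rw [add_comm] at hA; exact hA.shift
      have := ih (by omega) _ _ _ (hs hX) (hs hY) (hs hZ) hfirst.1 hfirst.2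
        (by grind) (by grind)
      rcases this with h | h | h
      · exact Or.inl (sh hXY0 h)
      · exact Or.inr (Or.inl (sh hXZ0 h))
      · exact Or.inr (Or.inr (sh (hXY0.symm.trans hXZ0) h))
    by_cases hlast : X j = Y j ∧ X j = Z j
    · have := ih (by omega) _ _ _ (hX.mono (Nat.le_succ j)) (hY.mono (Nat.le_succ j))
        (hZ.mono (Nat.le_succ j)) hXY0 hXZ0 hlast.1 hlast.2
      grind
    set J := j+1 with hJ
    let f : ℕ → V := fun i => if i ≤ J then X i else if i ≤ 2*J then Y (2*J - i) else Z (i - 2*J)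
    have fX : ∀ i ≤ J, f i = X i := fun i hi => by simp [f, hi]
    have fY : ∀ i ≤ J, f (2*J - i) = Y i := by
      intro i hi
      rcases hi.eq_or_lt with hi | hi
      · grind
      · grind
    have fZ : ∀ i ≤ J, f (2*J + i) = Z i := by
      intro i hi
      rcases Nat.eq_zero_or_pos i with rfl | hi0
      · grind
      · have h1 : ¬ (2*J + i ≤ J) := by omega
        have h2 : ¬ (2*J + i ≤ 2*J) := by omega
        simp only [f, h1, h2, if_false]
        simp
    have hW : IsW G (3*J) f := by
      intro i hi
      rcases Nat.lt_or_ge i J with h | h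
      · rw [fX i (by omega), fX (i+1) (by omega)]; exact hX.1 i h
      rcases Nat.lt_or_ge i (2*J) with h' | h'
      · obtain ⟨u, hu, rfl⟩ : ∃ u, u < J ∧ i = 2*J - (u+1) := ⟨2*J - i - 1, by omega, by omega⟩
        rw [fY (u+1) (by omega), show 2*J - (u+1) + 1 = 2*J - u by omega, fY u (by omega)]
        exact (hY.1 u hu).symm
      · obtain ⟨u, rfl⟩ : ∃ u, i = 2*J + u := ⟨i - 2*J, by omega⟩
        rw [fZ u (by omega), show 2*J + u + 1 = 2*J + (u+1) by omega, fZ (u+1) (by omega)]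
        exact hZ.1 u (by omega)
    have hexc := hTF (3*J) (by omega) f hW
    have hcard := card_ds f (3*J) (fun i hi => (hW i hi).ne)
    set D := ds f (3*J) with hD
    set U := vs f (3*J) with hU
    have hadjD : ∀ A : ℕ → V, (A = X ∨ A = Y ∨ A = Z) → ∀ i < J, (A i, A (i+1)) ∈ D := by
      rintro A (rfl | rfl | rfl) i hi
      · rw [hD, mem_ds]; grind
      · rw [hD, mem_ds]
        refine ⟨2*J - (i+1), by omega, Or.inr ?_⟩
        rw [fY (i+1) (by omega), show 2*J - (i+1) + 1 = 2*J - i by omega, fY i (by omega)]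
      · rw [hD, mem_ds]
        refine ⟨2*J + i, by omega, Or.inl ?_⟩
        grind
    have hadjD' : ∀ A : ℕ → V, (A = X ∨ A = Y ∨ A = Z) → ∀ i < J, (A (i+1), A i) ∈ D :=
      fun A hA i hi => mem_ds_swap (hadjD A hA i hi)
    have hUmem : ∀ x ∈ U, ∃ A : ℕ → V, (A = X ∨ A = Y ∨ A = Z) ∧ ∃ i ≤ J, A i = x := by
      intro x hx
      rw [hU, mem_vs] at hx
      obtain ⟨i, hi, rfl⟩ := hx
      rcases Nat.lt_or_ge i J with h | h
      · exact ⟨X, by simp, i, by omega, (fX i (by omega)).symm⟩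
      rcases Nat.lt_or_ge i (2*J) with h' | h'
      · refine ⟨Y, by simp, 2*J - i, by omega, ?_⟩
        rw [← fY (2*J - i) (by omega), show 2*J - (2*J - i) = i by omega]
      · refine ⟨Z, by simp, i - 2*J, by omega, ?_⟩
        rw [← fZ (i - 2*J) (by omega), show 2*J + (i - 2*J) = i by omega]
    have hNBA : ∀ A : ℕ → V, (A = X ∨ A = Y ∨ A = Z) → NB G J A := by
      grind
    have hdeg : ∀ x ∈ U, 2 ≤ (D.filter (fun p => p.1 = x)).card := by
      intro x hx
      have key : ∀ y z, (x, y) ∈ D → (x, z) ∈ D → y ≠ z → 2 ≤ (D.filter (fun p => p.1 = x)).card := by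
        intro y z hy hz hyz
        have : ({(x, y), (x, z)} : Finset (V × V)) ⊆ D.filter (fun p => p.1 = x) := by
          intro p hp
          simp only [mem_insert, mem_singleton] at hp
          grind
        have h2 := card_le_card this
        rwa [card_pair (by grind)] at h2
      obtain ⟨A, hA, i, hi, rfl⟩ := hUmem x hx
      have hA0 : A 0 = X 0 := by
        rcases hA with h | h | h <;> rw [h]
        exacts [hXY0.symm, hXZ0.symm]
      have hAJ : A J = X J := by
        rcases hA with h | h | h <;> rw [h]
        exacts [hXYj.symm, hXZj.symm]
      rcases Nat.eq_zero_or_pos i with rfl | hi0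
      · rw [hA0] at key ⊢
        by_cases h1 : X 1 = Y 1
        · have h2 : X 1 ≠ Z 1 := fun h => hfirst ⟨h1, h⟩
          exact key _ _ (hadjD X (by simp) 0 (by omega))
            (by have := hadjD Z (by simp) 0 (by omega); grind) h2
        · exact key _ _ (hadjD X (by simp) 0 (by omega))
            (by have := hadjD Y (by simp) 0 (by omega); grind) h1
      rcases hi.eq_or_lt with hiJ | hiJ
      · rw [hiJ, hAJ] at key ⊢
        by_cases h1 : X j = Y j
        · have h2 : X j ≠ Z j := fun h => hlast ⟨h1, h⟩
          exact key _ _ (hadjD' X (by simp) j (by omega))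
            (by have := hadjD' Z (by simp) j (by omega); grind) h2
        · exact key _ _ (hadjD' X (by simp) j (by omega))
            (by have := hadjD' Y (by simp) j (by omega); grind) h1
      · obtain ⟨u, rfl⟩ : ∃ u, i = u+1 := ⟨i-1, by omega⟩
        exact key _ _ (hadjD A hA (u+1) hiJ) (hadjD' A hA u (by omega))
          ((hNBA A hA).2 u (by omega))
    have hsum : D.card = ∑ x ∈ U, (D.filter (fun p => p.1 = x)).card :=
      card_eq_sum_card_fiberwise (fun p hp => fst_mem_of_ds hp)
    have hdeg2 : ∀ x ∈ U, (D.filter (fun p => p.1 = x)).card = 2 := by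
      have h1 : ∑ x ∈ U, (D.filter (fun p => p.1 = x)).card ≤ ∑ x ∈ U, 2 := by
        rw [← hsum]; simp; omega
      intro x hx
      exact (((sum_eq_sum_iff_of_le hdeg).1
        (le_antisymm (sum_le_sum hdeg) h1)) x hx).symm
    have h3 : ∀ x y z w, (x, y) ∈ D → (x, z) ∈ D → (x, w) ∈ D → y = z ∨ y = w ∨ z = w := by
      intro x y z w hy hz hw
      by_contra hcon
      push Not at hcon
      have hs : ({(x, y), (x, z), (x, w)} : Finset (V × V)) ⊆ D.filter (fun p => p.1 = x) := by
        intro p hp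
        simp only [mem_insert, mem_singleton] at hp
        grind
      have h2 := card_le_card hs
      rw [hdeg2 x (fst_mem_of_ds hy), card_eq_three.2
        ⟨_, _, _, by grind, by grind, by grind, rfl⟩] at h2
      omega
    have hdet : ∀ A B : ℕ → V, (A = X ∨ A = Y ∨ A = Z) → (B = X ∨ B = Y ∨ B = Z) →
        A 0 = B 0 → A 1 = B 1 → ∀ i ≤ J, A i = B i := by
      intro A B hA hB h0 h1
      have : ∀ i, i + 1 ≤ J → A i = B i ∧ A (i+1) = B (i+1) := by
        intro i
        induction i with
        | zero => grind
        | succ i ih =>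
          intro hi
          obtain ⟨e1, e2⟩ := ih (by omega)
          refine ⟨e2, ?_⟩
          have d1 := hadjD A hA (i+1) (by omega)
          have d2 := hadjD B hB (i+1) (by omega)
          have d3 := hadjD' A hA i (by omega)
          rw [← e2] at d2
          rcases h3 _ _ _ _ d1 d2 d3 with h | h | h
          · exact h
          · exact absurd h ((hNBA A hA).2 i (by omega))
          · rw [e1] at h; exact absurd h ((hNBA B hB).2 i (by omega))
      intro i hi
      rcases Nat.eq_zero_or_pos i with rfl | hi0
      · exact h0
      · grind
    have d1 := hadjD X (by simp) 0 (by omega)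
    have d2 := hadjD Y (by simp) 0 (by omega)
    have d3 := hadjD Z (by simp) 0 (by omega)
    rw [← hXY0] at d2
    rw [← hXZ0] at d3
    rcases h3 _ _ _ _ d1 d2 d3 with h | h | h
    · exact Or.inl (hdet X Y (by simp) (by simp) hXY0 h)
    · exact Or.inr (Or.inl (hdet X Z (by simp) (by simp) hXZ0 h))
    · exact Or.inr (Or.inr (hdet Y Z (by simp) (by simp) (hXY0.symm.trans hXZ0) h))

variable {V : Type*} [Fintype V]

def ex (T : ℕ) (f : Fin (T+1) → V) : ℕ → V := fun i => f ⟨min i T, by omega⟩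
def rs (T : ℕ) (f : ℕ → V) : Fin (T+1) → V := fun i => f i
def SW (T : ℕ) (F : (ℕ → V) → ℝ) : ℝ := ∑ f : Fin (T+1) → V, F (ex T f)
def ind (p : Prop) : ℝ := if p then 1 else 0

lemma ind_nonneg (p : Prop) : 0 ≤ ind p := by unfold ind; positivity
lemma ind_and (p q : Prop) : ind (p ∧ q) = ind p * ind q := by
  unfold ind; grind
lemma ind_true {p : Prop} (h : p) : ind p = 1 := by simp [ind, h]
lemma ind_false {p : Prop} (h : ¬ p) : ind p = 0 := by simp [ind, h]
lemma ind_mono {p q : Prop} (h : p → q) : ind p ≤ ind q := by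
  by_cases hp : p
  · grind
  · rw [ind_false hp]; exact ind_nonneg q
lemma ind_le_one (p : Prop) : ind p ≤ 1 := by unfold ind; grind

lemma rs_ex (T : ℕ) (f : Fin (T+1) → V) : rs T (ex T f) = f := by
  ext i; simp only [rs, ex]; grind
lemma ex_rs (T : ℕ) (f : ℕ → V) (i : ℕ) (h : i ≤ T) : ex T (rs T f) i = f i := by
  simp [rs, ex, h]

lemma SW_mono {T : ℕ} {F F' : (ℕ → V) → ℝ} (h : ∀ f, F f ≤ F' f) : SW T F ≤ SW T F' :=
  sum_le_sum fun _ _ => h _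
lemma SW_nonneg {T : ℕ} {F : (ℕ → V) → ℝ} (h : ∀ f, 0 ≤ F f) : 0 ≤ SW T F :=
  sum_nonneg fun _ _ => h _
lemma SW_add {T : ℕ} (F F' : (ℕ → V) → ℝ) : SW T (fun f => F f + F' f) = SW T F + SW T F' :=
  sum_add_distrib
lemma SW_sub {T : ℕ} (F F' : (ℕ → V) → ℝ) : SW T (fun f => F f - F' f) = SW T F - SW T F' :=
  sum_sub_distrib _ _
lemma SW_const_mul {T : ℕ} (c : ℝ) (F : (ℕ → V) → ℝ) : SW T (fun f => c * F f) = c * SW T F :=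
  (mul_sum _ _ _).symm
lemma SW_mul_const {T : ℕ} (c : ℝ) (F : (ℕ → V) → ℝ) : SW T (fun f => F f * c) = SW T F * c :=
  (sum_mul _ _ _).symm
lemma SW_sum {T : ℕ} {ι : Type*} (s : Finset ι) (F : ι → (ℕ → V) → ℝ) :
    SW T (fun f => ∑ i ∈ s, F i f) = ∑ i ∈ s, SW T (F i) := sum_comm
lemma SW_congr {T : ℕ} {F F' : (ℕ → V) → ℝ} (h : ∀ f, F f = F' f) : SW T F = SW T F' :=
  sum_congr rfl fun _ _ => h _

lemma SW_mul (T1 T2 : ℕ) (C : (ℕ → V) → (ℕ → V) → ℝ)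
    (hC : ∀ y y' z, (∀ i ≤ T1, y i = y' i) → C y z = C y' z) :
    SW (T1+T2) (fun f => C f (fun i => f (T1+i))) =
      SW T1 (fun y => SW T2 (fun z => if z 0 = y T1 then C y z else 0)) := by
  unfold SW
  rw [← Fintype.sum_prod_type', ← sum_filter (s := univ)
    (p := fun x : (Fin (T1+1) → V) × (Fin (T2+1) → V) => ex T2 x.2 0 = ex T1 x.1 T1)
    (f := fun x => C (ex T1 x.1) (ex T2 x.2))]
  let g : (Fin (T1+1) → V) → (Fin (T2+1) → V) → ℕ → V := fun y z i =>
    if i ≤ T1 then ex T1 y i else ex T2 z (i - T1)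
  refine sum_bij' (fun f _ => (rs T1 (ex (T1+T2) f), rs T2 (fun i => ex (T1+T2) f (T1+i))))
    (fun x _ => rs (T1+T2) (g x.1 x.2)) ?_ ?_ ?_ ?_ ?_
  · intro f _
    simp [ex, rs]
  · intros; simp
  · intro f _
    ext i
    simp only [rs, g]
    split_ifs with h
    · rw [ex_rs _ _ _ h]
      simp only [ex]; grind
    · rw [ex_rs _ _ _ (by omega)]
      simp only [ex]; grind
  · rintro ⟨y, z⟩ hx
    simp only [mem_filter, mem_univ, true_and] at hx
    have h1 : rs T1 (ex (T1+T2) (rs (T1+T2) (g y z))) = y := by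
      ext i
      have hi : (i : ℕ) ≤ T1 := by omega
      simp only [rs, ex, g]
      rw [if_pos (by simp; omega)]
      congr 1; ext; simp; omega
    have h2 : rs T2 (fun i => ex (T1+T2) (rs (T1+T2) (g y z)) (T1+i)) = z := by
      ext i
      have hi : (i : ℕ) ≤ T2 := by omega
      have : ex (T1+T2) (rs (T1+T2) (g y z)) (T1 + i) = g y z (T1+i) := ex_rs _ _ _ (by omega)
      change ex (T1+T2) (rs (T1+T2) (g y z)) (T1 + i) = z i
      rw [this]
      simp only [g]
      split_ifs with h
      · have : (i : ℕ) = 0 := by omega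
        rw [this, add_zero, ← hx]
        simp only [ex]; grind
      · rw [Nat.add_sub_cancel_left]; simp only [ex]; grind
    grind
  · intro f _
    have : ex T2 (rs T2 (fun i => ex (T1+T2) f (T1+i))) = fun i => ex (T1+T2) f (T1+i) := by
      ext i; simp only [ex, rs]; congr 1; ext; simp; try omega
    dsimp only
    rw [this]
    apply hC
    intro i hi
    rw [ex_rs _ _ _ hi]

lemma SW_succ (T : ℕ) (C : (ℕ → V) → V → ℝ)
    (hC : ∀ y y' z, (∀ i ≤ T, y i = y' i) → C y z = C y' z) :
    SW (T+1) (fun f => C f (f (T+1))) = SW T (fun y => ∑ v, C y v) := by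
  unfold SW
  rw [← Fintype.sum_prod_type', Fintype.sum_equiv
    ((Fin.snocEquiv (fun _ : Fin (T+2) => V)).symm.trans (Equiv.prodComm _ _)) _ (fun x => C (ex T x.1) x.2)]
  intro f
  simp only [Fin.snocEquiv, Equiv.trans_apply, Equiv.coe_fn_symm_mk, Equiv.prodComm_apply, Prod.swap_prod_mk]
  have : ex (T+1) f (T+1) = f (Fin.last (T+1)) := by simp only [ex]; congr 1; ext; simp
  rw [this]
  apply hC
  intro i hi
  simp only [ex, Fin.init]; congr 1; grind

lemma SW_zero (F : (ℕ → V) → ℝ) : SW 0 F = ∑ v, F (fun _ => v) := by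
  unfold SW
  rw [Fintype.sum_equiv (Equiv.funUnique (Fin 1) V) _ (fun v => F (fun _ => v))]
  intro f; congr 1; ext i; simp only [ex, Equiv.funUnique_apply]; simp

def Reg (G : SimpleGraph V) (D : ℝ) : Prop := ∀ v, ∑ u, ind (G.Adj v u) = D + 1

lemma NB_iff {G : SimpleGraph V} {T : ℕ} {f g : ℕ → V} (hfg : ∀ i ≤ T, f i = g i) :
    NB G T f ↔ NB G T g :=
  ⟨fun h => h.congr hfg, fun h => h.congr fun i hi => (hfg i hi).symm⟩

lemma NB_succ_succ {G : SimpleGraph V} {T : ℕ} {f : ℕ → V} :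
    NB G (T+2) f ↔ NB G (T+1) f ∧ G.Adj (f (T+1)) (f (T+2)) ∧ f (T+2) ≠ f T := by
  constructor
  · intro h; exact ⟨h.mono (by omega), h.1 (T+1) (by omega), h.2 T le_rfl⟩
  · rintro ⟨h, h1, h2⟩
    refine ⟨fun i hi => ?_, fun i hi => ?_⟩
    · rcases Nat.lt_or_ge i (T+1) with h' | h'
      · exact h.1 i h'
      grind
    · rcases Nat.lt_or_ge i T with h' | h'
      · exact h.2 i (by omega)
      grind

lemma NB_one {G : SimpleGraph V} {f : ℕ → V} : NB G 1 f ↔ G.Adj (f 0) (f 1) := by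
  constructor
  · intro h; exact h.1 0 (by omega)
  · intro h; refine ⟨fun i hi => ?_, fun i hi => by omega⟩
    grind

lemma NB_zero {G : SimpleGraph V} {f : ℕ → V} : NB G 0 f :=
  ⟨fun i hi => by omega, fun i hi => by omega⟩

lemma sum_adj_ne {G : SimpleGraph V} {D : ℝ} (hG : Reg G D) {x y : V} (h : G.Adj x y) :
    ∑ v, ind (G.Adj x v ∧ v ≠ y) = D := by
  have h1 := hG x
  rw [← add_sum_erase _ _ (mem_univ y), ind_true h] at h1
  rw [← add_sum_erase _ _ (mem_univ y), ind_false (by simp)]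
  have : ∑ v ∈ univ.erase y, ind (G.Adj x v ∧ v ≠ y) =
      ∑ v ∈ univ.erase y, ind (G.Adj x v) := by
    apply sum_congr rfl
    intro v hv
    rw [ind_and, ind_true (ne_of_mem_erase hv), mul_one]
  grind

lemma SW_NB_succ {G : SimpleGraph V} {D : ℝ} (hG : Reg G D) (T : ℕ) (F : (ℕ → V) → ℝ)
    (hF : ∀ y y', (∀ i ≤ T+1, y i = y' i) → F y = F y') :
    SW (T+2) (fun f => F f * ind (NB G (T+2) f)) = D * SW (T+1) (fun f => F f * ind (NB G (T+1) f)) := by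
  let C : (ℕ → V) → V → ℝ := fun y v => F y * ind (NB G (T+1) y) *
        ind (G.Adj (y (T+1)) v ∧ v ≠ y T)
  have h1 : SW (T+2) (fun f => F f * ind (NB G (T+2) f)) =
      SW (T+2) (fun f => C f (f (T+1+1))) := by
    apply SW_congr; intro f
    dsimp only [C]
    rw [NB_succ_succ, ind_and]; ring
  refine h1.trans ((SW_succ (T+1) C ?_).trans ?_)
  rotate_left
  · rw [← SW_const_mul]
    apply SW_congr; intro y
    simp only [C]
    rw [← mul_sum]
    by_cases h : NB G (T+1) y
    · rw [sum_adj_ne hG (h.1 T (by omega)).symm]; ring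
    · rw [ind_false h]; ring
  · intro y y' z h
    simp only [C]
    rw [hF y y' h, h T (by omega), h (T+1) le_rfl, NB_iff h]

lemma SW_NB_one {G : SimpleGraph V} {D : ℝ} (hG : Reg G D) (F : V → ℝ) :
    SW 1 (fun f => F (f 0) * ind (NB G 1 f)) = (D + 1) * ∑ v, F v := by
  let C : (ℕ → V) → V → ℝ := fun y v => F (y 0) * ind (G.Adj (y 0) v)
  have h1 : SW 1 (fun f => F (f 0) * ind (NB G 1 f)) =
      SW (0+1) (fun f => C f (f (0+1))) := by
    apply SW_congr; intro f; simp only [NB_one, zero_add, C]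
  refine h1.trans ((SW_succ 0 C ?_).trans ?_)
  rotate_left
  · rw [SW_zero, mul_sum]
    apply sum_congr rfl; intro v _
    simp only [C]
    rw [← mul_sum, hG]; ring
  grind

lemma count_NB {G : SimpleGraph V} {D : ℝ} (hG : Reg G D) (hD : 1 ≤ D) (a : V) (j : ℕ) :
    SW j (fun f => ind (f 0 = a) * ind (NB G j f)) ≤ 2 * D^j := by
  rcases j with _ | j
  · rw [SW_zero]
    simp only [ind_true NB_zero]
    simp [ind]
  induction j with
  | zero =>
    rw [SW_NB_one hG (fun v => ind (v = a))]
    simp [ind]; linarith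
  | succ j ih =>
    rw [SW_NB_succ hG j (fun f => ind (f 0 = a)) (by grind)]
    calc _ ≤ D * (2 * D^(j+1)) := by gcongr
      _ = _ := by ring

lemma count_two {G : SimpleGraph V} {K : ℕ} (hTF : TF G (3*K)) {j : ℕ} (hj : j ≤ K) (a b : V) :
    SW j (fun f => ind (f 0 = a ∧ f j = b ∧ NB G j f)) ≤ 2 := by
  have : SW j (fun f => ind (f 0 = a ∧ f j = b ∧ NB G j f)) =
      ((univ.filter (fun f : Fin (j+1) → V => ex j f 0 = a ∧ ex j f j = b ∧ NB G j (ex j f))).card : ℝ) := by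
    rw [card_filter]; push_cast; simp only [SW, ind]; congr!
  rw [this]
  by_contra hcon
  push Not at hcon
  have hcon : 2 < (univ.filter (fun f : Fin (j+1) → V => ex j f 0 = a ∧ ex j f j = b ∧ NB G j (ex j f))).card := by
    exact_mod_cast hcon
  rw [two_lt_card] at hcon
  obtain ⟨X, hX, Y, hY, Z, hZ, h1, h2, h3⟩ := hcon
  simp only [mem_filter, mem_univ, true_and] at hX hY hZ
  have key : ∀ A B : Fin (j+1) → V, (∀ i ≤ j, ex j A i = ex j B i) → A = B := by
    intro A B h
    rw [← rs_ex j A, ← rs_ex j B]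
    ext i; exact h i (by omega)
  rcases two_walks G K hTF j hj _ _ _ hX.2.2 hY.2.2 hZ.2.2 (by grind) (by grind)
    (by grind) (by grind) with h | h | h
  · exact h1 (key _ _ h)
  · exact h2 (key _ _ h)
  · exact h3 (key _ _ h)

variable {V : Type*} [Fintype V]

lemma if_eq_ind (p : Prop) (x : ℝ) : (if p then x else 0) = ind p * x := by
  unfold ind; simp

lemma inner_bd {G : SimpleGraph V} {K : ℕ} (hTF : TF G (3*K)) {r : ℕ} (hr : r ≤ K) (q : ℕ)
    (a : V) (S : Finset V) (B : (ℕ → V) → ℝ) (M : ℝ) (hM : 0 ≤ M)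
    (hBM : ∀ b, SW q (fun x => ind (x 0 = b) * B x) ≤ M) :
    SW (r+q) (fun z => ind (z 0 = a) * ind (z r ∈ S) * ind (NB G r z) * B (fun i => z (r+i))) ≤
      S.card * 2 * M := by
  let C : (ℕ → V) → (ℕ → V) → ℝ := fun y x =>
    ind (y 0 = a) * ind (y r ∈ S) * ind (NB G r y) * B x
  have h := SW_mul r q C (by
    intro y y' z h; simp only [C]; rw [h 0 (by omega), h r le_rfl, NB_iff h])
  refine h.le.trans ?_
  have h2 : SW r (fun y => SW q (fun z => if z 0 = y r then C y z else 0)) ≤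
      SW r (fun y => ∑ b ∈ S, ind (y 0 = a ∧ y r = b ∧ NB G r y) * M) := by
    apply SW_mono; intro y
    have h3 : SW q (fun z => if z 0 = y r then C y z else 0) =
        (ind (y 0 = a) * ind (y r ∈ S) * ind (NB G r y)) * SW q (fun x => ind (x 0 = y r) * B x) := by
      rw [← SW_const_mul]; apply SW_congr; intro x; rw [if_eq_ind]; simp only [C]; ring
    rw [h3, ← sum_mul]
    have h4 : ∑ b ∈ S, ind (y 0 = a ∧ y r = b ∧ NB G r y) =
        ind (y 0 = a) * ind (y r ∈ S) * ind (NB G r y) := by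
      simp only [ind_and]
      rw [← mul_sum, ← sum_mul]
      have : ∑ b ∈ S, ind (y r = b) = ind (y r ∈ S) := by
        simp [ind]
      rw [this]; ring
    rw [h4]
    exact mul_le_mul_of_nonneg_left (hBM _)
      (mul_nonneg (mul_nonneg (ind_nonneg _) (ind_nonneg _)) (ind_nonneg _))
  refine h2.trans ?_
  rw [SW_sum]
  calc _ ≤ ∑ b ∈ S, 2 * M := by
        apply sum_le_sum; intro b _
        rw [SW_mul_const]
        exact mul_le_mul_of_nonneg_right (count_two hTF hr a b) hM
    _ = _ := by simp; ring

lemma three_bd {G : SimpleGraph V} {D : ℝ} (hG : Reg G D) (hD : 1 ≤ D) {K : ℕ} (hTF : TF G (3*K))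
    {r : ℕ} (hr : r ≤ K) (t q : ℕ) (a : V) :
    SW (t+(r+q)) (fun f => ind (f 0 = a) * ind (NB G t f) *
      (ind (f (t+r) ∈ vs f t) * ind (NB G r (fun i => f (t+i))) *
        ind (NB G q (fun i => f (t+(r+i)))))) ≤ 2 * D^t * ((t+1) * 2 * (2 * D^q)) := by
  let C : (ℕ → V) → (ℕ → V) → ℝ := fun y z =>
    ind (y 0 = a) * ind (NB G t y) * (ind (z r ∈ vs y t) * ind (NB G r z) *
        ind (NB G q (fun i => z (r+i))))
  have h := SW_mul t (r+q) C (by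
    intro y y' z h; simp only [C]; rw [h 0 (by omega), vs_congr h, NB_iff h])
  refine h.le.trans ?_
  have h2 : ∀ y, SW (r+q) (fun z => if z 0 = y t then C y z else 0) ≤
      ind (y 0 = a) * ind (NB G t y) * ((t+1) * 2 * (2 * D^q)) := by
    intro y
    have h3 : SW (r+q) (fun z => if z 0 = y t then C y z else 0) =
        ind (y 0 = a) * ind (NB G t y) * SW (r+q) (fun z => ind (z 0 = y t) * ind (z r ∈ vs y t) *
          ind (NB G r z) * ind (NB G q (fun i => z (r+i)))) := by
      rw [← SW_const_mul]; apply SW_congr; intro x; rw [if_eq_ind]; simp only [C]; ring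
    rw [h3]
    refine mul_le_mul_of_nonneg_left ?_ (mul_nonneg (ind_nonneg _) (ind_nonneg _))
    refine (inner_bd hTF hr q (y t) (vs y t) (fun x => ind (NB G q x)) (2 * D^q) (by positivity)
      (fun b => count_NB hG hD b q)).trans ?_
    have : ((vs y t).card : ℝ) ≤ t+1 := by exact_mod_cast card_vs_le y t
    gcongr
  refine (SW_mono h2).trans ?_
  rw [SW_mul_const]
  gcongr
  exact count_NB hG hD a t

lemma psi {G : SimpleGraph V} {D : ℝ} (hG : Reg G D) (hD : 1 ≤ D) {K : ℕ} (hTF : TF G (3*K))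
    {j : ℕ} (hj : j ≤ K) (z : V) :
    SW j (fun f => ind (f 0 = z) * (ind (NB G j f) * (D⁻¹)^(vs f j).card)) ≤
      D⁻¹ * (10 * (K+1)^3) := by
  have hw : 0 < D⁻¹ := by positivity
  let P : ℕ → ℕ → (ℕ → V) → ℝ := fun t s f =>
    (D⁻¹)^((t+1)+(j-s)) * (ind (f 0 = z) * ind (NB G t f) *
      (ind (f (t+(s-t)) ∈ vs f t) * ind (NB G (s-t) (fun i => f (t+i))) *
        ind (NB G (j-s) (fun i => f (t+((s-t)+i))))))
  have hP0 : ∀ t s f, 0 ≤ P t s f := by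
    intro t s f
    simp only [P]
    have := ind_nonneg
    refine mul_nonneg (by positivity) (mul_nonneg (mul_nonneg (this _) (this _))
      (mul_nonneg (mul_nonneg (this _) (this _)) (this _)))
  have hpt : ∀ f : ℕ → V, ind (f 0 = z) * (ind (NB G j f) * (D⁻¹)^(vs f j).card) ≤
      ind (f 0 = z) * ind (NB G j f) * (D⁻¹)^(j+1) +
      ∑ t ∈ range j, ∑ s ∈ (range (j+1)).filter (fun s => t < s), P t s f := by
    intro f
    have hS : 0 ≤ ∑ t ∈ range j, ∑ s ∈ (range (j+1)).filter (fun s => t < s), P t s f :=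
      sum_nonneg fun t _ => sum_nonneg fun s _ => hP0 t s f
    have hA : 0 ≤ ind (f 0 = z) * ind (NB G j f) * (D⁻¹)^(j+1) :=
      mul_nonneg (mul_nonneg (ind_nonneg _) (ind_nonneg _)) (by positivity)
    by_cases h0 : f 0 = z
    swap
    · rw [ind_false h0]; grind
    by_cases h1 : NB G j f
    swap
    · rw [ind_false h1]; grind
    rcases struct f j (fun i hi => (h1.1 i hi).ne) h1.2 (hTF j (by omega) f h1.1) with h | h
    · rw [card_vs_inj f j h, ← mul_assoc]; linarith
    · obtain ⟨t, s, ht1, hts, hsj, ha, hb, hc, hd, _⟩ := h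
      have h2 : P t s f = (D⁻¹)^(vs f j).card := by
        simp only [P]
        have e : t + (s-t) = s := by omega
        have n1 : NB G t f := h1.mono (by omega)
        have n2 : NB G (s-t) (fun i => f (t+i)) := by
          refine NB.shift (h1.mono ?_); omega
        have n3 : NB G (j-s) (fun i => f (t+((s-t)+i))) := by
          simp only [← add_assoc, e]; refine NB.shift (h1.mono ?_); omega
        have n4 : f (t+(s-t)) ∈ vs f t := by rw [e]; exact hb s hts le_rfl
        rw [ind_true h0, ind_true n1, ind_true n2, ind_true n3, ind_true n4, hd]; ring
      rw [ind_true h0, ind_true h1]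
      have h3 : P t s f ≤ ∑ t ∈ range j, ∑ s ∈ (range (j+1)).filter (fun s => t < s), P t s f := by
        refine le_trans ?_ (single_le_sum (f := fun t => ∑ s ∈ (range (j+1)).filter (fun s => t < s), P t s f)
          (fun t _ => sum_nonneg fun s _ => hP0 t s f) (mem_range.2 (show t < j by omega)))
        exact single_le_sum (f := fun s => P t s f) (fun s _ => hP0 t s f)
          (by simp; omega)
      rw [h2] at h3
      have : 0 ≤ (D⁻¹)^(j+1) := by positivity
      linarith
  refine (SW_mono hpt).trans ?_
  rw [SW_add, SW_mul_const, SW_sum]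
  have hA : SW j (fun f => ind (f 0 = z) * ind (NB G j f)) * (D⁻¹)^(j+1) ≤ D⁻¹ * 2 := by
    calc _ ≤ 2 * D^j * (D⁻¹)^(j+1) := by gcongr; exact count_NB hG hD z j
      _ = D⁻¹ * 2 := by rw [inv_pow, pow_succ]; field_simp
  have hB : ∀ t ∈ range j, ∀ s ∈ (range (j+1)).filter (fun s => t < s),
      SW j (P t s) ≤ D⁻¹ * (8 * (K+1)) := by
    intro t ht s hs
    simp only [mem_filter, mem_range] at ht hs
    simp only [P]
    rw [SW_const_mul]
    have e : t + ((s-t) + (j-s)) = j := by omega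
    have h3 := three_bd hG hD hTF (r := s-t) (by omega) t (j-s) z
    rw [e] at h3
    have htK : (t:ℝ) ≤ K := by exact_mod_cast (by omega : t ≤ K)
    calc _ ≤ (D⁻¹)^((t+1)+(j-s)) * (2 * D^t * ((t+1) * 2 * (2 * D^(j-s)))) := by gcongr
      _ = D⁻¹ * (8 * (t+1)) := by simp only [inv_pow, pow_add]; field_simp; ring
      _ ≤ _ := by gcongr
  have hB2 : ∑ t ∈ range j, SW j (fun f => ∑ s ∈ (range (j+1)).filter (fun s => t < s), P t s f)
      ≤ ∑ t ∈ range j, ((K:ℝ)+1) * (D⁻¹ * (8 * (K+1))) := by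
    apply sum_le_sum; intro t ht
    rw [SW_sum]
    refine (sum_le_sum (hB t ht)).trans ?_
    rw [sum_const, nsmul_eq_mul]
    have : (((range (j+1)).filter (fun s => t < s)).card : ℝ) ≤ K+1 := by
      have := card_filter_le (range (j+1)) (fun s => t < s)
      rw [card_range] at this
      exact_mod_cast (by omega : _ ≤ K+1)
    gcongr
  rw [sum_const, card_range, nsmul_eq_mul] at hB2
  have hjK : (j:ℝ) ≤ K+1 := by exact_mod_cast (by omega : j ≤ K+1)
  have hK1 : (1:ℝ) ≤ K + 1 := by have : (0:ℝ) ≤ K := by positivity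
                                 linarith
  have hK3 : (1:ℝ) ≤ (K + 1)^3 := one_le_pow₀ hK1
  calc _ ≤ D⁻¹ * 2 + (j:ℝ) * (((K:ℝ)+1) * (D⁻¹ * (8 * (K+1)))) := add_le_add hA hB2
    _ ≤ D⁻¹ * 2 + ((K:ℝ)+1) * (((K:ℝ)+1) * (D⁻¹ * (8 * (K+1)))) := by gcongr
    _ = D⁻¹ * (2 + 8 * (K+1)^3) := by ring
    _ ≤ _ := by gcongr; linarith

lemma block {G : SimpleGraph V} {D : ℝ} (hG : Reg G D) (hD : 1 ≤ D) {K : ℕ} (hTF : TF G (3*K))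
    (S : Finset V) (a : V) (haS : a ∈ S) :
    SW K (fun f => ind (f 0 = a) * (ind (NB G K f) * (D⁻¹)^(vs f K \ S).card)) ≤
      S.card * (20 * (K+1)^4) := by
  have hw : 0 < D⁻¹ := by positivity
  have hw1 : D⁻¹ ≤ 1 := inv_le_one_of_one_le₀ hD
  let P : ℕ → (ℕ → V) → ℝ := fun t f =>
    D * (ind (f 0 = a) * ind (f t ∈ S) * ind (NB G t f) *
      (ind (NB G (K-t) (fun i => f (t+i))) * (D⁻¹)^(vs (fun i => f (t+i)) (K-t)).card))
  have hP0 : ∀ t f, 0 ≤ P t f := by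
    intro t f
    have := ind_nonneg
    exact mul_nonneg (by linarith) (mul_nonneg (mul_nonneg (mul_nonneg (this _) (this _)) (this _))
      (mul_nonneg (this _) (by positivity)))
  have hpt : ∀ f : ℕ → V, ind (f 0 = a) * (ind (NB G K f) * (D⁻¹)^(vs f K \ S).card) ≤
      ∑ t ∈ range (K+1), P t f := by
    intro f
    have hS : 0 ≤ ∑ t ∈ range (K+1), P t f := sum_nonneg fun t _ => hP0 t f
    by_cases h0 : f 0 = a
    swap
    · rw [ind_false h0]; grind
    by_cases h1 : NB G K f
    swap
    · rw [ind_false h1]; grind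
    have hne : ((range (K+1)).filter (fun t => f t ∈ S)).Nonempty :=
      ⟨0, by grind⟩
    obtain ⟨t, ht, hmax⟩ := exists_max_image _ id hne
    simp only [mem_filter, mem_range, id] at ht hmax
    have hlast : ∀ i, t < i → i ≤ K → f i ∉ S := by
      intro i hi hiK hS
      have := hmax i ⟨by omega, hS⟩
      omega
    have hcard : (vs (fun i => f (t+i)) (K-t)).card ≤ (vs f K \ S).card + 1 := by
      have hsub : vs (fun i => f (t+i)) (K-t) ⊆ insert (f t) (vs f K \ S) := by
        intro x hx
        rw [mem_vs] at hx
        obtain ⟨i, hi, rfl⟩ := hx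
        rcases Nat.eq_zero_or_pos i with rfl | hi0
        · simp
        · refine mem_insert_of_mem (mem_sdiff.2 ⟨mem_vs_self (by omega), hlast _ (by omega) (by omega)⟩)
      exact (card_le_card hsub).trans (card_insert_le _ _)
    have hPt : (D⁻¹)^(vs f K \ S).card ≤ P t f := by
      simp only [P]
      have n3 : NB G (K-t) (fun i => f (t+i)) := NB.shift (h1.mono (by omega))
      rw [ind_true h0, ind_true ht.2, ind_true (h1.mono (by omega)), ind_true n3]
      have : (D⁻¹)^((vs f K \ S).card+1) ≤ (D⁻¹)^(vs (fun i => f (t+i)) (K-t)).card :=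
        pow_le_pow_of_le_one hw.le hw1 hcard
      calc _ = D * (D⁻¹)^((vs f K \ S).card+1) := by grind
        _ ≤ _ := by simp_all
    rw [ind_true h0, ind_true h1, one_mul, one_mul]
    exact hPt.trans (single_le_sum (f := fun t => P t f) (fun t _ => hP0 t f) (by simp; omega))
  refine (SW_mono hpt).trans ?_
  rw [SW_sum]
  have hB : ∀ t ∈ range (K+1), SW K (P t) ≤ S.card * (20 * (K+1)^3) := by
    intro t ht
    simp only [mem_range] at ht
    simp only [P]
    rw [SW_const_mul]
    have := inner_bd hTF (r := t) (by omega) (K-t) a S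
      (fun x => ind (NB G (K-t) x) * (D⁻¹)^(vs x (K-t)).card) (D⁻¹ * (10 * (K+1)^3)) (by positivity)
      (fun b => psi hG hD hTF (by omega) b)
    rw [show t + (K-t) = K by omega] at this
    calc _ ≤ D * (S.card * 2 * (D⁻¹ * (10 * (K+1)^3))) := by gcongr
      _ = _ := by grind
  refine (sum_le_sum hB).trans ?_
  rw [sum_const, card_range, nsmul_eq_mul]; grind

def Blk (G : SimpleGraph V) (K B : ℕ) (f : ℕ → V) : Prop := ∀ b < B, NB G K (fun i => f (b*K+i))

lemma Blk.isW {G : SimpleGraph V} {K B : ℕ} {f : ℕ → V} (h : Blk G K B f) : IsW G (B*K) f := by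
  intro i hi
  rcases Nat.eq_zero_or_pos K with rfl | hK
  · omega
  have h1 := (h (i / K) (Nat.div_lt_of_lt_mul (by grind))).1 (i % K) (Nat.mod_lt _ hK)
  have e : i / K * K + i % K = i := Nat.div_add_mod' i K
  grind

lemma Blk_iff {G : SimpleGraph V} {K B : ℕ} {f g : ℕ → V} (hfg : ∀ i ≤ B*K, f i = g i) :
    Blk G K B f ↔ Blk G K B g := by
  unfold Blk
  refine forall_congr' fun b => forall_congr' fun hb => NB_iff fun i hi => hfg _ ?_
  have : (b+1)*K ≤ B*K := Nat.mul_le_mul_right K hb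
  grind

lemma Blk_succ {G : SimpleGraph V} {K B : ℕ} {f : ℕ → V} :
    Blk G K (B+1) f ↔ Blk G K B f ∧ NB G K (fun i => f (B*K+i)) := by
  unfold Blk
  constructor
  · intro h; exact ⟨fun b hb => h b (by omega), h B (by omega)⟩
  · rintro ⟨h1, h2⟩ b hb
    rcases Nat.lt_or_ge b B with h | h
    · exact h1 b h
    grind

lemma blocks {G : SimpleGraph V} {D : ℝ} (hG : Reg G D) (hD : 1 ≤ D) {K : ℕ} (hTF : TF G (3*K))
    (a : V) (B0 B : ℕ) (hB : B ≤ B0) :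
    SW (B*K) (fun f => ind (f 0 = a) * ind (Blk G K B f) * (D⁻¹)^(vs f (B*K)).card) ≤
      D⁻¹ * ((B0*K+1) * (20 * (K+1)^4))^B := by
  have hw : 0 < D⁻¹ := by positivity
  induction B with
  | zero =>
    rw [zero_mul, SW_zero]
    simp only [pow_zero, mul_one, vs_zero, card_singleton, pow_one]
    rw [← sum_mul]
    have : ∑ i : V, ind (i = a) * ind (Blk G K 0 fun _ => i) = 1 := by
      have h : ∀ i : V, ind (Blk G K 0 fun _ => i) = 1 := fun i => ind_true (fun b hb => by omega)
      simp only [h]; simp [ind]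
    simp_all
  | succ B ih =>
    have ih := ih (by omega)
    let C : (ℕ → V) → (ℕ → V) → ℝ := fun y z =>
      ind (y 0 = a) * ind (Blk G K B y) * (D⁻¹)^(vs y (B*K)).card *
        (ind (NB G K z) * (D⁻¹)^(vs z K \ vs y (B*K)).card)
    have h := SW_mul (B*K) K C (by
      intro y y' z h; simp only [C]; rw [h 0 (by omega), vs_congr h, Blk_iff h])
    have h1 : SW ((B+1)*K) (fun f => ind (f 0 = a) * ind (Blk G K (B+1) f) * (D⁻¹)^(vs f ((B+1)*K)).card)
        = SW (B*K+K) (fun f => C f (fun i => f (B*K+i))) := by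
      rw [add_mul, one_mul]
      apply SW_congr; intro f
      simp only [C]
      rw [Blk_succ, ind_and]
      have : (vs f (B*K+K)).card = (vs f (B*K)).card + (vs (fun i => f (B*K+i)) K \ vs f (B*K)).card := by
        rw [add_comm (vs f (B*K)).card, card_sdiff_add_card]
        congr 1
        ext x
        simp only [mem_vs, mem_union]
        constructor
        · rintro ⟨i, hi, rfl⟩
          rcases Nat.lt_or_ge i (B*K) with h | h
          · grind
          · exact Or.inl ⟨i - B*K, by omega, by grind⟩
        · grind
      rw [this, pow_add]; ring
    rw [h1, h]
    have h2 : ∀ y, SW K (fun z => if z 0 = y (B*K) then C y z else 0) ≤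
        (ind (y 0 = a) * ind (Blk G K B y) * (D⁻¹)^(vs y (B*K)).card) * ((B0*K+1) * (20 * (K+1)^4)) := by
      intro y
      have h3 : SW K (fun z => if z 0 = y (B*K) then C y z else 0) =
          (ind (y 0 = a) * ind (Blk G K B y) * (D⁻¹)^(vs y (B*K)).card) *
          SW K (fun z => ind (z 0 = y (B*K)) * (ind (NB G K z) * (D⁻¹)^(vs z K \ vs y (B*K)).card)) := by
        rw [← SW_const_mul]; apply SW_congr; intro x; rw [if_eq_ind]; simp only [C]; ring
      rw [h3]
      refine mul_le_mul_of_nonneg_left ?_ (mul_nonneg (mul_nonneg (ind_nonneg _) (ind_nonneg _)) (by positivity))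
      refine (block hG hD hTF (vs y (B*K)) (y (B*K)) (mem_vs_self le_rfl)).trans ?_
      have h5 : (vs y (B*K)).card ≤ B0*K+1 := (card_vs_le _ _).trans (by gcongr; omega)
      have h6 : ((vs y (B*K)).card : ℝ) ≤ B0*K+1 := by exact_mod_cast h5
      gcongr
    refine (SW_mono h2).trans ?_
    rw [SW_mul_const, pow_succ _ B, ← mul_assoc D⁻¹]
    refine mul_le_mul_of_nonneg_right ih ?_
    positivity

def SF (T : ℕ) (f : ℕ → V) : Prop :=
  ∀ i < T, ∃ i' < T, i' ≠ i ∧ ((f i' = f i ∧ f (i'+1) = f (i+1)) ∨ (f i' = f (i+1) ∧ f (i'+1) = f i))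

lemma SF_card {T : ℕ} {f : ℕ → V} (h : SF T f) : (ds f T).card ≤ T := by
  let r : V × V → ℕ → Prop := fun p i => p = (f i, f (i+1)) ∨ p = (f (i+1), f i)
  have h1 := sum_card_bipartiteAbove_eq_sum_card_bipartiteBelow (s := ds f T)
    (t := range T) r
  have h2 : ∀ p ∈ ds f T, 2 ≤ ((range T).bipartiteAbove r p).card := by
    intro p hp
    rw [mem_ds] at hp
    obtain ⟨i, hi, hp⟩ := hp
    obtain ⟨i', hi', hne, h'⟩ := h i hi
    have : ({i, i'} : Finset ℕ) ⊆ (range T).bipartiteAbove r p := by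
      intro x hx
      simp only [mem_insert, mem_singleton] at hx
      rw [mem_bipartiteAbove]
      rcases hx with rfl | rfl
      · grind
      · grind
    have := card_le_card this
    rwa [card_pair hne.symm] at this
  have h3 : ∀ i ∈ range T, ((ds f T).bipartiteBelow r i).card ≤ 2 := by
    intro i _
    have : (ds f T).bipartiteBelow r i ⊆ {(f i, f (i+1)), (f (i+1), f i)} := by
      intro p hp
      rw [mem_bipartiteBelow] at hp
      simpa [r] using hp.2
    exact (card_le_card this).trans card_le_two
  have h4 := sum_le_sum h2
  have h5 := sum_le_sum h3
  simp only [sum_const, smul_eq_mul, card_range] at h4 h5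
  omega

lemma count_SF {G : SimpleGraph V} {D : ℝ} (hG : Reg G D) (hD : 1 ≤ D) {K : ℕ} (hTF : TF G (3*K))
    (m : ℕ) :
    SW (2*m*K) (fun f => ind (f (2*m*K) = f 0 ∧ Blk G K (2*m) f ∧ SF (2*m*K) f)) ≤
      Fintype.card V * (D^(m*K) * (((2*m:ℕ)*K+1) * (20 * (K+1)^4))^(2*m)) := by
  have hw : 0 < D⁻¹ := by positivity
  have hpt : ∀ f : ℕ → V, ind (f (2*m*K) = f 0 ∧ Blk G K (2*m) f ∧ SF (2*m*K) f) ≤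
      ∑ a : V, D^(m*K+1) * (ind (f 0 = a) * ind (Blk G K (2*m) f) * (D⁻¹)^(vs f (2*m*K)).card) := by
    intro f
    have e : ∑ a : V, D^(m*K+1) * (ind (f 0 = a) * ind (Blk G K (2*m) f) * (D⁻¹)^(vs f (2*m*K)).card)
        = D^(m*K+1) * (ind (Blk G K (2*m) f) * (D⁻¹)^(vs f (2*m*K)).card) := by
      rw [← mul_sum]; simp only [mul_assoc]; rw [← sum_mul]
      have : ∑ a : V, ind (f 0 = a) = 1 := by simp [ind]
      rw [this, one_mul]
    rw [e]
    by_cases h : (f (2*m*K) = f 0 ∧ Blk G K (2*m) f ∧ SF (2*m*K) f)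
    · rw [ind_true h, ind_true h.2.1, one_mul]
      have h1 := SF_card h.2.2
      have h2 := card_ds f (2*m*K) (fun i hi => (h.2.1.isW i hi).ne)
      have h3 : (vs f (2*m*K)).card ≤ m*K+1 := by
        have : 2*m*K = 2*(m*K) := by ring
        omega
      have h4 := pow_le_pow_right₀ hD h3
      rw [inv_pow, ← div_eq_mul_inv, one_le_div (by positivity)]
      exact h4
    · rw [ind_false h]
      exact mul_nonneg (by positivity) (mul_nonneg (ind_nonneg _) (by positivity))
  refine (SW_mono hpt).trans ?_
  rw [SW_sum]
  have : ∀ a ∈ (univ : Finset V), SW (2*m*K) (fun f => D^(m*K+1) * (ind (f 0 = a) * ind (Blk G K (2*m) f) * (D⁻¹)^(vs f (2*m*K)).card))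
      ≤ D^(m*K) * (((2*m:ℕ)*K+1) * (20 * (K+1)^4))^(2*m) := by
    intro a _
    rw [SW_const_mul]
    calc _ ≤ D^(m*K+1) * (D⁻¹ * (((2*m:ℕ)*K+1) * (20 * (K+1)^4))^(2*m)) := by
          gcongr; exact blocks hG hD hTF a (2*m) (2*m) le_rfl
      _ = _ := by grind
  refine (sum_le_sum this).trans ?_
  simp

variable {V : Type*} [Fintype V]

def Am (G : SimpleGraph V) : Matrix V V ℝ := fun a b => ind (G.Adj a b)
def Qm (G : SimpleGraph V) (k : ℕ) : Matrix V V ℝ := fun a b =>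
  SW k (fun f => ind (f 0 = a ∧ f k = b) * ind (NB G k f))

lemma sum_ind_mul (a : V) (F : V → ℝ) : ∑ v, ind (v = a) * F v = F a := by
  simp [ind]
lemma sum_ind_mul' (a : V) (F : V → ℝ) : ∑ v, ind (a = v) * F v = F a := by
  simp [ind]

lemma one_ind [DecidableEq V] (a b : V) : (1 : Matrix V V ℝ) a b = ind (a = b) := by
  rw [Matrix.one_apply, ind]; simp

lemma Qm_zero [DecidableEq V] (G : SimpleGraph V) : Qm G 0 = 1 := by
  ext a b
  simp only [Qm]
  rw [SW_zero]
  simp only [ind_true NB_zero, mul_one, ind_and]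
  rw [sum_ind_mul a (fun v => ind (v = b)), one_ind]

lemma Qm_one (G : SimpleGraph V) : Qm G 1 = Am G := by
  ext a b
  simp only [Qm]
  let C : (ℕ → V) → V → ℝ := fun y v => ind (y 0 = a) * (ind (v = b) * ind (G.Adj (y 0) v))
  have h1 : SW 1 (fun f => ind (f 0 = a ∧ f 1 = b) * ind (NB G 1 f)) =
      SW (0+1) (fun f => C f (f (0+1))) := by
    apply SW_congr; intro f; simp only [NB_one, C, ind_and, zero_add]; ring
  rw [h1, SW_succ 0 C (by grind), SW_zero]
  simp only [C]
  simp only [← mul_sum]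
  rw [sum_ind_mul a, sum_ind_mul b]; rfl

lemma Qm_step {G : SimpleGraph V} (T : ℕ) :
    Qm G (T+2) = Qm G (T+1) * Am G - (Matrix.of fun a b =>
      SW (T+1) (fun f => ind (f 0 = a ∧ f T = b) * ind (NB G (T+1) f))) := by
  ext a b
  rw [Matrix.sub_apply, Matrix.mul_apply, Matrix.of_apply]
  simp only [Qm]
  let C : (ℕ → V) → V → ℝ := fun y v => ind (v = b) * (ind (y 0 = a) * ind (NB G (T+1) y) *
        ind (G.Adj (y (T+1)) v ∧ v ≠ y T))
  have h1 : SW (T+2) (fun f => ind (f 0 = a ∧ f (T+2) = b) * ind (NB G (T+2) f)) =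
      SW (T+1+1) (fun f => C f (f (T+1+1))) := by
    apply SW_congr; intro f
    simp only [C]
    rw [NB_succ_succ, ind_and, ind_and (NB G (T+1) f)]; ring
  rw [h1, SW_succ (T+1) C]
  · simp only [Am, ← SW_mul_const, ← SW_sum]
    rw [← SW_sub]
    apply SW_congr; intro f
    simp only [C]
    rw [sum_ind_mul b]
    have : ∑ i, ind (f 0 = a ∧ f (T+1) = i) * ind (NB G (T+1) f) * ind (G.Adj i b) =
        ind (f 0 = a) * ind (NB G (T+1) f) * ind (G.Adj (f (T+1)) b) := by
      rw [← sum_ind_mul' (f (T+1)) (fun i => ind (f 0 = a) * ind (NB G (T+1) f) * ind (G.Adj i b))]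
      apply sum_congr rfl; intro i _; rw [ind_and]; ring
    rw [this]
    by_cases hN : NB G (T+1) f
    · rw [ind_and, ind_and]
      by_cases hb : b = f T
      · rw [ind_false (not_not.2 hb), ind_true hb.symm, hb, ind_true (hN.1 T (by omega)).symm]; ring
      · rw [ind_true (show b ≠ f T from hb), ind_false (show ¬ f T = b from fun h => hb h.symm)]; ring
    · rw [ind_false hN]; ring
  · intro y y' z h
    simp only [C]
    rw [h 0 (by omega), h T (by omega), h (T+1) le_rfl, NB_iff h]

lemma Qm_two [DecidableEq V] {G : SimpleGraph V} {D : ℝ} (hG : Reg G D) :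
    Qm G 2 = Am G * Am G - (D+1) • (1 : Matrix V V ℝ) := by
  rw [Qm_step 0, zero_add, Qm_one]
  congr 1
  ext a b
  rw [Matrix.of_apply, SW_NB_one hG (fun v => ind (v = a ∧ v = b))]
  simp only [ind_and]
  rw [sum_ind_mul a (fun v => ind (v = b)), Matrix.smul_apply, one_ind, smul_eq_mul]

lemma Qm_rec {G : SimpleGraph V} {D : ℝ} (hG : Reg G D) (k : ℕ) :
    Qm G (k+3) = Qm G (k+2) * Am G - D • Qm G (k+1) := by
  rw [Qm_step (k+1)]
  congr 1
  ext a b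
  rw [Matrix.of_apply, Matrix.smul_apply, smul_eq_mul]
  exact SW_NB_succ hG k (fun f => ind (f 0 = a ∧ f (k+1) = b))
    (by grind)

open Polynomial in
def qp (D : ℝ) : ℕ → Polynomial ℝ
  | 0 => 1
  | 1 => X
  | 2 => X * X - C (D+1)
  | (k+3) => qp D (k+2) * X - C D * qp D (k+1)

lemma Qm_eq [DecidableEq V] {G : SimpleGraph V} {D : ℝ} (hG : Reg G D) (k : ℕ) :
    Qm G k = Polynomial.aeval (Am G) (qp D k) := by
  induction k using Nat.strong_induction_on with
  | _ k ih =>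
    match k with
    | 0 => simp [qp, Qm_zero]
    | 1 => simp [qp, Qm_one]
    | 2 =>
      simp only [qp, map_sub, map_mul, Polynomial.aeval_X, Polynomial.aeval_C]
      rw [Qm_two hG, Algebra.algebraMap_eq_smul_one]
    | (k+3) =>
      rw [Qm_rec hG, ih (k+2) (by omega), ih (k+1) (by omega)]
      simp only [qp, map_sub, map_mul, Polynomial.aeval_X, Polynomial.aeval_C]
      rw [Algebra.smul_def]

lemma trace_Qm (G : SimpleGraph V) (k : ℕ) :
    (Qm G k).trace = SW k (fun f => ind (f k = f 0 ∧ NB G k f)) := by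
  simp only [Matrix.trace, Matrix.diag, Qm]
  rw [← SW_sum]
  apply SW_congr; intro f
  rw [← sum_mul, ind_and]
  congr 1
  simp only [ind_and]
  rw [sum_ind_mul' (f 0) (fun v => ind (f k = v))]

lemma Qm_powC (G : SimpleGraph V) (K B : ℕ) (a b : V) :
    (Qm G K ^ B) a b = SW (B*K) (fun f => ind (f 0 = a ∧ f (B*K) = b) * ind (Blk G K B f)) := by
  induction B generalizing b with
  | zero =>
    rw [pow_zero, zero_mul, SW_zero]
    have h : ∀ i : V, ind (Blk G K 0 fun _ => i) = 1 := fun i => ind_true (fun b hb => by omega)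
    simp only [h, mul_one, ind_and]
    rw [sum_ind_mul a (fun v => ind (v = b)), one_ind]
  | succ B ih =>
    rw [pow_succ, Matrix.mul_apply]
    let C : (ℕ → V) → (ℕ → V) → ℝ := fun y z =>
      ind (y 0 = a) * ind (Blk G K B y) * (ind (z K = b) * ind (NB G K z))
    have h := SW_mul (B*K) K C (by
      intro y y' z h; simp only [C]; rw [h 0 (by omega), Blk_iff h])
    have h1 : SW ((B+1)*K) (fun f => ind (f 0 = a ∧ f ((B+1)*K) = b) * ind (Blk G K (B+1) f))
        = SW (B*K+K) (fun f => C f (fun i => f (B*K+i))) := by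
      rw [add_mul, one_mul]
      apply SW_congr; intro f
      simp only [C]
      rw [Blk_succ, ind_and, ind_and]; ring
    rw [h1, h]
    simp only [ih]
    simp only [← SW_mul_const, ← SW_sum]
    apply SW_congr; intro y
    have h2 : SW K (fun z => if z 0 = y (B*K) then C y z else 0) =
        ind (y 0 = a) * ind (Blk G K B y) * Qm G K (y (B*K)) b := by
      simp only [Qm]
      rw [← SW_const_mul]; apply SW_congr; intro z; rw [if_eq_ind]; simp only [C]
      rw [ind_and]; ring
    rw [h2, ← sum_ind_mul' (y (B*K)) (fun j => ind (y 0 = a) * ind (Blk G K B y) * Qm G K j b)]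
    apply sum_congr rfl; intro i _; rw [ind_and]; ring

lemma Qm_pow [DecidableEq V] (G : SimpleGraph V) (K B : ℕ) (a b : V) :
    (Qm G K ^ B) a b = SW (B*K) (fun f => ind (f 0 = a ∧ f (B*K) = b) * ind (Blk G K B f)) := by
  rw [← Qm_powC]
  congr!

lemma trace_Qm_pow [DecidableEq V] (G : SimpleGraph V) (K B : ℕ) :
    (Qm G K ^ B).trace = SW (B*K) (fun f => ind (f (B*K) = f 0 ∧ Blk G K B f)) := by
  simp only [Matrix.trace, Matrix.diag, Qm_pow]
  rw [← SW_sum]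
  apply SW_congr; intro f
  rw [← sum_mul, ind_and]
  congr 1
  simp only [ind_and]
  rw [sum_ind_mul' (f 0) (fun v => ind (f (B*K) = v))]
variable {ℓ : ℕ}
def Anti (s : V → V → PF ℓ) : Prop := ∀ u v, s v u = (s u v)⁻¹

lemma lift_adj (G : SimpleGraph V) {s : V → V → PF ℓ} (hs : Anti s)
    (p q : V × Fin ℓ) : (liftGraph G s).Adj p q ↔ G.Adj p.1 q.1 ∧ q.2 = s p.1 q.1 p.2 := by
  unfold liftGraph
  rw [SimpleGraph.fromRel_adj]
  constructor
  · rintro ⟨hne, h | h⟩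
    · exact h
    · refine ⟨h.1.symm, ?_⟩
      rw [h.2, hs q.1 p.1]; simp
  · intro h
    exact ⟨fun e => h.1.ne (by rw [e]), Or.inl h⟩

def hol (s : V → V → PF ℓ) (f : ℕ → V) : ℕ → PF ℓ
  | 0 => 1
  | i+1 => s (f i) (f (i+1)) * hol s f i

def fixN (σ : PF ℓ) : ℝ := ∑ x, ind (σ x = x)

def Fol (s : V → V → PF ℓ) (T : ℕ) (p : ℕ → V × Fin ℓ) : Prop :=
  ∀ i < T, (p (i+1)).2 = s (p i).1 (p (i+1)).1 (p i).2

lemma hol_congr (s : V → V → PF ℓ) {f g : ℕ → V} :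
    ∀ {T : ℕ}, (∀ i ≤ T, f i = g i) → hol s f T = hol s g T
  | 0, _ => rfl
  | T+1, h => by
    simp only [hol]
    rw [hol_congr s (fun i hi => h i (by omega)), h T (by omega), h (T+1) le_rfl]

lemma Fol_hol {s : V → V → PF ℓ} {T : ℕ} {p : ℕ → V × Fin ℓ} (h : Fol s T p) :
    ∀ i ≤ T, (p i).2 = hol s (fun j => (p j).1) i (p 0).2 := by
  intro i
  induction i with
  | zero => intro _; rfl
  | succ i ih => intro hi; rw [h i (by omega), ih (by omega)]; rfl

lemma SW_lift (s : V → V → PF ℓ) (T : ℕ) (C : (ℕ → V × Fin ℓ) → ℝ)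
    (hC : ∀ p p', (∀ i ≤ T, p i = p' i) → C p = C p') :
    SW T (fun p => ind (Fol s T p) * C p) = SW T (fun f => ∑ x, C (fun i => (f i, hol s f i x))) := by
  unfold SW
  rw [← Fintype.sum_prod_type']
  simp only [← if_eq_ind]
  rw [← sum_filter]
  refine sum_bij' (fun p _ => (fun i => (p i).1, (p 0).2))
    (fun x _ => rs T (fun i => (ex T x.1 i, hol s (ex T x.1) i x.2))) ?_ ?_ ?_ ?_ ?_
  · intros; simp
  · rintro ⟨f, x⟩ _
    simp only [mem_filter, mem_univ, true_and]
    intro i hi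
    rw [ex_rs _ _ _ (by omega), ex_rs _ _ _ (by omega)]; rfl
  · intro p hp
    simp only [mem_filter, mem_univ, true_and] at hp
    ext1 i
    have h1 := Fol_hol hp i (by omega)
    have h2 : ex T p i = p i := congrFun (rs_ex T p) i
    simp only [rs]
    rw [← h2]
    refine Prod.ext rfl ?_
    rw [h1]; rfl
  · rintro ⟨f, x⟩ _
    refine Prod.ext ?_ rfl
    exact rs_ex T f
  · intro p hp
    simp only [mem_filter, mem_univ, true_and] at hp
    apply hC
    intro i hi
    exact Prod.ext rfl (Fol_hol hp i hi)

lemma IsW_lift {G : SimpleGraph V} {s : V → V → PF ℓ} (hs : Anti s) {T : ℕ}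
    {p : ℕ → V × Fin ℓ} :
    IsW (liftGraph G s) T p ↔ Fol s T p ∧ IsW G T (fun i => (p i).1) := by
  simp only [IsW, lift_adj G hs, Fol]
  grind

lemma NB_lift {G : SimpleGraph V} {s : V → V → PF ℓ} (hs : Anti s) {T : ℕ}
    {p : ℕ → V × Fin ℓ} :
    NB (liftGraph G s) T p ↔ Fol s T p ∧ NB G T (fun i => (p i).1) := by
  unfold NB
  rw [IsW_lift hs]
  constructor
  · rintro ⟨⟨h1, h2⟩, h3⟩
    refine ⟨h1, h2, fun i hi he => h3 i hi (Prod.ext he ?_)⟩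
    rw [h1 (i+1) (by omega), h1 i (by omega)]
    dsimp only at he
    rw [he, hs (p i).1]
    simp
  grind

lemma Blk_lift {G : SimpleGraph V} {s : V → V → PF ℓ} (hs : Anti s) {K B : ℕ}
    {p : ℕ → V × Fin ℓ} :
    Blk (liftGraph G s) K B p ↔ Fol s (B*K) p ∧ Blk G K B (fun i => (p i).1) := by
  constructor
  · intro h
    refine ⟨((IsW_lift hs).1 h.isW).1, fun b hb => ((NB_lift hs).1 (h b hb)).2⟩
  · rintro ⟨h1, h2⟩ b hb
    refine (NB_lift hs).2 ⟨fun i hi => h1 _ ?_, h2 b hb⟩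
    have : (b+1)*K ≤ B*K := Nat.mul_le_mul_right K hb
    grind

lemma SW_lift_closed (s : V → V → PF ℓ) (T : ℕ) (P : (ℕ → V) → Prop)
    (hP : ∀ f f', (∀ i ≤ T, f i = f' i) → (P f ↔ P f')) :
    SW T (fun p : ℕ → V × Fin ℓ => ind (p T = p 0 ∧ (Fol s T p ∧ P (fun i => (p i).1)))) =
      SW T (fun f => ind (f T = f 0 ∧ P f) * fixN (hol s f T)) := by
  have h1 : SW T (fun p : ℕ → V × Fin ℓ => ind (p T = p 0 ∧ (Fol s T p ∧ P (fun i => (p i).1)))) =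
      SW T (fun p => ind (Fol s T p) * ind (p T = p 0 ∧ P (fun i => (p i).1))) := by
    apply SW_congr; intro p; simp only [ind_and]; ring
  rw [h1, SW_lift]
  · apply SW_congr; intro f
    rw [fixN, mul_sum]
    apply sum_congr rfl; intro x _
    rw [← ind_and]
    congr 1
    simp only [hol, Equiv.Perm.coe_one, id, Prod.mk.injEq]
    grind
  grind

lemma trace_lift_Qm (G : SimpleGraph V) {s : V → V → PF ℓ} (hs : Anti s) (k : ℕ) :
    (Qm (liftGraph G s) k).trace = SW k (fun f => ind (f k = f 0 ∧ NB G k f) * fixN (hol s f k)) := by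
  rw [trace_Qm, ← SW_lift_closed s k (fun f => NB G k f) (fun f f' h => NB_iff h)]
  apply SW_congr; intro p; rw [NB_lift hs]

lemma trace_lift_Qm_pow (G : SimpleGraph V) {s : V → V → PF ℓ} (hs : Anti s) (K B : ℕ) :
    (Qm (liftGraph G s) K ^ B).trace =
      SW (B*K) (fun f => ind (f (B*K) = f 0 ∧ Blk G K B f) * fixN (hol s f (B*K))) := by
  rw [trace_Qm_pow, ← SW_lift_closed s (B*K) (fun f => Blk G K B f) (fun f f' h => Blk_iff h)]
  apply SW_congr; intro p; rw [Blk_lift hs]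

lemma Reg_lift {G : SimpleGraph V} {D : ℝ} (hG : Reg G D) {s : V → V → PF ℓ}
    (hs : Anti s) : Reg (liftGraph G s) D := by
  rintro ⟨u, x⟩
  rw [Fintype.sum_prod_type, ← hG u]
  apply sum_congr rfl; intro v _
  simp only [lift_adj G hs, ind_and]
  rw [← mul_sum]
  have := sum_ind_mul (s u v x) (fun _ => (1:ℝ))
  grind

open Matrix

section LA
variable {n m : Type*} [Fintype n] [Fintype m] [DecidableEq n] [DecidableEq m]

lemma intertw (X : Matrix n n ℝ) (Y : Matrix n m ℝ) (Z : Matrix m m ℝ) (h : X * Y = Y * Z)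
    (p : Polynomial ℝ) : Polynomial.aeval X p * Y = Y * Polynomial.aeval Z p := by
  induction p using Polynomial.induction_on' with
  | add p q hp hq => rw [map_add, map_add, Matrix.add_mul, Matrix.mul_add, hp, hq]
  | monomial k a =>
    rw [Polynomial.aeval_monomial, Polynomial.aeval_monomial]
    have : X ^ k * Y = Y * Z ^ k := by
      induction k with
      | zero => simp
      | succ k ih => rw [pow_succ, Matrix.mul_assoc, h, ← Matrix.mul_assoc, ih, Matrix.mul_assoc, ← pow_succ]
    rw [Matrix.mul_assoc, this, Algebra.algebraMap_eq_smul_one, Algebra.algebraMap_eq_smul_one]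
    simp

lemma aeval_diag (μ : n → ℝ) (p : Polynomial ℝ) :
    Polynomial.aeval (diagonal μ) p = diagonal (fun i => p.eval (μ i)) := by
  have h := Polynomial.aeval_algHom_apply (Matrix.diagonalAlgHom (n := n) (α := ℝ) ℝ) μ p
  simp_all

lemma spec_lemma (B : Matrix n n ℝ) (hB : B.IsHermitian) (M b c : ℝ)
    (hM : ∀ f : n → ℝ, |f ⬝ᵥ (B *ᵥ f)| ≤ M * (f ⬝ᵥ f)) (h : Polynomial ℝ)
    (h0 : ∀ x, |x| ≤ M → 0 ≤ h.eval x) (h1 : ∀ x, b < |x| → |x| ≤ M → c ≤ h.eval x)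
    (ht : (Polynomial.aeval B h).trace < c) :
    ∀ f : n → ℝ, |f ⬝ᵥ (B *ᵥ f)| ≤ b * (f ⬝ᵥ f) := by
  set U : Matrix n n ℝ := (hB.eigenvectorUnitary : Matrix n n ℝ) with hU
  have hUU : star U * U = 1 := Unitary.coe_star_mul_self _
  have hUU' : U * star U = 1 := Unitary.coe_mul_star_self _
  have hs : star U = Uᵀ := by
    rw [star_eq_conjTranspose]; ext i j; simp [conjTranspose_apply]
  rw [hs] at hUU hUU'
  set μ := hB.eigenvalues with hμ
  have hBU : B * U = U * diagonal μ := by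
    ext i j
    have := congrFun (hB.mulVec_eigenvectorBasis j) i
    simp only [Matrix.mul_diagonal]
    rw [Matrix.mul_apply]
    simp only [mulVec, dotProduct] at this
    simp only [hU, Matrix.IsHermitian.eigenvectorUnitary_apply]
    rw [this]
    simp [hμ, mul_comm]
  have hBd : B = U * diagonal μ * Uᵀ := by
    rw [← hBU, Matrix.mul_assoc, hUU', Matrix.mul_one]
  have hq : ∀ f : n → ℝ, f ⬝ᵥ (B *ᵥ f) = ∑ i, μ i * ((Uᵀ *ᵥ f) i)^2 := by
    intro f
    conv_lhs => rw [hBd]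
    rw [← mulVec_mulVec, ← mulVec_mulVec, dotProduct_mulVec, ← mulVec_transpose]
    simp only [dotProduct, mulVec_diagonal]
    apply sum_congr rfl; intros; ring
  have hn : ∀ f : n → ℝ, f ⬝ᵥ f = ∑ i, ((Uᵀ *ᵥ f) i)^2 := by
    intro f
    have : f ⬝ᵥ f = (Uᵀ *ᵥ f) ⬝ᵥ (Uᵀ *ᵥ f) := by
      rw [dotProduct_mulVec, vecMul_transpose, mulVec_mulVec, hUU', one_mulVec]
    rw [this]; simp only [dotProduct]
    apply sum_congr rfl; intros; ring
  have hμM : ∀ i, |μ i| ≤ M := by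
    intro i
    have := hM (U *ᵥ (Pi.single i 1))
    rw [hq, hn, mulVec_mulVec, hUU, one_mulVec] at this
    simpa [Pi.single_apply] using this
  have htr : (Polynomial.aeval B h).trace = ∑ i, h.eval (μ i) := by
    have := intertw B U (diagonal μ) hBU h
    rw [aeval_diag] at this
    have h2 : Polynomial.aeval B h = U * diagonal (fun i => h.eval (μ i)) * Uᵀ := by
      rw [← this, Matrix.mul_assoc, hUU', Matrix.mul_one]
    rw [h2, Matrix.trace_mul_comm, ← Matrix.mul_assoc, hUU, Matrix.one_mul, trace_diagonal]
  have hb : ∀ i, |μ i| ≤ b := by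
    intro i
    by_contra hcon
    push Not at hcon
    have := h1 _ hcon (hμM i)
    have h3 := single_le_sum (f := fun i => h.eval (μ i)) (fun j _ => h0 _ (hμM j)) (mem_univ i)
    linarith
  intro f
  rw [hq, hn, mul_sum]
  refine (abs_sum_le_sum_abs _ _).trans (sum_le_sum fun i _ => ?_)
  rw [abs_mul, abs_of_nonneg (sq_nonneg ((Uᵀ *ᵥ f) i))]
  exact mul_le_mul_of_nonneg_right (hb i) (sq_nonneg _)

lemma aeval_proj (A P : Matrix n n ℝ) (hP : P * P = P) (hc : A * P = P * A) (h : Polynomial ℝ)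
    (h0 : h.eval 0 = 0) :
    Polynomial.aeval (A * (1 - P)) h = Polynomial.aeval A h * (1 - P) := by
  have hidem : (1 - P) * (1 - P) = 1 - P := by
    rw [Matrix.mul_sub, Matrix.sub_mul, Matrix.sub_mul, hP]; simp
  have e : (A * (1 - P)) * (1 - P) = (1 - P) * A := by
    rw [Matrix.mul_assoc, hidem, Matrix.mul_sub, Matrix.sub_mul, hc]; simp
  have e2 : (A * (1-P)) * P = P * 0 := by
    rw [Matrix.mul_assoc, Matrix.sub_mul, hP]; simp
  have e3 : A * (1-P) = (1-P) * A := by rw [Matrix.mul_sub, Matrix.sub_mul, hc]; simp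
  have i1 := intertw _ _ _ e h
  have i2 := intertw _ _ _ e2 h
  have i3 := intertw _ _ _ e3 h
  have z : Polynomial.aeval (0 : Matrix n n ℝ) h = 0 := by
    have := Polynomial.aeval_algebraMap_apply (Matrix n n ℝ) (0:ℝ) h
    rw [map_zero] at this
    rw [this]
    simp [Polynomial.aeval_def, Polynomial.eval₂_eq_eval_map, h0]
  rw [z, Matrix.mul_zero] at i2
  rw [i3, ← i1, Matrix.mul_sub (Polynomial.aeval (A * (1 - P)) h), i2]; simp
end LA

section LiftLA
variable {V : Type*} [Fintype V] {ℓ : ℕ}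

def Jm (V : Type*) (ℓ : ℕ) : Matrix (V × Fin ℓ) V ℝ := fun p u => ind (p.1 = u)
def Pm (V : Type*) [Fintype V] (ℓ : ℕ) : Matrix (V × Fin ℓ) (V × Fin ℓ) ℝ :=
  (ℓ : ℝ)⁻¹ • (Jm V ℓ * (Jm V ℓ)ᵀ)

lemma JJ [DecidableEq V] : (Jm V ℓ)ᵀ * Jm V ℓ = (ℓ : ℝ) • (1 : Matrix V V ℝ) := by
  ext u v
  rw [Matrix.mul_apply, Matrix.smul_apply, one_ind, Fintype.sum_prod_type]
  simp only [Matrix.transpose_apply, Jm, sum_const, card_univ, Fintype.card_fin]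
  rw [← smul_sum, sum_ind_mul u (fun x => ind (x = v))]
  simp

lemma Am_symm (G : SimpleGraph V) : (Am G)ᵀ = Am G := by
  ext a b; simp only [Matrix.transpose_apply, Am]; congr 1; exact propext (G.adj_comm b a)

lemma AJ (G : SimpleGraph V) {s : V → V → PF ℓ} (hs : Anti s) :
    Am (liftGraph G s) * Jm V ℓ = Jm V ℓ * Am G := by
  ext ⟨u, x⟩ v
  rw [Matrix.mul_apply, Matrix.mul_apply, Fintype.sum_prod_type]
  simp only [Jm, Am, lift_adj G hs, ind_and]
  rw [sum_ind_mul' u (fun w => ind (G.Adj w v)), ← sum_ind_mul v (fun w => ind (G.Adj u w))]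
  apply sum_congr rfl; intro w _
  have : ∑ y, ind (y = s u w x) * (ind (G.Adj u w) * ind (w = v)) = _ :=
    sum_ind_mul (s u w x) (fun _ => ind (G.Adj u w) * ind (w = v))
  grind

lemma Pm_symm : (Pm V ℓ)ᵀ = Pm V ℓ := by
  rw [Pm, Matrix.transpose_smul, Matrix.transpose_mul, Matrix.transpose_transpose]

lemma PJ (hl : 0 < ℓ) : Pm V ℓ * Jm V ℓ = Jm V ℓ := by
  have : (ℓ : ℝ) ≠ 0 := by positivity
  rw [Pm, Matrix.smul_mul, Matrix.mul_assoc, JJ, Matrix.mul_smul, Matrix.mul_one, smul_smul,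
    inv_mul_cancel₀ this, one_smul]

lemma PP (hl : 0 < ℓ) : Pm V ℓ * Pm V ℓ = Pm V ℓ := by
  conv_lhs => rw [Pm, Matrix.smul_mul, Matrix.mul_smul, ← Matrix.mul_assoc, ← Matrix.smul_mul, ← Matrix.smul_mul]
  have := PJ (V := V) hl
  rw [Pm, Matrix.smul_mul] at this
  rw [Pm, Matrix.smul_mul, this]

lemma AP (G : SimpleGraph V) {s : V → V → PF ℓ} (hs : Anti s) :
    Am (liftGraph G s) * Pm V ℓ = Pm V ℓ * Am (liftGraph G s) := by
  have h := AJ G hs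
  have h2 := congrArg Matrix.transpose h
  rw [Matrix.transpose_mul, Matrix.transpose_mul, Am_symm, Am_symm] at h2
  rw [Pm, Matrix.mul_smul, Matrix.smul_mul, ← Matrix.mul_assoc, h, Matrix.mul_assoc, Matrix.mul_assoc, h2]

lemma trace_new (G : SimpleGraph V) {s : V → V → PF ℓ} (hs : Anti s) (hl : 0 < ℓ)
    (h : Polynomial ℝ) (h0 : h.eval 0 = 0) :
    (Polynomial.aeval (Am (liftGraph G s) * (1 - Pm V ℓ)) h).trace =
      (Polynomial.aeval (Am (liftGraph G s)) h).trace - (Polynomial.aeval (Am G) h).trace := by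
  have hl' : (ℓ : ℝ) ≠ 0 := by positivity
  rw [aeval_proj _ _ (PP hl) (AP G hs) h h0, Matrix.mul_sub, Matrix.mul_one, Matrix.trace_sub]
  congr 1
  rw [Pm, Matrix.mul_smul, ← Matrix.mul_assoc, intertw _ _ _ (AJ G hs) h, Matrix.trace_smul,
    Matrix.mul_assoc, Matrix.trace_mul_comm, Matrix.mul_assoc, JJ, Matrix.mul_smul, Matrix.trace_smul]
  simp [hl']

lemma dot_symm {n : Type*} [Fintype n] {A : Matrix n n ℝ} (hA : Aᵀ = A) (f g : n → ℝ) :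
    f ⬝ᵥ (A *ᵥ g) = (A *ᵥ f) ⬝ᵥ g := by
  rw [dotProduct_mulVec, ← mulVec_transpose, hA]

lemma Am_bound {G : SimpleGraph V} {D : ℝ} (hG : Reg G D) (f : V → ℝ) :
    |f ⬝ᵥ (Am G *ᵥ f)| ≤ (D+1) * (f ⬝ᵥ f) := by
  have e1 : f ⬝ᵥ (Am G *ᵥ f) = ∑ u, ∑ v, ind (G.Adj u v) * (f u * f v) := by
    simp only [dotProduct, mulVec, Am, mul_sum]
    apply sum_congr rfl; intros; apply sum_congr rfl; intros; ring
  have e2 : ∑ u, ∑ v, ind (G.Adj u v) * (f u)^2 = (D+1) * (f ⬝ᵥ f) := by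
    simp only [← sum_mul]
    simp only [dotProduct, mul_sum]
    apply sum_congr rfl; intro u _; rw [hG u]; ring
  have e3 : ∑ u, ∑ v, ind (G.Adj u v) * (f v)^2 = (D+1) * (f ⬝ᵥ f) := by
    rw [sum_comm, ← e2]
    apply sum_congr rfl; intro u _; apply sum_congr rfl; intro v _
    rw [G.adj_comm]
  have e4 : ∑ u, ∑ v, ind (G.Adj u v) * |f u * f v| ≤ (D+1) * (f ⬝ᵥ f) := by
    have : ∑ u, ∑ v, ind (G.Adj u v) * |f u * f v| ≤
        ∑ u, ∑ v, (ind (G.Adj u v) * (f u)^2 / 2 + ind (G.Adj u v) * (f v)^2 / 2) := by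
      apply sum_le_sum; intro u _; apply sum_le_sum; intro v _
      have h1 : |f u * f v| ≤ ((f u)^2 + (f v)^2)/2 := by
        rw [abs_le]; constructor <;> nlinarith [sq_nonneg (f u - f v), sq_nonneg (f u + f v)]
      nlinarith [ind_nonneg (G.Adj u v)]
    refine this.trans (le_of_eq ?_)
    simp only [sum_add_distrib, ← sum_div]
    rw [e2, e3]; ring
  rw [e1]
  refine (abs_sum_le_sum_abs _ _).trans ((sum_le_sum fun u _ =>
    (abs_sum_le_sum_abs _ _)).trans ?_)
  simp only [abs_mul (ind _), abs_of_nonneg (ind_nonneg _)]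
  exact e4

lemma lift_snd {G : SimpleGraph V} {D : ℝ} (hG : Reg G D) (hD : 0 ≤ D)
    {s : V → V → PF ℓ} (hs : Anti s) (hl : 0 < ℓ)
    (b c : ℝ) (h : Polynomial ℝ) (hz : h.eval 0 = 0)
    (h0 : ∀ x, |x| ≤ D+1 → 0 ≤ h.eval x) (h1 : ∀ x, b < |x| → |x| ≤ D+1 → c ≤ h.eval x)
    (ht : (Polynomial.aeval (Am (liftGraph G s)) h).trace - (Polynomial.aeval (Am G) h).trace < c)
    (hb : SndEigLE (Am G) b) : SndEigLE (Am (liftGraph G s)) b := by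
  set A := Am (liftGraph G s) with hA
  set P := Pm V ℓ with hP
  have hl' : (0:ℝ) < ℓ := by positivity
  have hPP : P * P = P := PP hl
  have hAP : A * P = P * A := AP G hs
  have hPs : Pᵀ = P := Pm_symm
  have hAs : Aᵀ = A := Am_symm _
  set B := A * (1 - P) with hB
  have hBs : Bᵀ = B := by
    rw [hB, Matrix.transpose_mul, Matrix.transpose_sub, Matrix.transpose_one, hPs, hAs,
      Matrix.sub_mul, Matrix.mul_sub, hAP]; simp
  have hnorm : ∀ f : V × Fin ℓ → ℝ, f ⬝ᵥ f = (P *ᵥ f) ⬝ᵥ (P *ᵥ f) + (f - P *ᵥ f) ⬝ᵥ (f - P *ᵥ f) := by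
    intro f
    have : f ⬝ᵥ (P *ᵥ f) = (P *ᵥ f) ⬝ᵥ (P *ᵥ f) := by
      rw [← dot_symm hPs, mulVec_mulVec, hPP]
    simp only [sub_dotProduct, dotProduct_sub]
    rw [this, dotProduct_comm (P *ᵥ f) f, this]; ring
  have hBf : ∀ f : V × Fin ℓ → ℝ, f ⬝ᵥ (B *ᵥ f) = (f - P *ᵥ f) ⬝ᵥ (A *ᵥ (f - P *ᵥ f)) := by
    intro f
    have e1 : B *ᵥ f = A *ᵥ (f - P *ᵥ f) := by
      rw [hB, ← mulVec_mulVec, Matrix.sub_mulVec, one_mulVec]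
    rw [e1, sub_dotProduct]
    have e2 : (P *ᵥ f) ⬝ᵥ (A *ᵥ (f - P *ᵥ f)) = 0 := by
      rw [← dot_symm hPs, mulVec_mulVec, ← hAP, ← mulVec_mulVec, Matrix.mulVec_sub P, mulVec_mulVec, hPP]
      simp
    rw [e2, sub_zero]
  have hself : ∀ f : V × Fin ℓ → ℝ, 0 ≤ f ⬝ᵥ f := fun f =>
    sum_nonneg fun i _ => mul_self_nonneg _
  have hM : ∀ f : V × Fin ℓ → ℝ, |f ⬝ᵥ (B *ᵥ f)| ≤ (D+1) * (f ⬝ᵥ f) := by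
    intro f
    rw [hBf, hnorm f]
    refine (Am_bound (Reg_lift hG hs) _).trans ?_
    nlinarith [hself (P *ᵥ f)]
  have hspec := spec_lemma B (by rw [Matrix.IsHermitian, conjTranspose_eq_transpose_of_trivial, hBs])
    (D+1) b c hM h h0 h1 (by rw [hB, hA, hP, trace_new G hs hl h hz]; exact ht)
  intro f hf
  have hsq : ∑ v, (f v)^2 = f ⬝ᵥ f := by
    simp only [dotProduct]; apply sum_congr rfl; intros; ring
  rw [hsq]
  set φ : V → ℝ := (ℓ:ℝ)⁻¹ • ((Jm V ℓ)ᵀ *ᵥ f) with hφ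
  have hPf : P *ᵥ f = Jm V ℓ *ᵥ φ := by
    rw [hP, Pm, hφ, Matrix.smul_mulVec, Matrix.mulVec_smul, mulVec_mulVec]
  have hφ0 : ∑ v, φ v = 0 := by
    have : ∑ v, ((Jm V ℓ)ᵀ *ᵥ f) v = ∑ p, f p := by
      simp only [mulVec, dotProduct, Matrix.transpose_apply, Jm]
      rw [sum_comm]
      apply sum_congr rfl; intro p _
      rw [sum_ind_mul' p.1 (fun _ => f p)]
    rw [hφ]
    simp only [Pi.smul_apply, ← smul_sum, this, hf, smul_zero]
  have hJ : ∀ g k : V → ℝ, (Jm V ℓ *ᵥ g) ⬝ᵥ (Jm V ℓ *ᵥ k) = ℓ * (g ⬝ᵥ k) := by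
    intro g k
    rw [dotProduct_mulVec, ← mulVec_transpose, mulVec_mulVec, JJ, Matrix.smul_mulVec, one_mulVec,
      smul_dotProduct, smul_eq_mul]
  have h5 : f ⬝ᵥ (A *ᵥ f) = ℓ * (φ ⬝ᵥ (Am G *ᵥ φ)) + (f - P *ᵥ f) ⬝ᵥ (B *ᵥ (f - P *ᵥ f)) := by
    have e1 : f = P *ᵥ f + (f - P *ᵥ f) := by abel
    have e2 : P *ᵥ (f - P *ᵥ f) = 0 := by rw [Matrix.mulVec_sub P, mulVec_mulVec, hPP]; simp
    have e3 : (f - P *ᵥ f) ⬝ᵥ (B *ᵥ (f - P *ᵥ f)) = (f - P *ᵥ f) ⬝ᵥ (A *ᵥ (f - P *ᵥ f)) := by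
      rw [hBf, e2, sub_zero]
    have e4 : (P *ᵥ f) ⬝ᵥ (A *ᵥ (f - P *ᵥ f)) = 0 := by
      rw [← dot_symm hPs, mulVec_mulVec, ← hAP, ← mulVec_mulVec, e2]; simp
    have e5 : (f - P *ᵥ f) ⬝ᵥ (A *ᵥ (P *ᵥ f)) = 0 := by
      rw [dot_symm hAs, dotProduct_comm, e4]
    have e6 : (P *ᵥ f) ⬝ᵥ (A *ᵥ (P *ᵥ f)) = ℓ * (φ ⬝ᵥ (Am G *ᵥ φ)) := by
      rw [hPf, mulVec_mulVec, hA, AJ G hs, ← mulVec_mulVec, hJ]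
    rw [e3, ← e6]
    conv_lhs => rw [e1]
    rw [Matrix.mulVec_add, add_dotProduct, dotProduct_add, dotProduct_add, e4, e5]; ring
  rw [h5, hnorm f, hPf, hJ]
  have h6 := hb φ hφ0
  have h7 := hspec (f - P *ᵥ f)
  have hsq2 : ∑ v, (φ v)^2 = φ ⬝ᵥ φ := by
    simp only [dotProduct]; apply sum_congr rfl; intros; ring
  rw [hsq2] at h6
  rw [← hPf]
  refine (abs_add_le _ _).trans ?_
  rw [abs_mul, abs_of_pos hl']
  nlinarith
end LiftLA

section Sign
variable {V : Type*} [Fintype V] {ℓ : ℕ} (H : Subgroup (PF ℓ))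

def sg (t : V → V → H) (u v : V) : H := t u v * (t v u)⁻¹
def sgp (t : V → V → H) (u v : V) : PF ℓ := (sg H t u v : PF ℓ)

lemma sg_anti (t : V → V → H) (u v : V) : sg H t v u = (sg H t u v)⁻¹ := by
  simp [sg]

lemma sgp_anti (t : V → V → H) : Anti (sgp H t) := fun u v => by
  simp only [sgp]; rw [sg_anti]; rfl

lemma count_trans (htr : ∀ i j : Fin ℓ, ∃ h ∈ H, h i = j) (y z : Fin ℓ) :
    (ℓ : ℝ) * ∑ g : H, ind ((g : PF ℓ) y = z) = Fintype.card H := by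
  have h1 : ∀ z', ∑ g : H, ind ((g : PF ℓ) y = z') =
      ∑ g : H, ind ((g : PF ℓ) y = z) := by
    intro z'
    obtain ⟨k, hk, hkz⟩ := htr z z'
    rw [← Equiv.sum_comp (Equiv.mulLeft (⟨k, hk⟩ : H))]
    apply sum_congr rfl; intro g _
    congr 1
    simp only [Equiv.coe_mulLeft, Subgroup.coe_mul, Equiv.Perm.coe_mul, Function.comp]
    rw [← hkz]
    exact propext k.injective.eq_iff
  have h2 : ∑ z', ∑ g : H, ind ((g : PF ℓ) y = z') = Fintype.card H := by
    rw [sum_comm]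
    have : ∀ g : H, ∑ z', ind ((g : PF ℓ) y = z') = 1 := by
      intro g
      have := sum_ind_mul' ((g : PF ℓ) y) (fun _ => (1:ℝ))
      simpa only [mul_one] using this
    simp [this]
  simp_all

lemma sum_fix (htr : ∀ i j : Fin ℓ, ∃ h ∈ H, h i = j) (hl : 0 < ℓ) (X L : PF ℓ) :
    ∑ g : H, fixN (X * (g : PF ℓ) * L) = Fintype.card H := by
  have hl' : (ℓ : ℝ) ≠ 0 := by positivity
  simp only [fixN]
  rw [sum_comm]
  have : ∀ x, ∑ g : H, ind ((X * (g : PF ℓ) * L) x = x) = (Fintype.card H : ℝ) / ℓ := by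
    intro x
    rw [← count_trans H htr (L x) (X⁻¹ x)]
    rw [mul_div_cancel_left₀ _ hl']
    apply sum_congr rfl; intro g _
    congr 1
    simp only [Equiv.Perm.coe_mul, Function.comp]
    apply propext
    constructor
    · intro h; conv_rhs => rw [← h]
      simp
    · simp_all
  simp only [this]
  simp only [sum_const, card_univ, Fintype.card_fin, nsmul_eq_mul]
  field_simp

def upd (t : V → V → H) (a b : V) (g : H) : V → V → H :=
  fun u v => if u = a ∧ v = b then g * t u v else t u v

lemma sgp_upd (t : V → V → H) {a b : V} (hab : a ≠ b) (g : H) :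
    sgp H (upd H t a b g) a b = g * sgp H t a b := by
  simp [sgp, sg, upd, hab, mul_assoc]

lemma sgp_upd' (t : V → V → H) {a b : V} (g : H) {u v : V} (h1 : ¬ (u = a ∧ v = b))
    (h2 : ¬ (u = b ∧ v = a)) :
    sgp H (upd H t a b g) u v = sgp H t u v := by
  have h3 : ¬ (v = a ∧ u = b) := fun h => h2 ⟨h.2, h.1⟩
  simp only [sgp, sg, upd, if_neg h1, if_neg h3]

lemma hol_upd (t : V → V → H) (g : H) {f : ℕ → V} {T i : ℕ} (hi : i < T) (hne : f i ≠ f (i+1))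
    (hu : ∀ i' < T, i' ≠ i → ¬ ((f i' = f i ∧ f (i'+1) = f (i+1)) ∨ (f i' = f (i+1) ∧ f (i'+1) = f i))) :
    hol (sgp H (upd H t (f i) (f (i+1)) g)) f T =
      hol (sgp H t) f T * (hol (sgp H t) f (i+1))⁻¹ * g * hol (sgp H t) f (i+1) := by
  have h1 : ∀ j ≤ i, hol (sgp H (upd H t (f i) (f (i+1)) g)) f j = hol (sgp H t) f j := by
    intro j
    induction j with
    | zero => intro _; rfl
    | succ j ih =>
      intro hj
      simp only [hol]
      have := hu j (by omega) (by omega)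
      rw [ih (by omega), sgp_upd' H t g (fun h => this (Or.inl h)) (fun h => this (Or.inr h))]
  have h2 : ∀ j, i + 1 + j ≤ T → hol (sgp H (upd H t (f i) (f (i+1)) g)) f (i+1+j) =
      hol (sgp H t) f (i+1+j) * (hol (sgp H t) f (i+1))⁻¹ * g * hol (sgp H t) f (i+1) := by
    intro j
    induction j with
    | zero =>
      intro _
      simp only [add_zero, mul_inv_cancel, one_mul]
      simp only [hol]
      rw [h1 i le_rfl, sgp_upd H t hne, mul_assoc]
    | succ j ih =>
      intro hj
      have := hu (i+1+j) (by omega) (by omega)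
      rw [← add_assoc]
      simp only [hol]
      rw [ih (by omega), sgp_upd' H t g (fun h => this (Or.inl h)) (fun h => this (Or.inr h))]
      simp only [hol, mul_assoc]
  have := h2 (T - (i+1)) (by omega)
  grind

lemma upd_bij (a b : V) (g : H) : Function.Bijective (fun t : V → V → H => upd H t a b g) := by
  rw [Function.bijective_iff_has_inverse]
  refine ⟨fun t => upd H t a b g⁻¹, fun t => ?_, fun t => ?_⟩ <;>
  · funext u v
    simp only [upd]
    simp_all

lemma avg_fix (htr : ∀ i j : Fin ℓ, ∃ h ∈ H, h i = j) (hl : 0 < ℓ) {f : ℕ → V} {T : ℕ}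
    (hne : ∀ i < T, f i ≠ f (i+1)) (hSF : ¬ SF T f) :
    ∑ t : V → V → H, fixN (hol (sgp H t) f T) = Fintype.card (V → V → H) := by
  simp only [SF] at hSF
  push Not at hSF
  obtain ⟨i, hi, hu⟩ := hSF
  have hu' : ∀ i' < T, i' ≠ i → ¬ ((f i' = f i ∧ f (i'+1) = f (i+1)) ∨ (f i' = f (i+1) ∧ f (i'+1) = f i)) := by
    intro i' h1 h2 h3
    have := hu i' h1 h2
    rcases h3 with h | h
    · grind
    · grind
  have hc : (Fintype.card H : ℝ) ≠ 0 := by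
    have : 0 < Fintype.card H := Fintype.card_pos
    positivity
  have key : (Fintype.card H : ℝ) * ∑ t : V → V → H, fixN (hol (sgp H t) f T) =
      (Fintype.card H : ℝ) * Fintype.card (V → V → H) := by
    calc (Fintype.card H : ℝ) * ∑ t : V → V → H, fixN (hol (sgp H t) f T)
        = ∑ g : H, ∑ t : V → V → H, fixN (hol (sgp H t) f T) := by simp
      _ = ∑ g : H, ∑ t : V → V → H, fixN (hol (sgp H (upd H t (f i) (f (i+1)) g)) f T) := by
          apply sum_congr rfl; intro g _
          exact ((upd_bij H (f i) (f (i+1)) g).sum_comp (fun t => fixN (hol (sgp H t) f T))).symm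
      _ = ∑ t : V → V → H, ∑ g : H, fixN (hol (sgp H (upd H t (f i) (f (i+1)) g)) f T) :=
          sum_comm
      _ = ∑ t : V → V → H, (Fintype.card H : ℝ) := by
          apply sum_congr rfl; intro t _
          rw [← sum_fix H htr hl (hol (sgp H t) f T * (hol (sgp H t) f (i+1))⁻¹) (hol (sgp H t) f (i+1))]
          apply sum_congr rfl; intro g _
          rw [hol_upd H t g hi (hne i hi) hu']
      _ = _ := by simp [mul_comm]
  grind

lemma fixN_le (σ : PF ℓ) : fixN σ ≤ ℓ := by
  unfold fixN
  refine (sum_le_sum (fun x _ => ind_le_one _)).trans ?_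
  simp

lemma exists_sign (htr : ∀ i j : Fin ℓ, ∃ h ∈ H, h i = j) (hl : 0 < ℓ) (G : SimpleGraph V) (K B : ℕ) :
    ∃ t : V → V → H,
      SW (B*K) (fun f => ind (f (B*K) = f 0 ∧ Blk G K B f) * (fixN (hol (sgp H t) f (B*K)) - 1)) ≤
      ℓ * SW (B*K) (fun f => ind (f (B*K) = f 0 ∧ Blk G K B f ∧ SF (B*K) f)) := by
  set X : ℝ := ℓ * SW (B*K) (fun f => ind (f (B*K) = f 0 ∧ Blk G K B f ∧ SF (B*K) f)) with hX
  have hsum : ∑ t : V → V → H,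
      SW (B*K) (fun f => ind (f (B*K) = f 0 ∧ Blk G K B f) * (fixN (hol (sgp H t) f (B*K)) - 1)) ≤
      ∑ t : V → V → H, X := by
    rw [← SW_sum]
    have : ∑ t : V → V → H, X =
      SW (B*K) (fun f => Fintype.card (V → V → H) * (ℓ * ind (f (B*K) = f 0 ∧ Blk G K B f ∧ SF (B*K) f))) := by
      rw [SW_const_mul, SW_const_mul]; simp [hX]
    rw [this]
    apply SW_mono
    intro f
    rw [← mul_sum]
    by_cases h : f (B*K) = f 0 ∧ Blk G K B f
    · rw [ind_true h, one_mul]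
      by_cases hS : SF (B*K) f
      · rw [ind_true ⟨h.1, h.2, hS⟩, mul_one]
        have : ∑ t : V → V → H, (fixN (hol (sgp H t) f (B*K)) - 1) ≤ ∑ t : V → V → H, (ℓ : ℝ) := by
          apply sum_le_sum; intro t _
          linarith [fixN_le (hol (sgp H t) f (B*K))]
        simp_all
      · rw [ind_false (fun h' => hS h'.2.2), sum_sub_distrib,
          avg_fix H htr hl (fun i hi => (h.2.isW i hi).ne) hS]
        simp
    · rw [ind_false h, ind_false (fun h' => h ⟨h'.1, h'.2.1⟩)]; simp
  obtain ⟨t, _, ht⟩ := exists_le_of_sum_le (univ_nonempty) hsum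
  exact ⟨t, ht⟩

lemma qp_odd (D : ℝ) (j : ℕ) : (qp D (2*j+1)).eval 0 = 0 := by
  induction j with
  | zero => simp [qp]
  | succ j ih => rw [show 2*(j+1)+1 = 2*j+3 by ring]; simp [qp, ih]

lemma qp_grow {D r x : ℝ} (hr : 0 < r) (hrD : r ≤ D) (hx : r + D / r ≤ |x|) (k : ℕ) :
    r * |(qp D (k+1)).eval x| ≤ |(qp D (k+2)).eval x| := by
  have hDr : 1 ≤ D / r := by rw [le_div_iff₀ hr]; linarith
  have hD : 0 < D := by linarith
  induction k with
  | zero =>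
    simp only [qp, Polynomial.eval_X, Polynomial.eval_sub, Polynomial.eval_mul, Polynomial.eval_C]
    have h1 : x * x = |x| * |x| := (abs_mul_abs_self x).symm
    rw [h1]
    have h2 : r * |x| + (D + 1) ≤ |x| * |x| := by
      have e : r * (D / r) = D := by field_simp
      have h3 : (r + D/r) * (D / r) ≤ |x| * (|x| - r) := by
        apply mul_le_mul hx (by linarith) (by positivity) (abs_nonneg _)
      nlinarith
    grind
  | succ k ih =>
    rw [show k+1+2 = k+3 by ring, qp]
    simp only [Polynomial.eval_X, Polynomial.eval_sub, Polynomial.eval_mul, Polynomial.eval_C]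
    set a := |(qp D (k+1)).eval x|
    set b := (qp D (k+2)).eval x with hb
    have h1 : |b| * |x| - D * a ≤ |b * x - D * (qp D (k+1)).eval x| := by
      have := abs_sub_abs_le_abs_sub (b * x) (D * (qp D (k+1)).eval x)
      rwa [abs_mul, abs_mul, abs_of_pos hD] at this
    refine le_trans ?_ h1
    have h2 : D * a ≤ (D / r) * |b| := by
      rw [div_mul_eq_mul_div, le_div_iff₀ hr]; nlinarith
    have h3 := mul_le_mul_of_nonneg_right hx (abs_nonneg b)
    grind

lemma qp_lower {D r x : ℝ} (hr : 0 < r) (hrD : r ≤ D) (hx : r + D / r ≤ |x|) (k : ℕ) :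
    r ^ (k+1) ≤ |(qp D (k+1)).eval x| := by
  induction k with
  | zero =>
    simp only [qp, Polynomial.eval_X, zero_add, pow_one]
    have : 0 < D / r := by apply div_pos (by linarith) hr
    linarith
  | succ k ih =>
    refine le_trans ?_ (qp_grow hr hrD hx k)
    rw [pow_succ, mul_comm]; simp_all

theorem stage2 (htr : ∀ i j : Fin ℓ, ∃ h ∈ H, h i = j) (hl : 0 < ℓ) {G : SimpleGraph V} {D r b : ℝ}
    (hG : Reg G D) (hr : 1 ≤ r) (hrD : r ≤ D) (hrb : r + D / r ≤ b) {K m : ℕ} (hK : Odd K) (hm : 1 ≤ m)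
    (hTF : TF G (3*K)) (hb : SndEigLE (Am G) b)
    (hbig : ℓ * (Fintype.card V * (D^(m*K) * (((2*m:ℕ)*K+1) * (20*(K+1)^4))^(2*m))) < r^(2*m*K)) :
    ∃ t : V → V → H, SndEigLE (Am (liftGraph G (sgp H t))) b := by
  obtain ⟨t, ht⟩ := exists_sign H htr hl G K (2*m)
  refine ⟨t, ?_⟩
  obtain ⟨j, hj⟩ := hK
  have hcount := count_SF hG (hr.trans hrD) hTF m
  have hr0 : 0 < r := by linarith
  refine lift_snd hG (by linarith) (sgp_anti H t) hl b (r^(2*m*K)) ((qp D K)^(2*m)) ?_ ?_ ?_ ?_ hb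
  · rw [Polynomial.eval_pow, hj, qp_odd, zero_pow (by omega)]
  · intro x _; rw [Polynomial.eval_pow, pow_mul]; positivity
  · intro x hx _
    rw [Polynomial.eval_pow, mul_comm (2*m) K, pow_mul, pow_mul _ 2 m, pow_mul _ 2 m]
    apply pow_le_pow_left₀ (by positivity)
    rw [← sq_abs (Polynomial.eval x _)]
    apply pow_le_pow_left₀ (by positivity)
    rw [hj]; exact qp_lower hr0 hrD (by linarith) (2*j)
  · rw [map_pow, map_pow, ← Qm_eq hG, ← Qm_eq (Reg_lift hG (sgp_anti H t)),
      trace_lift_Qm_pow G (sgp_anti H t), trace_Qm_pow, ← SW_sub]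
    refine lt_of_le_of_lt ?_ hbig
    refine le_trans ?_ (mul_le_mul_of_nonneg_left hcount (by positivity))
    grind

end Sign

variable {V : Type*} [Fintype V]

lemma SW_cons (T : ℕ) (C : V → (ℕ → V) → ℝ) :
    SW (T+1) (fun f => C (f 0) (fun i => f (i+1))) = ∑ v, SW T (C v) := by
  unfold SW
  rw [← Fintype.sum_prod_type', Fintype.sum_equiv
    (Fin.consEquiv (fun _ : Fin (T+2) => V)).symm _ (fun x : V × (Fin (T+1) → V) => C x.1 (ex T x.2))]
  intro f
  simp only [Fin.consEquiv, Equiv.coe_fn_symm_mk]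
  congr 1
  ext i; simp only [ex, Fin.tail]; simp

def TQ (G : SimpleGraph V) (k : ℕ) : ℝ := SW k (fun f => ind (f k = f 0) * ind (NB G k f))
def CN (G : SimpleGraph V) (k : ℕ) : ℝ :=
  SW k (fun f => ind (f k = f 0) * ind (NB G k f) * ind (f (k-1) ≠ f 1))
def TL (G : SimpleGraph V) (k : ℕ) : ℝ :=
  SW k (fun f => ind (f k = f 0) * ind (NB G k f) * ind (f (k-1) = f 1))

lemma ind_not (p : Prop) : ind (¬ p) = 1 - ind p := by
  unfold ind; grind

lemma TQ_split (G : SimpleGraph V) (k : ℕ) : TQ G k = CN G k + TL G k := by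
  unfold TQ CN TL
  rw [← SW_add]; apply SW_congr; intro f
  rw [show (f (k-1) ≠ f 1) = ¬ (f (k-1) = f 1) from rfl, ind_not]; ring

lemma TL_step {G : SimpleGraph V} {D : ℝ} (hG : Reg G D) (k : ℕ) :
    TL G (k+3) = (D - 1) * TQ G (k+1) + TL G (k+1) := by
  let C2 : V → (ℕ → V) → V → ℝ := fun y g v =>
    ind (v = y) * (ind (g (k+1) = g 0) * ind (NB G (k+1) g) *
      ind (G.Adj y (g 0) ∧ y ≠ g 1 ∧ y ≠ g k))
  have h1 : TL G (k+3) = SW (k+2+1) (fun f => (fun y g => C2 y g (g (k+2))) (f 0) (fun i => f (i+1))) := by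
    apply SW_congr; intro f
    simp only [C2]
    show ind (f (k+3) = f 0) * ind (NB G (k+3) f) * ind (f (k+2) = f 1) = _
    by_cases a : f (k+3) = f 0
    swap
    · rw [ind_false a]; simp
    by_cases b : f (k+2) = f 1
    swap
    · rw [ind_false b]; simp
    rw [ind_true a, ind_true b]
    simp only [one_mul, mul_one]
    rw [← ind_and]
    congr 1
    rw [eq_iff_iff]
    constructor
    · intro h
      refine ⟨⟨fun i hi => h.1 (i+1) (by omega), fun i hi => h.2 (i+1) (by omega)⟩, ?_, ?_, ?_⟩
      all_goals first | exact h.1 0 (by omega) | exact (h.2 0 (by omega)).symm | skip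
      · have := h.2 (k+1) (by omega)
        grind
    · rintro ⟨h, h2, h3, h4⟩
      refine ⟨fun i hi => ?_, fun i hi => ?_⟩
      · rcases i with _ | i
        · exact h2
        · rcases Nat.lt_or_ge i (k+1) with h' | h'
          · exact h.1 i h'
          · obtain rfl : i = k+1 := by omega
            show G.Adj (f (k+2)) (f (k+3))
            rw [a, b]; exact h2.symm
      · rcases i with _ | i
        · exact h3.symm
        · rcases Nat.lt_or_ge i k with h' | h'
          · exact h.2 i (by omega)
          grind
  rw [h1, SW_cons (k+2) (fun y g => C2 y g (g (k+2)))]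
  have h2 : ∀ y, SW (k+2) (fun g => C2 y g (g (k+2))) = SW (k+1) (fun g => ∑ v, C2 y g v) := by
    intro y
    apply SW_succ (k+1)
    intro g g' v h
    simp only [C2]
    rw [h 0 (by omega), h 1 (by omega), h k (by omega), h (k+1) le_rfl, NB_iff h]
  simp only [h2]
  rw [← SW_sum]
  unfold TQ TL
  rw [← SW_const_mul, ← SW_add]
  apply SW_congr; intro g
  simp only [C2, sum_ind_mul]
  rw [← mul_sum]
  by_cases a : g (k+1) = g 0
  swap
  · rw [ind_false a]; simp
  by_cases b : NB G (k+1) g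
  swap
  · rw [ind_false b]; simp
  rw [ind_true a, ind_true b]
  simp only [one_mul, mul_one, Nat.add_sub_cancel]
  have e1 : G.Adj (g 0) (g 1) := b.1 0 (by omega)
  have e2 : G.Adj (g 0) (g k) := by rw [← a]; exact (b.1 k (by omega)).symm
  have e3 := sum_adj_ne hG e1
  by_cases c : g k = g 1
  · rw [ind_true c, c]
    rw [show D - 1 + 1 = D by ring, ← e3]
    apply sum_congr rfl; intro v _; rw [G.adj_comm]; congr 1; simp
  · rw [ind_false c, add_zero, ← e3, ← add_sum_erase _ _ (mem_univ (g k)),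
      ← add_sum_erase (a := g k) _ (fun v => ind (G.Adj (g 0) v ∧ v ≠ g 1)) (mem_univ (g k)),
      ind_true (show G.Adj (g 0) (g k) ∧ g k ≠ g 1 from ⟨e2, c⟩), ind_false (by simp)]
    rw [zero_add, add_sub_cancel_left]
    apply sum_congr rfl; intro v hv
    rw [G.adj_comm]; grind

lemma CN_step {G : SimpleGraph V} {D : ℝ} (hG : Reg G D) (k : ℕ) :
    CN G (k+3) = TQ G (k+3) - D * TQ G (k+1) + CN G (k+1) := by
  have := TL_step hG k
  have h1 := TQ_split G (k+3)
  have h2 := TQ_split G (k+1)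
  grind

open Polynomial in
def rp (D : ℝ) : ℕ → ℝ[X]
  | 0 => 2
  | 1 => X
  | (k+2) => X * rp D (k+1) - C D * rp D k

open Polynomial in
lemma rp_qp (D : ℝ) (k : ℕ) : rp D (k+3) = rp D (k+1) + qp D (k+3) - C D * qp D (k+1) := by
  induction k using Nat.strong_induction_on with
  | _ k ih =>
    match k with
    | 0 => simp [rp, qp]; ring
    | 1 => simp [rp, qp]; ring
    | (k+2) =>
      have h1 := ih (k+1) (by omega)
      have h2 := ih k (by omega)
      have e1 : rp D (k+5) = X * rp D (k+4) - C D * rp D (k+3) := rfl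
      have e2 : rp D (k+3) = X * rp D (k+2) - C D * rp D (k+1) := rfl
      have e3 : qp D (k+5) = qp D (k+4) * X - C D * qp D (k+3) := rfl
      have e4 : qp D (k+3) = qp D (k+2) * X - C D * qp D (k+1) := rfl
      grind

lemma trace_qp [DecidableEq V] {G : SimpleGraph V} {D : ℝ} (hG : Reg G D) (k : ℕ) :
    (Polynomial.aeval (Am G) (qp D k)).trace = TQ G k := by
  rw [← Qm_eq hG, trace_Qm]; apply SW_congr; intro f; rw [ind_and]

lemma CN_one (G : SimpleGraph V) : CN G 1 = 0 := by
  apply sum_eq_zero; intro f _; beta_reduce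
  by_cases a : ex 1 f 1 = ex 1 f 0
  · have : ¬ NB G 1 (ex 1 f) := by rw [NB_one, a]; exact G.loopless.irrefl _
    rw [ind_false this]; simp
  · rw [ind_false a]; simp

lemma CN_two (G : SimpleGraph V) : CN G 2 = 0 := by
  apply sum_eq_zero; intro f _; beta_reduce
  rw [ind_false (p := ex 2 f (2-1) ≠ ex 2 f 1) (by simp)]; simp

lemma trace_rp [DecidableEq V] {G : SimpleGraph V} {D : ℝ} (hG : Reg G D) (k : ℕ) :
    (Polynomial.aeval (Am G) (rp D (k+1))).trace = CN G (k+1) -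
      (if Even (k+1) then (D-1) * Fintype.card V else 0) := by
  induction k using Nat.strong_induction_on with
  | _ k ih =>
    match k with
    | 0 =>
      simp [rp, CN_one, Am, Matrix.trace, ind]
    | 1 =>
      have h1 := trace_qp hG 2
      have h2 : TQ G 2 = 0 := by
        apply sum_eq_zero; intro f _; beta_reduce
        by_cases a : NB G 2 (ex 2 f)
        · rw [ind_false (p := ex 2 f 2 = ex 2 f 0) (a.2 0 le_rfl)]; simp
        · rw [ind_false a]; simp
      have h3 : rp D (1+1) = qp D 2 + Polynomial.C (1-D) := by
        simp [rp, qp]; ring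
      rw [h3, map_add, Matrix.trace_add, h1, h2, CN_two, Polynomial.aeval_C, Matrix.algebraMap_eq_diagonal]
      simp [Matrix.trace]; ring
    | (k+2) =>
      have h1 := ih k (by omega)
      rw [show k+2+1 = k+3 from rfl, rp_qp, CN_step hG, map_sub, map_add, map_mul, Polynomial.aeval_C,
        Matrix.trace_sub, Matrix.trace_add, h1, trace_qp hG]
      rw [← Algebra.smul_def, Matrix.trace_smul, trace_qp hG]
      have : Even (k+3) ↔ Even (k+1) := by
        rw [show k+3 = k+1+2 by ring, Nat.even_add]; simp
      simp only [this, smul_eq_mul]; ring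

lemma count_ext {N : ℕ} (R : Finset (Fin N × Fin N)) (hR : ∀ p ∈ R, ∀ q ∈ R, p.1 = q.1 ↔ p.2 = q.2) :
    ∑ σ : PF N, ind (∀ p ∈ R, σ p.1 = p.2) = (N.factorial : ℝ) / (N.descFactorial R.card : ℝ) := by
  have hinj1 : Set.InjOn Prod.fst (R : Set (Fin N × Fin N)) := by
    intro p hp q hq h
    exact Prod.ext h ((hR p hp q hq).1 h)
  have hcard : (R.image Prod.fst).card = R.card := card_image_of_injOn hinj1
  have hle : R.card ≤ N := by
    rw [← hcard]; simpa using card_le_univ (R.image Prod.fst)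
  obtain ⟨σ₀, hσ₀⟩ : ∃ σ : PF N, ∀ p ∈ R, σ p.1 = p.2 := by
    let F : Fin N → Fin N := fun x => if h : ∃ y, (x, y) ∈ R then h.choose else x
    have hF : ∀ p ∈ R, F p.1 = p.2 := by
      intro p hp
      have h : ∃ y, (p.1, y) ∈ R := ⟨p.2, hp⟩
      simp only [F, dif_pos h]
      exact ((hR _ h.choose_spec p hp).1 rfl)
    obtain ⟨g, hg⟩ := exists_equiv_extend_of_card_eq (α := Fin N) (t := (univ : Finset (Fin N)))
      (by simp) (s := R.image Prod.fst) (f := F) (by simp) (by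
        intro x hx y hy h
        simp only [coe_image, Set.mem_image] at hx hy
        obtain ⟨p, hp, rfl⟩ := hx
        obtain ⟨q, hq, rfl⟩ := hy
        grind)
    refine ⟨g.trans (Equiv.subtypeUnivEquiv (by simp)), fun p hp => ?_⟩
    have := hg p.1 (mem_image_of_mem _ hp)
    rw [hF p hp] at this
    simp_all
  have h1 : ∑ σ : PF N, ind (∀ p ∈ R, σ p.1 = p.2) =
      ∑ σ : PF N, ind (∀ x, ¬ (x ∉ R.image Prod.fst) → σ x = x) := by
    rw [← Equiv.sum_comp (Equiv.mulLeft σ₀)]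
    apply sum_congr rfl; intro σ _
    congr 1
    rw [eq_iff_iff]
    constructor
    · intro h x hx
      rw [not_not, mem_image] at hx
      obtain ⟨p, hp, rfl⟩ := hx
      have := h p hp
      rw [← hσ₀ p hp] at this
      simp_all
    · intro h p hp
      rw [← hσ₀ p hp]
      show σ₀ (σ p.1) = _
      grind
  rw [h1]
  have h2 : ∑ σ : PF N, ind (∀ x, ¬ (x ∉ R.image Prod.fst) → σ x = x) =
      (Fintype.card {σ : PF N // ∀ x, ¬ (x ∉ R.image Prod.fst) → σ x = x} : ℝ) := by
    rw [Fintype.card_subtype, card_filter]; push_cast; simp only [ind]; congr!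
  rw [h2, ← Fintype.card_congr (Equiv.Perm.subtypeEquivSubtypePerm (fun x => x ∉ R.image Prod.fst)),
    Fintype.card_perm]
  have h3 : Fintype.card {x // x ∉ R.image Prod.fst} = N - R.card := by
    rw [Fintype.card_subtype_compl, Fintype.card_coe, hcard, Fintype.card_fin]
  rw [h3, eq_div_iff (by simp_all)]
  exact_mod_cast Nat.factorial_mul_descFactorial hle

lemma count_ext_zero {N : ℕ} (R : Finset (Fin N × Fin N)) (hR : ¬ ∀ p ∈ R, ∀ q ∈ R, p.1 = q.1 ↔ p.2 = q.2) :
    ∑ σ : PF N, ind (∀ p ∈ R, σ p.1 = p.2) = 0 := by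
  apply sum_eq_zero; intro σ _
  apply ind_false
  intro h; apply hR; intro p hp q hq
  rw [← h p hp, ← h q hq]; simp

section
variable {U : Type*} [Fintype U] [LinearOrder U] {X : Type*}

def con (f : ℕ → U × X) (k : ℕ) : Prop :=
  ∀ x y z, (x, y) ∈ ds f k → (x, z) ∈ ds f k → y.1 = z.1 → y = z
def ea (f : ℕ → U × X) (k : ℕ) (e : U × U) : Finset ((U × X) × (U × X)) :=
  (ds f k).filter (fun p => p.1.1 = e.1 ∧ p.2.1 = e.2 ∧ e.1 < e.2)
def aE (f : ℕ → U × X) (k : ℕ) (e : U × U) : ℕ := (ea f k e).card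

variable {N : ℕ}
def sT (t : U × U → PF N) (u v : U) : PF N :=
  if u < v then t (u, v) else if v < u then (t (v, u))⁻¹ else 1

lemma sT_anti (t : U × U → PF N) : Anti (sT t) := by
  intro u v
  unfold sT
  rcases lt_trichotomy u v with h | h | h
  · grind
  · simp [h]
  · simp [h, h.not_gt]

lemma Fol_iff {t : U × U → PF N} {k : ℕ} {f : ℕ → U × Fin N}
    (hf : ∀ i < k, (f i).1 ≠ (f (i+1)).1) :
    Fol (sT t) k f ↔ ∀ e, ∀ p ∈ (ea f k e).image (fun p => (p.1.2, p.2.2)), t e p.1 = p.2 := by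
  constructor
  · intro h e p hp
    simp only [mem_image, ea, mem_filter] at hp
    obtain ⟨⟨x, y⟩, ⟨h1, h2, h3, h4⟩, rfl⟩ := hp
    dsimp only at h2 h3 ⊢
    rw [mem_ds] at h1
    obtain ⟨i, hi, h1 | h1⟩ := h1
    · have := h i hi
      rw [Prod.mk.injEq] at h1
      rw [← h1.1, ← h1.2, h2, h3, sT, if_pos h4] at this
      grind
    · have := h i hi
      rw [Prod.mk.injEq] at h1
      rw [← h1.1, ← h1.2, h2, h3, sT, if_neg h4.not_gt, if_pos h4] at this
      simp_all
  · intro h i hi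
    have h1 : (f i, f (i+1)) ∈ ds f k := mem_ds.2 ⟨i, hi, Or.inl rfl⟩
    rcases lt_or_gt_of_ne (hf i hi) with h4 | h4
    · have := h ((f i).1, (f (i+1)).1) ((f i).2, (f (i+1)).2) (mem_image.2 ⟨_, by
        rw [ea, mem_filter]; exact ⟨h1, rfl, rfl, h4⟩, rfl⟩)
      rw [sT, if_pos h4]; grind
    · have := h ((f (i+1)).1, (f i).1) ((f (i+1)).2, (f i).2) (mem_image.2 ⟨_, by
        rw [ea, mem_filter]; exact ⟨mem_ds_swap h1, rfl, rfl, h4⟩, rfl⟩)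
      dsimp only at this
      rw [sT, if_neg h4.not_gt, if_pos h4, ← this]; simp

lemma card_ea_image [DecidableEq (X × X)] {k : ℕ} (f : ℕ → U × X) (e : U × U) :
    ((ea f k e).image (fun p => (p.1.2, p.2.2))).card = aE f k e := by
  apply card_image_of_injOn
  intro p hp q hq h
  simp only [ea, coe_filter, Set.mem_ofPred_eq] at hp hq
  grind

lemma con_iff {k : ℕ} {f : ℕ → U × Fin N} (hf : ∀ i < k, (f i).1 ≠ (f (i+1)).1) :
    con f k ↔ ∀ e, ∀ p ∈ (ea f k e).image (fun p => (p.1.2, p.2.2)),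
      ∀ q ∈ (ea f k e).image (fun p => (p.1.2, p.2.2)), p.1 = q.1 ↔ p.2 = q.2 := by
  have hne : ∀ x y, (x, y) ∈ ds f k → x.1 ≠ y.1 := by
    intro x y h
    rw [mem_ds] at h
    obtain ⟨i, hi, h1 | h1⟩ := h <;> rw [Prod.mk.injEq] at h1 <;> rw [h1.1, h1.2]
    · exact hf i hi
    · exact (hf i hi).symm
  constructor
  · intro h e p hp q hq
    simp only [mem_image, ea, mem_filter] at hp hq
    obtain ⟨⟨x, y⟩, ⟨h1, h2, h3, h4⟩, rfl⟩ := hp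
    obtain ⟨⟨x', y'⟩, ⟨h1', h2', h3', h4'⟩, rfl⟩ := hq
    dsimp only at *
    constructor
    · intro hx
      have : x = x' := Prod.ext (by rw [h2, h2']) hx
      subst this
      rw [h _ _ _ h1 h1' (by rw [h3, h3'])]
    · intro hx
      have : y = y' := Prod.ext (by rw [h3, h3']) hx
      subst this
      rw [h _ _ _ (mem_ds_swap h1) (mem_ds_swap h1') (by rw [h2, h2'])]
  · intro h x y z hy hz hyz
    refine Prod.ext hyz ?_
    rcases lt_or_gt_of_ne (hne x y hy) with h4 | h4
    · exact (h (x.1, y.1) (x.2, y.2) (mem_image.2 ⟨_, by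
        rw [ea, mem_filter]; exact ⟨hy, rfl, rfl, h4⟩, rfl⟩) (x.2, z.2) (mem_image.2 ⟨(x, z), by
        rw [ea, mem_filter]; grind, rfl⟩)).1 rfl
    · exact (h (y.1, x.1) (y.2, x.2) (mem_image.2 ⟨_, by
        rw [ea, mem_filter]; exact ⟨mem_ds_swap hy, rfl, rfl, h4⟩, rfl⟩) (z.2, x.2) (mem_image.2 ⟨(z, x), by
        rw [ea, mem_filter]; exact ⟨mem_ds_swap hz, hyz.symm, rfl, h4⟩, rfl⟩)).2 rfl

def EE (F : (U × U → PF N) → ℝ) : ℝ :=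
  (∑ t, F t) / (Fintype.card (U × U → PF N) : ℝ)

lemma ind_forall {ι : Type*} [Fintype ι] (p : ι → Prop) : ind (∀ i, p i) = ∏ i, ind (p i) := by
  by_cases h : ∀ i, p i
  · rw [ind_true h, prod_eq_one]; intro i _; exact ind_true (h i)
  · rw [ind_false h]; push Not at h; obtain ⟨i, hi⟩ := h
    exact (prod_eq_zero (mem_univ i) (ind_false hi)).symm

lemma EE_Fol {k : ℕ} {f : ℕ → U × Fin N} (hf : ∀ i < k, (f i).1 ≠ (f (i+1)).1) :
    EE (fun t => ind (Fol (sT t) k f)) = ind (con f k) * ∏ e, (1 / (N.descFactorial (aE f k e) : ℝ)) := by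
  unfold EE
  have h1 : ∑ t : U × U → PF N, ind (Fol (sT t) k f) =
      ∏ e : U × U, ∑ σ : PF N,
        ind (∀ p ∈ (ea f k e).image (fun p => (p.1.2, p.2.2)), σ p.1 = p.2) := by
    rw [prod_univ_sum, Fintype.piFinset_univ]
    apply sum_congr rfl; intro t _
    rw [Fol_iff hf, ind_forall]
  rw [h1, con_iff hf]
  have h2 : (Fintype.card (U × U → PF N) : ℝ) = ∏ e : U × U, (N.factorial : ℝ) := by
    rw [Fintype.card_fun, Fintype.card_perm]; simp
  rw [h2, ← prod_div_distrib, ind_forall, ← prod_mul_distrib]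
  apply prod_congr rfl; intro e _
  by_cases h : ∀ p ∈ (ea f k e).image (fun p => (p.1.2, p.2.2)),
      ∀ q ∈ (ea f k e).image (fun p => (p.1.2, p.2.2)), p.1 = q.1 ↔ p.2 = q.2
  · rw [count_ext _ h, ind_true h, card_ea_image]
    have : (N.factorial : ℝ) ≠ 0 := by exact_mod_cast N.factorial_ne_zero
    field_simp
  · rw [count_ext_zero _ h, ind_false h]; simp

end

section
variable {U : Type*} [Fintype U] [LinearOrder U] {X Y : Type*}

def Sim (f : ℕ → U × X) (g : ℕ → U × Y) (k : ℕ) : Prop :=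
  (∀ i ≤ k, (f i).1 = (g i).1) ∧ ∀ i ≤ k, ∀ j ≤ k, f i = f j ↔ g i = g j
def vU (f : ℕ → U × X) (k : ℕ) (u : U) : ℕ := ((vs f k).filter (fun p => p.1 = u)).card

lemma Sim.symm {f : ℕ → U × X} {g : ℕ → U × Y} {k : ℕ} (h : Sim f g k) : Sim g f k :=
  ⟨fun i hi => (h.1 i hi).symm, fun i hi j hj => (h.2 i hi j hj).symm⟩
lemma Sim.mono {f : ℕ → U × X} {g : ℕ → U × Y} {k j : ℕ} (h : Sim f g k) (hj : j ≤ k) : Sim f g j :=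
  ⟨fun i hi => h.1 i (hi.trans hj), fun i hi l hl => h.2 i (hi.trans hj) l (hl.trans hj)⟩

lemma Sim.map {f : ℕ → U × X} {g : ℕ → U × Y} {k : ℕ} (h : Sim f g k) :
    ∃ Φ : U × X → U × Y, (∀ i ≤ k, Φ (f i) = g i) := by
  refine ⟨fun p => if h : ∃ i, i ≤ k ∧ f i = p then g h.choose else g 0, fun i hi => ?_⟩
  have h' : ∃ j, j ≤ k ∧ f j = f i := ⟨i, hi, rfl⟩
  beta_reduce; rw [dif_pos h']
  exact (h.2 _ h'.choose_spec.1 _ hi).1 h'.choose_spec.2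

lemma Sim.vU_le {f : ℕ → U × X} {g : ℕ → U × Y} {k : ℕ} (h : Sim f g k) (u : U) :
    vU g k u ≤ vU f k u := by
  obtain ⟨Φ, hΦ⟩ := h.map
  unfold vU
  refine (card_le_card ?_).trans (card_image_le (f := Φ))
  intro p hp
  rw [mem_filter, mem_vs] at hp
  obtain ⟨⟨i, hi, rfl⟩, h2⟩ := hp
  exact mem_image.2 ⟨f i, mem_filter.2 ⟨mem_vs_self hi, by rw [h.1 i hi, h2]⟩, hΦ i hi⟩

lemma Sim.aE_le {f : ℕ → U × X} {g : ℕ → U × Y} {k : ℕ} (h : Sim f g k) (e : U × U) :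
    aE g k e ≤ aE f k e := by
  obtain ⟨Φ, hΦ⟩ := h.map
  unfold aE
  refine (card_le_card ?_).trans (card_image_le (f := Prod.map Φ Φ))
  intro p hp
  rw [ea, mem_filter, mem_ds] at hp
  obtain ⟨⟨i, hi, rfl | rfl⟩, h2⟩ := hp
  · refine mem_image.2 ⟨(f i, f (i+1)), ?_, ?_⟩
    · rw [ea, mem_filter, mem_ds]
      refine ⟨⟨i, hi, Or.inl rfl⟩, ?_⟩
      dsimp only at h2 ⊢
      rw [h.1 i (by omega), h.1 (i+1) (by omega)]; exact h2
    grind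
  · refine mem_image.2 ⟨(f (i+1), f i), ?_, ?_⟩
    · rw [ea, mem_filter, mem_ds]
      refine ⟨⟨i, hi, Or.inr rfl⟩, ?_⟩
      dsimp only at h2 ⊢
      rw [h.1 i (by omega), h.1 (i+1) (by omega)]; exact h2
    grind

lemma Sim.vU {f : ℕ → U × X} {g : ℕ → U × Y} {k : ℕ} (h : Sim f g k) (u : U) :
    vU f k u = W.vU g k u := le_antisymm (h.symm.vU_le u) (h.vU_le u)
lemma Sim.aE {f : ℕ → U × X} {g : ℕ → U × Y} {k : ℕ} (h : Sim f g k) (e : U × U) :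
    aE f k e = W.aE g k e := le_antisymm (h.symm.aE_le e) (h.aE_le e)

lemma Sim.ds {f : ℕ → U × X} {g : ℕ → U × Y} {k : ℕ} (h : Sim f g k) {i j T : ℕ} (hT : T ≤ k) (hi : i ≤ k)
    (hj : j ≤ k) (hd : (f i, f j) ∈ ds f T) : (g i, g j) ∈ W.ds g T := by
  rw [mem_ds] at hd ⊢
  obtain ⟨l, hl, hd | hd⟩ := hd <;> rw [Prod.mk.injEq] at hd
  · exact ⟨l, hl, Or.inl (by rw [(h.2 i hi l (by omega)).1 hd.1, (h.2 j hj (l+1) (by omega)).1 hd.2])⟩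
  · exact ⟨l, hl, Or.inr (by rw [(h.2 i hi (l+1) (by omega)).1 hd.1, (h.2 j hj l (by omega)).1 hd.2])⟩

lemma Sim.vs {f : ℕ → U × X} {g : ℕ → U × Y} {k : ℕ} (h : Sim f g k) {i T : ℕ} (hT : T ≤ k) (hi : i ≤ k)
    (hd : f i ∈ vs f T) : g i ∈ W.vs g T := by
  rw [mem_vs] at hd ⊢
  obtain ⟨l, hl, hd⟩ := hd
  exact ⟨l, hl, (h.2 l (by omega) i hi).1 hd⟩

lemma Sim.con_imp {f : ℕ → U × X} {g : ℕ → U × Y} {k : ℕ} (h : Sim f g k) (hc : con f k) : con g k := by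
  intro x y z hy hz hyz
  obtain ⟨a, ha, rfl⟩ := mem_vs.1 (fst_mem_of_ds hy)
  obtain ⟨b, hb, h2⟩ := mem_vs.1 (snd_mem_of_ds hy)
  obtain ⟨c, hcc, h3⟩ := mem_vs.1 (snd_mem_of_ds hz)
  dsimp only at h2 h3
  subst h2 h3
  have h1 := h.symm.ds le_rfl ha hb hy
  have h2 := h.symm.ds le_rfl ha hcc hz
  exact (h.2 b hb c hcc).1 (hc _ _ _ h1 h2 (by rw [h.1 b hb, h.1 c hcc, hyz]))

lemma Sim.con {f : ℕ → U × X} {g : ℕ → U × Y} {k : ℕ} (h : Sim f g k) : con f k ↔ W.con g k :=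
  ⟨h.con_imp, h.symm.con_imp⟩

lemma Sim.exc {f : ℕ → U × X} {g : ℕ → U × Y} : ∀ {k : ℕ}, Sim f g k → exc f k = W.exc g k
  | 0, _ => rfl
  | k+1, h => by
    have ih := Sim.exc (h.mono (Nat.le_succ k))
    simp only [W.exc, ih]
    have h1 : (f k, f (k+1)) ∈ W.ds f k ↔ (g k, g (k+1)) ∈ W.ds g k :=
      ⟨h.ds (by omega) (by omega) le_rfl, h.symm.ds (by omega) (by omega) le_rfl⟩
    have h2 : f (k+1) ∈ W.vs f k ↔ g (k+1) ∈ W.vs g k :=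
      ⟨h.vs (by omega) le_rfl, h.symm.vs (by omega) le_rfl⟩
    grind

lemma Sim_congr {f f' : ℕ → U × X} {g g' : ℕ → U × Y} {k : ℕ} (hf : ∀ i ≤ k, f i = f' i)
    (hg : ∀ i ≤ k, g i = g' i) (h : Sim f g k) : Sim f' g' k := by
  refine ⟨fun i hi => ?_, fun i hi j hj => ?_⟩
  · rw [← hf i hi, ← hg i hi]; exact h.1 i hi
  · rw [← hf i hi, ← hg i hi, ← hf j hj, ← hg j hj]; exact h.2 i hi j hj

lemma Sim_succ {f : ℕ → U × X} {g : ℕ → U × Y} {k : ℕ} : Sim f g (k+1) ↔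
    Sim f g k ∧ ((f (k+1)).1 = (g (k+1)).1 ∧ ∀ j ≤ k, f (k+1) = f j ↔ g (k+1) = g j) := by
  constructor
  · intro h
    exact ⟨h.mono (Nat.le_succ k), h.1 _ le_rfl, fun j hj => h.2 _ le_rfl j (by omega)⟩
  · rintro ⟨h, h1, h2⟩
    refine ⟨fun i hi => ?_, fun i hi j hj => ?_⟩
    · rcases Nat.lt_or_ge k i with h' | h'
      · grind
      · exact h.1 i h'
    · rcases Nat.lt_or_ge k i with h' | h' <;> rcases Nat.lt_or_ge k j with h'' | h''
      · grind
      · obtain rfl : i = k+1 := by omega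
        grind
      · obtain rfl : j = k+1 := by omega
        rw [eq_comm, h2 i h', eq_comm]
      · exact h.2 i h' j h''

lemma mem_vs_succ {Z : Type*} {g : ℕ → Z} {k : ℕ} {p : Z} : p ∈ vs g (k+1) ↔ p = g (k+1) ∨ p ∈ vs g k := by
  rw [vs_succ, mem_insert]
lemma vU_old {g : ℕ → U × Y} {k : ℕ} (h : g (k+1) ∈ vs g k) (u : U) : vU g (k+1) u = vU g k u := by
  unfold vU; congr 2; ext p; rw [mem_vs_succ]
  grind
lemma vU_new {g : ℕ → U × Y} {k : ℕ} (h : g (k+1) ∉ vs g k) (u : U) :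
    vU g (k+1) u = vU g k u + if (g (k+1)).1 = u then 1 else 0 := by
  unfold vU
  split_ifs with h1
  · rw [← card_insert_of_notMem (a := g (k+1)) (by simp [h])]
    congr 1; ext p; simp only [mem_filter, mem_vs_succ, mem_insert]
    grind
  · rw [add_zero]; congr 1; ext p; simp only [mem_filter, mem_vs_succ]
    grind

variable {N : ℕ}

lemma count_new (S : Finset (U × Fin N)) (u : U) :
    ∑ v : U × Fin N, ind (v.1 = u ∧ v ∉ S) = ((N - (S.filter (fun p => p.1 = u)).card : ℕ) : ℝ) := by
  have h1 : ∑ v : U × Fin N, ind (v.1 = u ∧ v ∉ S) =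
      ((univ.filter (fun v : U × Fin N => v.1 = u) \ S.filter (fun p => p.1 = u)).card : ℝ) := by
    have : (univ.filter (fun v : U × Fin N => v.1 = u) \ S.filter (fun p => p.1 = u)) =
        univ.filter (fun v : U × Fin N => v.1 = u ∧ v ∉ S) := by
      ext v; simp; tauto
    rw [this, card_filter]; push_cast; simp only [ind]; congr!
  rw [h1, card_sdiff_of_subset (filter_subset_filter _ (subset_univ S))]
  congr 2
  have : (univ.filter (fun v : U × Fin N => v.1 = u)) = ({u} : Finset U) ×ˢ univ := by
    ext ⟨a, b⟩; simp [eq_comm]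
  simp_all

lemma count_Sim (w : ℕ → U × Y) (T : ℕ) :
    SW T (fun f : ℕ → U × Fin N => ind (Sim f w T)) = ∏ u, (N.descFactorial (vU w T u) : ℝ) := by
  induction T with
  | zero =>
    rw [SW_zero]
    have h1 : ∀ v : U × Fin N, ind (Sim (fun _ => v) w 0) = ind (v.1 = (w 0).1 ∧ v ∉ (∅ : Finset (U × Fin N))) := by
      intro v; congr 1; rw [eq_iff_iff]
      constructor
      · intro h; exact ⟨h.1 0 le_rfl, by simp⟩
      · intro h
        refine ⟨fun i hi => ?_, fun i hi j hj => ?_⟩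
        · grind
        grind
    simp only [h1]
    rw [count_new, prod_eq_single (w 0).1]
    · simp [vU, vs_zero, filter_singleton]
    · intro u _ hu
      simp [vU, vs_zero, filter_singleton, hu.symm]
    · simp
  | succ T ih =>
    let C : (ℕ → U × Fin N) → (U × Fin N) → ℝ := fun f v =>
      ind (Sim f w T) * ind (v.1 = (w (T+1)).1 ∧ ∀ j ≤ T, v = f j ↔ w (T+1) = w j)
    have h1 : SW (T+1) (fun f : ℕ → U × Fin N => ind (Sim f w (T+1))) = SW (T+1) (fun f => C f (f (T+1))) := by
      apply SW_congr; intro f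
      rw [Sim_succ, ind_and]
    rw [h1, SW_succ]
    · simp only [C, ← mul_sum]
      by_cases h : w (T+1) ∈ vs w T
      · obtain ⟨j0, hj0, he⟩ := mem_vs.1 h
        simp only [vU_old h]
        rw [← ih]
        apply SW_congr; intro f
        by_cases hs : Sim f w T
        · have : ∀ v, ind (v.1 = (w (T+1)).1 ∧ ∀ j ≤ T, v = f j ↔ w (T+1) = w j) = ind (v = f j0) * 1 := by
            intro v; rw [mul_one]; congr 1; rw [eq_iff_iff]
            constructor
            · grind
            · rintro rfl
              refine ⟨by rw [hs.1 j0 hj0, he], fun j hj => ?_⟩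
              rw [hs.2 j0 hj0 j hj, he]
          simp only [this]
          rw [sum_ind_mul, mul_one]
        · rw [ind_false hs]; simp
      · have h2 : ∀ f : ℕ → U × Fin N, ind (Sim f w T) *
            ∑ v : U × Fin N, ind (v.1 = (w (T+1)).1 ∧ ∀ j ≤ T, v = f j ↔ w (T+1) = w j) =
            ind (Sim f w T) * ((N - vU w T (w (T+1)).1 : ℕ) : ℝ) := by
          intro f
          by_cases hs : Sim f w T
          · congr 1
            rw [← hs.vU, vU, ← count_new]
            apply sum_congr rfl; intro v _
            congr 1; rw [eq_iff_iff]
            apply and_congr_right; intro _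
            constructor
            · intro h3 h4
              obtain ⟨j, hj, rfl⟩ := mem_vs.1 h4
              exact h (mem_vs.2 ⟨j, hj, ((h3 j hj).1 rfl).symm⟩)
            · intro h3 j hj
              constructor
              · rintro rfl; exact absurd (mem_vs_self hj) h3
              · intro h4; exact absurd (mem_vs.2 ⟨j, hj, h4.symm⟩) h
          · rw [ind_false hs]; simp
        simp only [h2]
        rw [SW_mul_const, ih]
        simp only [vU_new h]
        rw [← mul_prod_erase _ _ (mem_univ (w (T+1)).1),
          ← mul_prod_erase _ (fun u => ((N.descFactorial (vU w T u + if (w (T+1)).1 = u then 1 else 0) : ℕ) : ℝ)) (mem_univ (w (T+1)).1)]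
        rw [if_pos rfl, Nat.descFactorial_succ]
        have : ∏ u ∈ univ.erase (w (T+1)).1, ((N.descFactorial (vU w T u + if (w (T+1)).1 = u then 1 else 0) : ℕ) : ℝ)
            = ∏ u ∈ univ.erase (w (T+1)).1, ((N.descFactorial (vU w T u) : ℕ) : ℝ) := by
          apply prod_congr rfl; intro u hu
          rw [if_neg (ne_of_mem_erase hu).symm, add_zero]
        grind
    · intro y y' z h
      simp only [C]
      congr 1
      · congr 1; rw [eq_iff_iff]
        exact ⟨Sim_congr h (fun _ _ => rfl), Sim_congr (fun i hi => (h i hi).symm) (fun _ _ => rfl)⟩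
      simp_all

lemma fi_ex {Z : Type*} (f : ℕ → Z) (i : ℕ) : ∃ j, f j = f i := ⟨i, rfl⟩
def fi {Z : Type*} (f : ℕ → Z) (i : ℕ) : ℕ := Nat.find (fi_ex f i)
lemma fi_le {Z : Type*} (f : ℕ → Z) (i : ℕ) : fi f i ≤ i := Nat.find_min' _ rfl
lemma fi_spec {Z : Type*} (f : ℕ → Z) (i : ℕ) : f (fi f i) = f i := Nat.find_spec (fi_ex f i)
lemma fi_min {Z : Type*} {f : ℕ → Z} {i j : ℕ} (h : j < fi f i) : f j ≠ f i := Nat.find_min (fi_ex f i) h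
lemma fi_eq_iff {Z : Type*} (f : ℕ → Z) (i j : ℕ) : fi f i = fi f j ↔ f i = f j := by
  constructor
  · intro h; rw [← fi_spec f i, h, fi_spec f j]
  · intro h; unfold fi; simp only [h]
lemma fi_unique {Z : Type*} {f : ℕ → Z} {i m : ℕ} (h1 : f m = f i) (h2 : ∀ j < m, f j ≠ f i) : fi f i = m := by
  apply le_antisymm (Nat.find_min' _ h1)
  grind

def Can {k : ℕ} (w : ℕ → U × Fin (k+1)) : Prop := ∀ i ≤ k, ((w i).2 : ℕ) = fi w i

lemma Sim.fi {f : ℕ → U × X} {g : ℕ → U × Y} {k : ℕ} (h : Sim f g k) {i : ℕ} (hi : i ≤ k) : fi f i = W.fi g i := by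
  have h1 := fi_le g i
  apply fi_unique
  · exact (h.2 _ (by omega) _ hi).2 (fi_spec g i)
  · intro j hj h2
    have := (h.2 _ (by omega) _ hi).1 h2
    exact fi_min hj this

lemma exists_unique_can {k : ℕ} (f : ℕ → U × X) (w : Fin (k+1) → U × Fin (k+1)) :
    (Can (ex k w) ∧ Sim f (ex k w) k) ↔
      w = rs k (fun i => ((f i).1, (⟨fi f i % (k+1), Nat.mod_lt _ (by omega)⟩ : Fin (k+1)))) := by
  constructor
  · rintro ⟨h1, h2⟩
    rw [← rs_ex k w]
    ext1 i
    have hi : (i : ℕ) ≤ k := by omega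
    simp only [rs]
    refine Prod.ext (h2.1 i hi).symm (Fin.ext ?_)
    rw [h1 i hi, h2.fi hi]
    exact (Nat.mod_eq_of_lt (by have := fi_le (ex k w) i; omega)).symm
  · rintro rfl
    have h0 : ∀ i ≤ k, fi f i % (k+1) = fi f i := fun i hi =>
      Nat.mod_eq_of_lt (by have := fi_le f i; omega)
    have hS : Sim f (ex k (rs k (fun i => ((f i).1, (⟨fi f i % (k+1), Nat.mod_lt _ (by omega)⟩ : Fin (k+1)))))) k := by
      refine ⟨fun i hi => by rw [ex_rs _ _ _ hi], fun i hi j hj => ?_⟩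
      rw [ex_rs _ _ _ hi, ex_rs _ _ _ hj]
      simp only [Prod.mk.injEq, Fin.mk.injEq, h0 i hi, h0 j hj, fi_eq_iff]
      constructor
      · grind
      · simp
    refine ⟨fun i hi => ?_, hS⟩
    rw [← hS.fi hi, ex_rs _ _ _ hi]
    exact h0 i hi

lemma PAT (k : ℕ) (Ψ : (ℕ → U × Fin N) → ℝ) (Ψ' : (ℕ → U × Fin (k+1)) → ℝ)
    (h : ∀ f w, Sim f w k → Ψ f = Ψ' w) :
    SW k Ψ = SW k (fun w => ind (Can w) * (Ψ' w * ∏ u, (N.descFactorial (vU w k u) : ℝ))) := by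
  have h1 : ∀ f : Fin (k+1) → U × Fin N, Ψ (ex k f) =
      ∑ w : Fin (k+1) → U × Fin (k+1), ind (Can (ex k w) ∧ Sim (ex k f) (ex k w) k) * Ψ (ex k f) := by
    intro f
    simp only [exists_unique_can]
    rw [sum_ind_mul]
  show ∑ f : Fin (k+1) → U × Fin N, Ψ (ex k f) = ∑ w : Fin (k+1) → U × Fin (k+1), _
  rw [sum_congr rfl (fun f _ => h1 f), sum_comm]
  apply sum_congr rfl; intro w _
  beta_reduce
  rw [← count_Sim (N := N)]
  have h2 : ∀ f : Fin (k+1) → U × Fin N, ind (Can (ex k w) ∧ Sim (ex k f) (ex k w) k) * Ψ (ex k f) =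
      ind (Can (ex k w)) * Ψ' (ex k w) * ind (Sim (ex k f) (ex k w) k) := by
    intro f
    rw [ind_and]
    by_cases hs : Sim (ex k f) (ex k w) k
    · grind
    · rw [ind_false hs]; ring
  simp only [h2]
  rw [← mul_sum, mul_assoc]; rfl

end

section
variable {U : Type*} [Fintype U] [LinearOrder U] {X Y : Type*} {N : ℕ}

def Cyc (w : ℕ → U × X) (k : ℕ) : Prop :=
  w k = w 0 ∧ NB (KK U) k (fun i => (w i).1) ∧ (w (k-1)).1 ≠ (w 1).1

lemma Cyc.hf {w : ℕ → U × X} {k : ℕ} (h : Cyc w k) : ∀ i < k, (w i).1 ≠ (w (i+1)).1 :=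
  fun i hi => by simpa using h.2.1.1 i hi

lemma CN_lift {s : U → U → PF N} (hs : Anti s) {k : ℕ} (hk : 1 ≤ k) :
    CN (liftGraph (KK U) s) k = SW k (fun p => ind (Cyc p k) * ind (Fol s k p)) := by
  apply SW_congr; intro p
  rw [← ind_and, ← ind_and, ← ind_and]
  congr 1; rw [eq_iff_iff, NB_lift hs]
  constructor
  · rintro ⟨⟨h1, h2, h3⟩, h4⟩
    refine ⟨⟨h1, h3, fun h5 => h4 (Prod.ext h5 ?_)⟩, h2⟩
    have a := h2 (k-1) (by omega)
    have b := h2 0 (by omega)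
    rw [Nat.sub_add_cancel hk, h1, h5] at a
    rw [hs (p 0).1 (p 1).1] at a
    simp_all
  · rintro ⟨⟨h1, h3, h4⟩, h2⟩
    grind

lemma EE_sum {ι : Type*} (s : Finset ι) (F : ι → (U × U → PF N) → ℝ) :
    EE (fun t => ∑ i ∈ s, F i t) = ∑ i ∈ s, EE (F i) := by
  unfold EE; rw [sum_comm, sum_div]
lemma EE_const_mul (c : ℝ) (F : (U × U → PF N) → ℝ) : EE (fun t => c * F t) = c * EE F := by
  unfold EE; rw [← mul_sum, mul_div_assoc]
lemma EE_const (c : ℝ) : EE (fun _ : U × U → PF N => c) = c := by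
  unfold EE
  simp
lemma EE_add (F F' : (U × U → PF N) → ℝ) : EE (fun t => F t + F' t) = EE F + EE F' := by
  unfold EE; rw [sum_add_distrib, add_div]
lemma EE_mono {F F' : (U × U → PF N) → ℝ} (h : ∀ t, F t ≤ F' t) : EE F ≤ EE F' := by
  unfold EE; gcongr; exact h _
lemma EE_SW {V : Type*} [Fintype V] (k : ℕ) (F : (ℕ → V) → (U × U → PF N) → ℝ) :
    EE (fun t => SW k (fun f => F f t)) = SW k (fun f => EE (F f)) := EE_sum _ _

lemma EE_CN {k : ℕ} (hk : 1 ≤ k) : EE (fun t : U × U → PF N => CN (liftGraph (KK U) (sT t)) k) =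
    SW k (fun w : ℕ → U × Fin (k+1) => ind (Can w) * (ind (Cyc w k) * (ind (con w k) *
      ∏ e, (1 / (N.descFactorial (aE w k e) : ℝ))) * ∏ u, (N.descFactorial (vU w k u) : ℝ))) := by
  simp only [CN_lift (sT_anti _) hk]
  rw [EE_SW]
  rw [← PAT k (fun f : ℕ → U × Fin N => ind (Cyc f k) * (ind (con f k) *
      ∏ e, (1 / (N.descFactorial (aE f k e) : ℝ))))]
  · apply SW_congr; intro f
    rw [EE_const_mul]
    by_cases h : Cyc f k
    · rw [EE_Fol h.hf]
    · rw [ind_false h]; simp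
  · intro f w h
    congr 1
    · congr 1; rw [eq_iff_iff]
      unfold Cyc
      rw [h.2 k le_rfl 0 (by omega), NB_iff (g := fun i => (w i).1) (fun i hi => h.1 i hi), h.1 (k-1) (by omega)]
      apply and_congr_right; intro _
      apply and_congr_right; intro _
      by_cases hk1 : k = 0
      · omega
      · rw [h.1 1 (by omega)]
    · rw [h.con]; simp only [h.aE]

lemma sum_vU (f : ℕ → U × X) (k : ℕ) : ∑ u, vU f k u = (vs f k).card := by
  unfold vU
  rw [card_eq_sum_card_fiberwise (f := fun p => p.1) (t := univ) (fun x _ => by simp)]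

lemma sum_aE (f : ℕ → U × X) (k : ℕ) (hf : ∀ i < k, (f i).1 ≠ (f (i+1)).1) :
    2 * ∑ e, aE f k e = (ds f k).card := by
  have hne : ∀ p ∈ ds f k, p.1.1 ≠ p.2.1 := by
    intro p h
    rw [mem_ds] at h
    obtain ⟨i, hi, rfl | rfl⟩ := h
    · exact hf i hi
    · grind
  have h1 : ∑ e, aE f k e = ((ds f k).filter (fun p => p.1.1 < p.2.1)).card := by
    rw [card_eq_sum_card_fiberwise (f := fun p => (p.1.1, p.2.1)) (t := univ) (fun x _ => by simp)]
    apply sum_congr rfl; rintro ⟨u, v⟩ _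
    unfold aE ea
    congr 1; ext p
    simp only [mem_filter, Prod.mk.injEq]
    constructor
    · grind
    · grind
  have h2 : ((ds f k).filter (fun p => p.1.1 < p.2.1)).card = ((ds f k).filter (fun p => ¬ p.1.1 < p.2.1)).card := by
    refine card_bij' (fun p _ => p.swap) (fun p _ => p.swap) ?_ ?_ ?_ ?_
    · intro p hp
      rw [mem_filter] at hp ⊢
      exact ⟨mem_ds_swap hp.1, hp.2.not_gt⟩
    · intro p hp
      rw [mem_filter] at hp ⊢
      exact ⟨mem_ds_swap hp.1, lt_of_le_of_ne (not_lt.1 hp.2) (hne p hp.1).symm⟩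
    · simp
    · simp
  have h3 := card_filter_add_card_filter_not (s := ds f k) (fun p => p.1.1 < p.2.1)
  omega

lemma ds_card_le {Z : Type*} (f : ℕ → Z) (k : ℕ) : (ds f k).card ≤ 2 * k := by
  unfold ds
  refine (card_biUnion_le_card_mul _ _ 2 (fun i _ => card_le_two)).trans ?_
  grind

lemma aE_le {f : ℕ → U × X} {k : ℕ} (hf : ∀ i < k, (f i).1 ≠ (f (i+1)).1) (e : U × U) : aE f k e ≤ k := by
  have h1 := sum_aE f k hf
  have h2 := ds_card_le f k
  have h3 : aE f k e ≤ ∑ e, aE f k e := single_le_sum (fun _ _ => Nat.zero_le _) (mem_univ e)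
  omega

lemma exc_le {Z : Type*} (f : ℕ → Z) (k : ℕ) : exc f k ≤ k := by
  induction k with
  | zero => rfl
  | succ k ih => rw [exc]; grind

open Polynomial in
def Gp (a b : ℕ) : ℝ[X] := ∏ j ∈ Ico a b, (1 - C (j : ℝ) * Polynomial.X)

lemma Gp_mul {a q : ℕ} (h : a ≤ q) : Gp 0 a * Gp a q = Gp 0 q := prod_Ico_consecutive _ (Nat.zero_le a) h
lemma Gp_deg (a b : ℕ) : (Gp a b).natDegree ≤ b - a := by
  unfold Gp
  refine (Polynomial.natDegree_prod_le _ _).trans ((sum_le_card_nsmul _ _ 1 ?_).trans (by simp))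
  intro j _
  refine (Polynomial.natDegree_sub_le _ _).trans ?_
  grind
lemma Gp_zero (a b : ℕ) : (Gp a b).eval 0 = 1 := by
  unfold Gp; rw [Polynomial.eval_prod]; simp
lemma Gp_pos {q N : ℕ} (hN : q < N) (a : ℕ) : 0 < (Gp a q).eval (1 / (N:ℝ)) := by
  unfold Gp; rw [Polynomial.eval_prod]
  apply prod_pos; intro j hj
  have hj := (mem_Ico.1 hj).2
  have : (j:ℝ) < N := by exact_mod_cast hj.trans hN
  have hN0 : (0:ℝ) < N := by exact_mod_cast (by omega : 0 < N)
  simp only [Polynomial.eval_sub, Polynomial.eval_one, Polynomial.eval_mul, Polynomial.eval_C, Polynomial.eval_X]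
  rw [mul_one_div, sub_pos, div_lt_one hN0]; exact this

lemma desc_Gp {N : ℕ} (hN : 1 ≤ N) (a : ℕ) :
    (N.descFactorial a : ℝ) = (N:ℝ)^a * (Gp 0 a).eval (1 / (N:ℝ)) := by
  have hN0 : (0:ℝ) < N := by exact_mod_cast hN
  induction a with
  | zero => simp [Gp]
  | succ a ih =>
    have : Gp 0 (a+1) = Gp 0 a * (1 - Polynomial.C (a : ℝ) * Polynomial.X) := by
      unfold Gp; rw [prod_Ico_succ_top (Nat.zero_le a)]
    rw [this, Polynomial.eval_mul, Nat.descFactorial_succ, Nat.cast_mul]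
    have h2 : ((N - a : ℕ) : ℝ) * (N.descFactorial a : ℝ) = ((N:ℝ) - a) * (N.descFactorial a : ℝ) := by
      rcases Nat.lt_or_ge N a with h | h
      · rw [Nat.descFactorial_eq_zero_iff_lt.2 h]; simp
      · simp_all
    rw [h2, ih]
    simp; grind

open Polynomial in
def Wp (k q : ℕ) (w : ℕ → U × X) : ℝ[X] :=
  Polynomial.X ^ (exc w k) * (∏ u, Gp 0 (vU w k u)) * ∏ e, Gp (aE w k e) q

lemma Wp_eval {k q : ℕ} {w : ℕ → U × X} (hf : ∀ i < k, (w i).1 ≠ (w (i+1)).1) (hq : k ≤ q) (hN : q < N) :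
    (∏ _e : U × U, (Gp 0 q).eval (1 / (N:ℝ))) * ((∏ e, (1 / (N.descFactorial (aE w k e) : ℝ))) *
      ∏ u, (N.descFactorial (vU w k u) : ℝ)) = N * (Wp k q w).eval (1 / (N:ℝ)) := by
  have hN0 : (0:ℝ) < N := by exact_mod_cast (by omega : 0 < N)
  have h1 : ∏ u, (N.descFactorial (vU w k u) : ℝ) =
      (N:ℝ)^((vs w k).card) * ∏ u, (Gp 0 (vU w k u)).eval (1 / (N:ℝ)) := by
    rw [← sum_vU, ← prod_pow_eq_pow_sum, ← prod_mul_distrib]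
    exact prod_congr rfl fun u _ => desc_Gp (by omega) _
  have h2 : (∏ _e : U × U, (Gp 0 q).eval (1 / (N:ℝ))) * (∏ e, (1 / (N.descFactorial (aE w k e) : ℝ))) =
      (1 / (N:ℝ))^(∑ e, aE w k e) * ∏ e, (Gp (aE w k e) q).eval (1 / (N:ℝ)) := by
    rw [← prod_pow_eq_pow_sum, ← prod_mul_distrib, ← prod_mul_distrib]
    apply prod_congr rfl; intro e _
    have ha := (aE_le hf e).trans hq
    rw [desc_Gp (by omega), ← Gp_mul ha, Polynomial.eval_mul]
    have := Gp_pos (lt_of_le_of_lt ha hN) 0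
    rw [one_div, one_div, inv_pow]; field_simp
  have h3 : (∑ e, aE w k e) + 1 = (vs w k).card + exc w k := by
    have a := sum_aE w k hf
    have b := card_ds w k (fun i hi h => hf i hi (by rw [h]))
    omega
  rw [← mul_assoc, h2, h1, Wp, Polynomial.eval_mul, Polynomial.eval_mul, Polynomial.eval_prod, Polynomial.eval_prod,
    Polynomial.eval_pow, Polynomial.eval_X]
  have h4 : (1 / (N:ℝ))^(∑ e, aE w k e) * (N:ℝ)^((vs w k).card) = N * (1 / (N:ℝ))^(exc w k) := by
    rw [one_div, inv_pow, inv_pow]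
    field_simp
    rw [← pow_add, ← pow_succ, h3]
  grind

lemma Wp_deg (k q : ℕ) (w : ℕ → U × X) : (Wp k q w).natDegree ≤ 2 * k + 1 + (Fintype.card U)^2 * q := by
  unfold Wp
  refine Polynomial.natDegree_mul_le.trans ?_
  have h1 : (∏ e, Gp (aE w k e) q).natDegree ≤ (Fintype.card U)^2 * q := by
    refine (Polynomial.natDegree_prod_le _ _).trans ((sum_le_card_nsmul _ _ q ?_).trans ?_)
    · intro e _; exact (Gp_deg _ _).trans (Nat.sub_le _ _)
    · simp [sq]
  have h2 : (∏ u, Gp 0 (vU w k u)).natDegree ≤ k + 1 := by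
    refine (Polynomial.natDegree_prod_le _ _).trans ?_
    refine le_trans (sum_le_sum (g := fun u => vU w k u) fun u _ => Gp_deg _ _) ?_
    rw [sum_vU]; exact card_vs_le w k
  have h3 : (Polynomial.X ^ (exc w k) * (∏ u, Gp 0 (vU w k u)) : Polynomial ℝ).natDegree ≤ k + (k+1) := by
    refine Polynomial.natDegree_mul_le.trans ?_
    rw [Polynomial.natDegree_X_pow]
    have := exc_le w k
    omega
  omega

def Good {k : ℕ} (w : ℕ → U × Fin (k+1)) : Prop := Can w ∧ Cyc w k ∧ con w k

open Polynomial in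
def Pk (U : Type*) [Fintype U] [LinearOrder U] (k q : ℕ) : ℝ[X] :=
  ∑ w : Fin (k+1) → U × Fin (k+1), C (ind (Good (ex k w))) * Wp k q (ex k w)

lemma Pk_eval {k q : ℕ} (hk : 1 ≤ k) (hq : k ≤ q) (hN : q < N) :
    N * (Pk U k q).eval (1 / (N:ℝ)) = (∏ _e : U × U, (Gp 0 q).eval (1 / (N:ℝ))) *
      EE (fun t : U × U → PF N => CN (liftGraph (KK U) (sT t)) k) := by
  rw [EE_CN hk, Pk, Polynomial.eval_finsetSum, SW, mul_sum, mul_sum]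
  apply sum_congr rfl; intro w _
  rw [Polynomial.eval_mul, Polynomial.eval_C, Good]
  by_cases h : Cyc (ex k w) k
  · have := Wp_eval (N := N) h.hf hq hN
    rw [ind_and, ind_and]
    grind
  · rw [ind_and, ind_and, ind_false h]; simp

lemma Pk_deg (k q : ℕ) : (Pk U k q).natDegree ≤ 2 * k + 1 + (Fintype.card U)^2 * q := by
  unfold Pk
  apply Polynomial.natDegree_sum_le_of_forall_le
  intro w _
  exact (Polynomial.natDegree_C_mul_le _ _).trans (Wp_deg _ _ _)

lemma Wp_zero {k q : ℕ} {w : ℕ → U × X} (h : 1 ≤ exc w k) : (Wp k q w).eval 0 = 0 := by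
  unfold Wp
  rw [Polynomial.eval_mul, Polynomial.eval_mul, Polynomial.eval_pow, Polynomial.eval_X, zero_pow (by omega)]; simp

lemma Wp_der {k q : ℕ} {w : ℕ → U × X} (h : 1 ≤ exc w k) :
    (Wp k q w).derivative.eval 0 = ind (exc w k = 1) := by
  obtain ⟨m, hm⟩ : ∃ m, exc w k = m + 1 := ⟨exc w k - 1, by omega⟩
  have h1 : ((∏ u, Gp 0 (vU w k u)) * ∏ e, Gp (aE w k e) q).eval 0 = 1 := by
    rw [Polynomial.eval_mul, Polynomial.eval_prod, Polynomial.eval_prod]; simp [Gp_zero]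
  unfold Wp
  rw [mul_assoc, Polynomial.derivative_mul, Polynomial.eval_add, Polynomial.eval_mul, h1, Polynomial.eval_mul,
    Polynomial.eval_pow, Polynomial.eval_X, hm, zero_pow (by omega), Polynomial.derivative_X_pow]
  simp
  rcases m with _ | m
  · simp [ind]
  · simp [ind]

end

lemma exc_fresh {Z : Type*} (f : ℕ → Z) (T : ℕ) (h : ∀ i < T, f (i+1) ∉ vs f i) : exc f T = 0 := by
  induction T with
  | zero => rfl
  | succ T ih =>
    rw [exc, ih (fun i hi => h i (by omega))]
    grind

lemma fresh_inj {Z : Type*} {f : ℕ → Z} {T : ℕ} (h : ∀ i < T, f (i+1) ∉ vs f i) :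
    ∀ i ≤ T, ∀ j ≤ T, f i = f j → i = j := by
  have key : ∀ i j, i < j → j ≤ T → f i ≠ f j := by
    intro i j hij hj e
    obtain ⟨m, rfl⟩ : ∃ m, j = m + 1 := ⟨j-1, by omega⟩
    exact h m (by omega) (e ▸ mem_vs_self (by omega))
  grind

lemma cyc_struct {Z : Type*} (f : ℕ → Z) (k : ℕ) (hk : 1 ≤ k) (hne : ∀ i < k, f i ≠ f (i+1))
    (hnb : ∀ i, i+2 ≤ k → f (i+2) ≠ f i) (h0 : f k = f 0) (h1 : f (k-1) ≠ f 1) (he : exc f k ≤ 1) :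
    exc f k = 1 ∧ ∃ c, 1 ≤ c ∧ c ∣ k ∧ (∀ i < c, ∀ j < c, f i = f j → i = j) ∧ ∀ i ≤ k, f i = f (i % c) := by
  have hk1 : k - 1 + 1 = k := by omega
  have hold : f (k-1+1) ∈ vs f (k-1) := by rw [hk1, h0]; exact mem_vs_self (by omega)
  rcases struct f k hne hnb he with h | ⟨t, s, ht, hts, hsk, hfr, hin, hfr2, hcard, hexc⟩
  · grind
  have hs : s = k := by
    by_contra hs
    exact hfr2 (k-1) (by omega) (by omega) hold
  subst hs
  have hek : exc f s = 1 := le_antisymm he (hexc ▸ exc_mono f (by omega))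
  refine ⟨hek, ?_⟩
  have hinj := fresh_inj hfr
  have hvt : (vs f (t+1)).card = t + 1 := by
    rw [vs_succ, insert_eq_of_mem (hin (t+1) (by omega) (by omega)), card_vs_inj f t hfr]
  have hds : ds f (t+1) = ds f s := by
    apply eq_of_subset_of_card_le (ds_mono f (by omega))
    have a := card_ds f s hne
    have b := card_ds f (t+1) (fun i hi => hne i (by omega))
    omega
  obtain ⟨b, hb, hfb⟩ := mem_vs.1 (hin (t+1) (by omega) (by omega))
  have hedge : ∀ i < s, (f i, f (i+1)) ∈ ds f (t+1) := by
    intro i hi; rw [hds, mem_ds]; exact ⟨i, hi, Or.inl rfl⟩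
  have hb0 : f (t+1) = f 0 := by
    have := hedge (s-1) (by omega)
    rw [mem_ds] at this
    obtain ⟨i, hi, e | e⟩ := this
    · grind
    · grind
  have hinj' : ∀ i < t+1, ∀ j < t+1, f i = f j → i = j := fun i hi j hj => hinj i (by omega) j (by omega)
  have hmod : ∀ j < t+1, f (j+1) = f ((j+1) % (t+1)) := by
    intro j hj
    rcases Nat.lt_or_ge j t with h | h
    · rw [Nat.mod_eq_of_lt (by omega)]
    · have : j = t := by omega
      rw [this, Nat.mod_self, hb0]
  have hper : ∀ i ≤ s, f i = f (i % (t+1)) := by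
    intro i
    induction i using Nat.strong_induction_on with
    | _ i ih =>
      intro hi
      rcases Nat.lt_or_ge i (t+1) with h | h
      · rw [Nat.mod_eq_of_lt h]
      obtain ⟨m, rfl⟩ : ∃ m, i = m + 1 := ⟨i-1, by omega⟩
      have hm := ih m (by omega) (by omega)
      have hml : m % (t+1) < t+1 := Nat.mod_lt _ (by omega)
      rcases Nat.lt_or_ge m (t+1) with h' | h'
      · grind
      have := hedge m (by omega)
      rw [mem_ds] at this
      obtain ⟨j, hj, e | e⟩ := this
      · obtain ⟨e1, e2⟩ := Prod.mk.injEq _ _ _ _ ▸ e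
        rw [hm] at e1
        have := hinj' _ hml j hj e1
        rw [e2, hmod j hj, ← this, Nat.mod_add_mod]
      · obtain ⟨e1, e2⟩ := Prod.mk.injEq _ _ _ _ ▸ e
        rw [hm, hmod j hj] at e1
        have e3 := hinj' _ hml _ (Nat.mod_lt _ (by omega)) e1
        obtain ⟨p, rfl⟩ : ∃ p, m = p + 1 := ⟨m-1, by omega⟩
        have e4 : p % (t+1) = j % (t+1) := Nat.ModEq.add_right_cancel' 1 e3
        rw [Nat.mod_eq_of_lt hj] at e4
        grind
  refine ⟨t+1, by omega, ?_, hinj', hper⟩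
  have := hper s le_rfl
  rw [h0] at this
  exact Nat.dvd_of_mod_eq_zero (hinj' _ (Nat.mod_lt _ (by omega)) 0 (by omega) this.symm)

lemma sum_ind_eq {V : Type*} [Fintype V] (a : V) : ∑ v, ind (a = v) = 1 := by simp [ind]

lemma SW_inj {V V' : Type*} [Fintype V] [Fintype V'] {T T' : ℕ} {P : (ℕ → V) → Prop} {P' : (ℕ → V') → Prop}
    (φ : (ℕ → V) → ℕ → V') (h1 : ∀ f, P f → P' (ex T' (rs T' (φ f))))
    (h2 : ∀ f g, P f → P g → (∀ i ≤ T', φ f i = φ g i) → ∀ i ≤ T, f i = g i) :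
    SW T (fun f => ind (P f)) ≤ SW T' (fun f => ind (P' f)) := by
  unfold SW ind
  rw [sum_boole, sum_boole]
  norm_cast
  apply card_le_card_of_injOn (fun f => rs T' (φ (ex T f)))
  · intro f hf
    grind
  · intro f hf g hg e
    simp only [coe_filter, mem_univ, true_and, Set.mem_ofPred_eq] at hf hg e
    rw [← rs_ex T f, ← rs_ex T g]
    ext i
    apply h2 _ _ hf hg _ _ (by omega)
    intro i hi
    rw [← ex_rs T' (φ (ex T f)) i hi, e, ex_rs T' _ i hi]

section
variable {U : Type*} [Fintype U] [LinearOrder U]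

lemma CN_eq (k : ℕ) : CN (KK U) k =
    SW k (fun f => ind (f k = f 0 ∧ NB (KK U) k f ∧ f (k-1) ≠ f 1)) := by
  apply SW_congr; intro f; rw [ind_and, ind_and]; ring

def Mk (U : Type*) [Fintype U] [LinearOrder U] (k : ℕ) : ℝ :=
  SW k (fun w : ℕ → U × Fin (k+1) => ind (Good w ∧ exc w k = 1))

lemma Cyc.struct {k : ℕ} (hk : 1 ≤ k) {X : Type*} {w : ℕ → U × X} (h : Cyc w k) (he : exc w k ≤ 1) :
    exc w k = 1 ∧ ∃ c, 1 ≤ c ∧ c ∣ k ∧ (∀ i < c, ∀ j < c, w i = w j → i = j) ∧ ∀ i ≤ k, w i = w (i % c) := by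
  apply cyc_struct w k hk _ _ h.1 _ he
  · intro i hi e; exact h.hf i hi (by rw [e])
  · intro i hi e; exact h.2.1.2 i hi (by simp only [e])
  · intro e; exact h.2.2 (by rw [e])

lemma Pk_zero {k q : ℕ} (hk : 1 ≤ k) : (Pk U k q).eval 0 = 0 := by
  rw [Pk, Polynomial.eval_finsetSum]
  apply sum_eq_zero; intro w _
  rw [Polynomial.eval_mul, Polynomial.eval_C]
  by_cases h : Good (ex k w)
  · rw [Wp_zero, mul_zero]
    by_contra hh
    have := (h.2.1.struct hk (by omega)).1
    omega
  · rw [ind_false h, zero_mul]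

lemma Pk_der {k q : ℕ} (hk : 1 ≤ k) : (Pk U k q).derivative.eval 0 = Mk U k := by
  rw [Pk, Polynomial.derivative_sum, Polynomial.eval_finsetSum]
  apply sum_congr rfl; intro w _; beta_reduce
  rw [Polynomial.derivative_C_mul, Polynomial.eval_mul, Polynomial.eval_C]
  by_cases h : Good (ex k w)
  · rw [Wp_der, ind_and]
    by_contra hh
    have := (h.2.1.struct hk (by omega)).1
    omega
  · rw [ind_false h, zero_mul, ind_false (fun h' => h h'.1)]

lemma Good_of {k : ℕ} (hk1 : 1 ≤ k) {γ : ℕ → U} {w : ℕ → U × Fin (k+1)} (h1 : γ k = γ 0)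
    (h2 : NB (KK U) k γ) (h3 : γ (k-1) ≠ γ 1) (hw : ∀ i ≤ k, (w i).1 = γ i)
    (hw2 : ∀ i ≤ k, ((w i).2 : ℕ) = i % k) : Good w ∧ exc w k = 1 := by
  have hk : 2 ≤ k := by
    by_contra h
    obtain rfl : k = 1 := by omega
    exact h3 (by grind)
  have hinj : ∀ i < k, ∀ j < k, w i = w j → i = j := by
    intro i hi j hj e
    have := hw2 i hi.le
    rw [e, hw2 j hj.le, Nat.mod_eq_of_lt hi, Nat.mod_eq_of_lt hj] at this
    exact this.symm
  have hwk : w k = w 0 := by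
    apply Prod.ext
    · grind
    · apply Fin.ext; simp_all
  have hwm : ∀ i ≤ k, w i = w (i % k) := by
    intro i hi
    rcases Nat.lt_or_ge i k with h | h
    · rw [Nat.mod_eq_of_lt h]
    · have : i = k := by omega
      simp_all
  have hlt : ∀ i, i % k < k := fun i => Nat.mod_lt _ (by omega)
  have hmod : ∀ i ≤ k, ∀ j ≤ k, w i = w j → i % k = j % k := by
    intro i hi j hj e
    exact hinj _ (hlt _) _ (hlt _) (by grind)
  have hne : ∀ i < k, γ i ≠ γ (i+1) := fun i hi => by simpa using h2.1 i hi
  refine ⟨⟨?_, ⟨hwk, h2.congr (fun i hi => (hw i hi).symm), ?_⟩, ?_⟩, ?_⟩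
  · intro i hi
    rw [hw2 i hi]; symm
    apply fi_unique (hwm i hi).symm
    grind
  · grind
  · have mix : ∀ i < k, ∀ j < k, w i = w (j+1) → (w (i+1)).1 ≠ (w j).1 := by
      intro i hi j hj e
      have e1 := hmod i hi.le (j+1) (by omega) e
      rw [Nat.mod_eq_of_lt hi] at e1
      rw [hw (i+1) (by omega), hw j (by omega)]
      rcases Nat.lt_or_ge (j+1) k with h | h
      · rw [Nat.mod_eq_of_lt h] at e1
        subst e1; exact h2.2 j (by omega)
      · have hj1 : j = k - 1 := by omega
        grind
    intro x y z hy hz hyz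
    rw [mem_ds] at hy hz
    obtain ⟨i, hi, e | e⟩ := hy <;> obtain ⟨j, hj, e' | e'⟩ := hz <;>
      obtain ⟨e1, e2⟩ := Prod.mk.injEq _ _ _ _ ▸ e <;> obtain ⟨e3, e4⟩ := Prod.mk.injEq _ _ _ _ ▸ e'
    · have := hinj i hi j hj (by rw [← e1, e3])
      rw [e2, e4, this]
    · exact absurd (by rw [← e2, ← e4, hyz]) (mix i hi j hj (by rw [← e1, e3]))
    · exact absurd (by rw [← e2, ← e4, hyz]) (mix j hj i hi (by rw [← e3, e1]))
    · have a := hmod (i+1) (by omega) (j+1) (by omega) (by rw [← e1, e3])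
      have b : i % k = j % k := Nat.ModEq.add_right_cancel' 1 a
      rw [Nat.mod_eq_of_lt hi, Nat.mod_eq_of_lt hj] at b
      rw [e2, e4, b]
  · obtain ⟨m, rfl⟩ : ∃ m, k = m + 2 := ⟨k-2, by omega⟩
    have fr : ∀ i < m + 1, w (i+1) ∉ vs w i := by
      intro i hi h
      obtain ⟨j, hj, e⟩ := mem_vs.1 h
      have := hinj j (by omega) (i+1) (by omega) e
      omega
    rw [fresh_exc w m (fr m (by omega)) _ _ _, exc_fresh w (m+1) fr]
    · rw [hwk]; exact mem_vs_self (by omega)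
    · grind
    grind

lemma Mk_lower {k : ℕ} (hk : 1 ≤ k) : CN (KK U) k ≤ Mk U k := by
  rw [CN_eq]
  apply SW_inj (fun γ i => (γ i, (⟨i % k, (Nat.mod_lt _ (by omega)).trans (by omega)⟩ : Fin (k+1))))
  · rintro γ ⟨h1, h2, h3⟩
    apply Good_of hk h1 h2 h3
    · intro i hi; rw [ex_rs _ _ _ hi]
    · intro i hi; rw [ex_rs _ _ _ hi]
  simp

def Per (k c : ℕ) (γ : ℕ → U) : Prop :=
  (γ k = γ 0 ∧ NB (KK U) k γ ∧ γ (k-1) ≠ γ 1) ∧ ∀ i ≤ k, γ i = γ (i % c)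

lemma Per_count {D : ℝ} (hD : 1 ≤ D) (hG : Reg (KK U) D) {k c : ℕ} (hk : 1 ≤ k) (hc : c ∣ k) (hck : c < k) :
    SW k (fun γ : ℕ → U => ind (Per k c γ)) ≤ 2 * Fintype.card U * (Real.sqrt D)^k := by
  have hc0 : 0 < c := Nat.pos_of_dvd_of_pos hc (by omega)
  have hc2 : 2 * c ≤ k := by
    obtain ⟨m, rfl⟩ := hc
    have : 2 ≤ m := by
      by_contra h
      have : m = 0 ∨ m = 1 := by omega
      grind
    nlinarith
  calc _ ≤ SW c (fun γ : ℕ → U => ind (NB (KK U) c γ)) := by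
        apply SW_inj (fun γ => γ)
        · intro γ h
          exact (h.1.2.1.mono (by omega)).congr fun i hi => (ex_rs c γ i hi).symm
        · intro f g hf hg h i hi
          rw [hf.2 i hi, hg.2 i hi]
          exact h _ (Nat.mod_lt _ hc0).le
    _ = ∑ a : U, SW c (fun γ : ℕ → U => ind (γ 0 = a) * ind (NB (KK U) c γ)) := by
        rw [← SW_sum]; apply SW_congr; intro f
        rw [← sum_mul]; rw [sum_ind_eq, one_mul]
    _ ≤ ∑ a : U, 2 * D^c := sum_le_sum fun a _ => count_NB hG hD a c
    _ = 2 * Fintype.card U * (Real.sqrt D)^(2*c) := by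
        rw [pow_mul, Real.sq_sqrt (by linarith)]; simp; ring
    _ ≤ _ := by
        gcongr
        simp_all

lemma Mk_upper {D : ℝ} (hD : 1 ≤ D) (hG : Reg (KK U) D) {k : ℕ} (hk : 1 ≤ k) :
    Mk U k ≤ CN (KK U) k + k * (2 * Fintype.card U * (Real.sqrt D)^k) := by
  have h1 : Mk U k ≤ ∑ c ∈ (range (k+1)).filter (fun c => c ∣ k),
      SW k (fun w : ℕ → U × Fin (k+1) => ind (Cyc w k ∧ ∀ i ≤ k, w i = w (i % c) ∧ ((w i).2 : ℕ) = i % c)) := by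
    rw [← SW_sum]
    apply SW_mono; intro w
    by_cases h : Good w ∧ exc w k = 1
    · obtain ⟨_, c, hc1, hck, hinj, hper⟩ := h.1.2.1.struct hk h.2.le
      rw [ind_true h]
      have : (c : ℕ) ∈ (range (k+1)).filter (fun c => c ∣ k) := by
        simp only [mem_filter, mem_range]
        exact ⟨by have := Nat.le_of_dvd (by omega) hck; omega, hck⟩
      refine le_trans ?_ (single_le_sum (fun c _ => ind_nonneg _) this)
      rw [ind_true]
      refine ⟨h.1.2.1, fun i hi => ⟨hper i hi, ?_⟩⟩
      rw [h.1.1 i hi]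
      apply fi_unique (hper i hi).symm
      intro j hj e
      have hl := Nat.mod_lt i hc1
      grind
    · rw [ind_false h]; exact sum_nonneg fun _ _ => ind_nonneg _
  have h2 : ∀ c, SW k (fun w : ℕ → U × Fin (k+1) => ind (Cyc w k ∧ ∀ i ≤ k, w i = w (i % c) ∧ ((w i).2 : ℕ) = i % c))
      ≤ SW k (fun γ : ℕ → U => ind (Per k c γ)) := by
    intro c
    apply SW_inj (fun w i => (w i).1)
    · intro w h
      have e : ∀ i ≤ k, ex k (rs k (fun i => (w i).1)) i = (w i).1 := fun i hi => ex_rs _ _ _ hi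
      refine ⟨⟨?_, h.1.2.1.congr fun i hi => (e i hi).symm, ?_⟩, ?_⟩
      · rw [e k le_rfl, e 0 (by omega), h.1.1]
      · rw [e _ (by omega), e 1 (by omega)]; exact h.1.2.2
      grind
    · grind
  refine h1.trans ((sum_le_sum fun c _ => h2 c).trans ?_)
  have hkm : k ∈ (range (k+1)).filter (fun c => c ∣ k) := by simp
  rw [← add_sum_erase _ _ hkm]
  apply add_le_add
  · rw [CN_eq]; apply SW_mono; intro f; exact ind_mono fun h => h.1
  · refine (sum_le_card_nsmul _ _ (2 * Fintype.card U * (Real.sqrt D)^k) ?_).trans ?_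
    · intro c hc
      simp only [mem_erase, mem_filter, mem_range] at hc
      exact Per_count hD hG hk hc.2.2 (by omega)
    · rw [nsmul_eq_mul]
      gcongr
      grind
end

lemma sum_ind {V : Type*} [Fintype V] (P : V → Prop) : ∑ v, ind (P v) = (univ.filter P).card := by
  unfold ind; simp
lemma sum_ind_mem {V : Type*} [Fintype V] (s : Finset V) : ∑ v, ind (v ∈ s) = s.card := by
  rw [sum_ind]; simp

section
variable {U : Type*} [Fintype U] [LinearOrder U] {N : ℕ}

lemma con_congr {X : Type*} {f g : ℕ → U × X} {T : ℕ} (h : ∀ i ≤ T, f i = g i) : con f T = con g T := by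
  unfold con; rw [ds_congr h]

lemma con_deg {X : Type*} [Fintype X] {f : ℕ → U × X} {T : ℕ} (h : con f T) (x : U × X) :
    ∑ v, ind ((x, v) ∈ ds f T) ≤ Fintype.card U := by
  rw [sum_ind (fun v => (x, v) ∈ ds f T)]
  norm_cast
  rw [← card_univ]
  apply card_le_card_of_injOn (fun v => v.1) (fun _ _ => mem_coe.2 (mem_univ _))
  intro y hy z hz e
  simp only [coe_filter, mem_univ, true_and, Set.mem_ofPred_eq] at hy hz
  exact h x y z hy hz e

def Yw (a b : ℝ) (T : ℕ) (f : ℕ → U × Fin N) : ℝ := ind (con f T) * (a ^ (vs f T).card * b ^ exc f T)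

lemma Yw_succ {a b : ℝ} (ha : 0 ≤ a) (hb : 0 ≤ b) {k : ℕ} (hbk : b * k ≤ 1) (haN : a * N ≤ 2) {T : ℕ} (hT : T + 1 ≤ k) :
    SW (T+1) (Yw (U := U) (N := N) a b (T+1)) ≤ (3 * Fintype.card U + 1) * SW T (Yw (U := U) (N := N) a b T) := by
  let C : (ℕ → U × Fin N) → U × Fin N → ℝ := fun y v =>
    ind (con y T) * (a ^ (insert v (vs y T)).card * b ^ (exc y T + if (y T, v) ∉ ds y T ∧ v ∈ vs y T then 1 else 0))
  have hC : ∀ y y' z, (∀ i ≤ T, y i = y' i) → C y z = C y' z := by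
    intro y y' z h
    simp only [C]
    rw [con_congr h, vs_congr h, ds_congr h, exc_congr h, h T le_rfl]
  calc _ ≤ SW (T+1) (fun f => C f (f (T+1))) := by
        apply SW_mono; intro f
        simp only [C, Yw]
        rw [vs_succ, exc]
        apply le_of_eq_of_le (b := ind (con f (T+1)) * (a ^ (insert (f (T+1)) (vs f T)).card * b ^ (exc f T + if (f T, f (T+1)) ∉ ds f T ∧ f (T+1) ∈ vs f T then 1 else 0))) (by congr!)
        apply mul_le_mul_of_nonneg_right _ (by positivity)
        apply ind_mono
        intro h x y z hy hz
        exact h x y z (ds_mono f (by omega) hy) (ds_mono f (by omega) hz)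
    _ = SW T (fun y => ∑ v, C y v) := SW_succ T C hC
    _ ≤ SW T (fun y => (3 * Fintype.card U + 1) * Yw a b T y) := by
        apply SW_mono; intro y
        by_cases hc : con y T
        · have h1 : ∀ v, C y v ≤ (a ^ (vs y T).card * b ^ exc y T) * (a + b * ind (v ∈ vs y T) + ind ((y T, v) ∈ ds y T)) := by
            intro v
            simp only [C]; rw [ind_true hc, one_mul]
            have p1 : 0 ≤ a ^ (vs y T).card * b ^ exc y T := by positivity
            by_cases h2 : v ∈ vs y T
            · rw [insert_eq_of_mem h2, ind_true h2]
              by_cases h3 : (y T, v) ∈ ds y T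
              · rw [ind_true h3]; simp only [h3, not_true, false_and, if_false, add_zero]
                nlinarith
              · rw [ind_false h3]; simp only [h3, h2, not_false_eq_true, and_self, if_true]
                rw [pow_succ]; nlinarith
            · have h3 : (y T, v) ∉ ds y T := fun h => h2 (snd_mem_of_ds h)
              rw [ind_false h2, ind_false h3, card_insert_of_notMem h2]
              simp only [h2, and_false, if_false, add_zero]
              rw [pow_succ]; nlinarith
          refine (sum_le_sum fun v _ => h1 v).trans ?_
          rw [← mul_sum, sum_add_distrib, sum_add_distrib, ← mul_sum, sum_ind_mem]
          rw [Yw, ind_true hc, one_mul, mul_comm]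
          apply mul_le_mul_of_nonneg_right _ (by positivity)
          have e1 : ∑ _v : U × Fin N, a ≤ 2 * Fintype.card U := by
            simp; nlinarith [(Nat.cast_nonneg (Fintype.card U) : (0:ℝ) ≤ _)]
          have e2 : b * ((vs y T).card : ℝ) ≤ 1 := by
            refine le_trans ?_ hbk
            gcongr
            exact_mod_cast (card_vs_le y T).trans hT
          have e3 := con_deg hc (y T)
          linarith
        · simp only [C, Yw, ind_false hc]; simp
    _ = _ := SW_const_mul _ _

lemma Yw_bound {a b : ℝ} (ha : 0 ≤ a) (hb : 0 ≤ b) {k : ℕ} (hbk : b * k ≤ 1) (haN : a * N ≤ 2) {T : ℕ} (hT : T ≤ k) :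
    SW T (Yw (U := U) (N := N) a b T) ≤ 2 * Fintype.card U * (3 * Fintype.card U + 1)^T := by
  induction T with
  | zero =>
    rw [SW_zero]
    simp only [Yw, vs_zero, exc]
    refine (sum_le_sum (g := fun _ => a) fun v _ => ?_).trans ?_
    · simp; exact mul_le_of_le_one_left ha (ind_le_one _)
    · simp; nlinarith [(Nat.cast_nonneg (Fintype.card U) : (0:ℝ) ≤ _)]
  | succ T ih =>
    refine (Yw_succ ha hb hbk haN hT).trans ?_
    refine (mul_le_mul_of_nonneg_left (ih (by omega)) (by positivity)).trans ?_
    rw [pow_succ]; grind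

lemma EE_TF {L : ℕ} (hN : 2 * (L+1) ≤ N) :
    EE (fun t : U × U → PF N => ind (¬ TF (liftGraph (KK U) (sT t)) L)) ≤
      4 * Fintype.card U * (L+1)^3 * (3 * Fintype.card U + 1)^L / N := by
  have hN0 : (0:ℝ) < N := by exact_mod_cast (by omega : 0 < N)
  have hN2 : 2 * ((L:ℝ)+1) ≤ N := by exact_mod_cast hN
  have hL0 : (0:ℝ) ≤ L := Nat.cast_nonneg L
  have hD : (0:ℝ) < N - (L+1) := by linarith
  obtain ⟨a, ha⟩ : ∃ a, a = 1 / ((N:ℝ) - (L+1)) := ⟨_, rfl⟩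
  obtain ⟨b, hb⟩ : ∃ b, b = 1 / ((L:ℝ)+1) := ⟨_, rfl⟩
  have ha0 : 0 < a := by rw [ha]; positivity
  have hb0 : 0 < b := by rw [hb]; positivity
  have haN : a * N ≤ 2 := by rw [ha, one_div, inv_mul_le_iff₀ hD]; linarith
  have hbk : b * ((L+1:ℕ):ℝ) ≤ 1 := by rw [hb]; push_cast; rw [one_div, inv_mul_cancel₀ (by positivity)]
  have key : ∀ T ≤ L, ∀ f : ℕ → U × Fin N,
      EE (fun t => ind (IsW (liftGraph (KK U) (sT t)) T f) * ind (2 ≤ exc f T)) ≤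
        (a * (L+1)^2) * Yw a b T f := by
    intro T hT f
    have hY : 0 ≤ Yw a b T f := by unfold Yw; have := ind_nonneg (con f T); positivity
    by_cases h2 : 2 ≤ exc f T
    · by_cases hf : IsW (KK U) T (fun i => (f i).1)
      · have hf' : ∀ i < T, (f i).1 ≠ (f (i+1)).1 := fun i hi => by simpa using hf i hi
        simp only [ind_true h2, mul_one, IsW_lift (sT_anti _), and_true, hf]
        rw [EE_Fol hf', Yw]
        have hsum : (∑ e, aE f T e) + 1 = (vs f T).card + exc f T := by
          have a := sum_aE f T hf'
          have b := card_ds f T (fun i hi h => hf' i hi (by rw [h]))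
          omega
        have h3 : ∏ e, (1 / (N.descFactorial (aE f T e) : ℝ)) ≤ a ^ (∑ e, aE f T e) := by
          rw [← prod_pow_eq_pow_sum]
          apply prod_le_prod
          · simp
          · intro e _
            rw [ha, one_div, one_div, inv_pow]
            apply inv_anti₀ (by positivity)
            have q := Nat.pow_sub_le_descFactorial N (aE f T e)
            have q2 := aE_le hf' e
            calc ((N:ℝ) - (L+1))^(aE f T e) ≤ ((N + 1 - aE f T e : ℕ) : ℝ)^(aE f T e) := by
                  gcongr
                  rw [Nat.cast_sub (by omega)]
                  have : (aE f T e : ℝ) ≤ L := by exact_mod_cast q2.trans hT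
                  grind
              _ ≤ _ := by exact_mod_cast q
        have h4 : a ^ (∑ e, aE f T e) ≤ (a * (L+1)^2) * (a ^ (vs f T).card * b ^ exc f T) := by
          obtain ⟨m, hm⟩ : ∃ m, exc f T = m + 2 := ⟨exc f T - 2, by omega⟩
          have : ∑ e, aE f T e = m + (vs f T).card + 1 := by omega
          rw [this, hm]
          have hab : a ≤ b := by
            rw [ha, hb]; apply one_div_le_one_div_of_le (by positivity); linarith
          have hb1 : b * ((L:ℝ)+1) = 1 := by rw [hb]; field_simp
          calc a ^ (m + (vs f T).card + 1) = a ^ (vs f T).card * a * a^m := by ring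
            _ ≤ a ^ (vs f T).card * a * b^m := by gcongr
            _ = a ^ (vs f T).card * a * b^m * (b * ((L:ℝ)+1))^2 := by grind
            _ = _ := by ring
        calc _ ≤ ind (con f T) * ((a * (L+1)^2) * (a ^ (vs f T).card * b ^ exc f T)) :=
              mul_le_mul_of_nonneg_left (h3.trans h4) (ind_nonneg _)
          _ = _ := by ring
      · have : ∀ t : U × U → PF N, ind (IsW (liftGraph (KK U) (sT t)) T f) * ind (2 ≤ exc f T) = 0 := by
          intro t; rw [ind_false (fun h => hf ((IsW_lift (sT_anti t)).1 h).2), zero_mul]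
        simp only [this, EE_const]; positivity
    · simp only [ind_false h2, mul_zero, EE_const]; positivity
  calc _ ≤ EE (fun t : U × U → PF N => ∑ T ∈ range (L+1),
        SW T (fun f => ind (IsW (liftGraph (KK U) (sT t)) T f) * ind (2 ≤ exc f T))) := by
        apply EE_mono; intro t
        by_cases h : TF (liftGraph (KK U) (sT t)) L
        · rw [ind_false (by simpa using h)]
          exact sum_nonneg fun T _ => SW_nonneg fun f => mul_nonneg (ind_nonneg _) (ind_nonneg _)
        · rw [ind_true h]
          unfold TF at h; push Not at h
          obtain ⟨T, hT, f, hf, he⟩ := h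
          refine le_trans ?_ (single_le_sum (f := fun T => SW T (fun f => ind (IsW (liftGraph (KK U) (sT t)) T f) * ind (2 ≤ exc f T))) (fun T _ => SW_nonneg fun f => mul_nonneg (ind_nonneg _) (ind_nonneg _)) (mem_range.2 (by omega : T < L + 1)))
          have hx : ∀ i ≤ T, f i = ex T (rs T f) i := fun i hi => (ex_rs T f i hi).symm
          refine le_trans ?_ (single_le_sum (f := fun g => ind (IsW (liftGraph (KK U) (sT t)) T (ex T g)) * ind (2 ≤ exc (ex T g) T)) (fun g _ => mul_nonneg (ind_nonneg _) (ind_nonneg _)) (mem_univ (rs T f)))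
          rw [ind_true, ind_true, one_mul]
          · rw [← exc_congr hx]; exact he
          · intro i hi; rw [← hx i hi.le, ← hx (i+1) hi]; exact hf i hi
    _ = ∑ T ∈ range (L+1), SW T (fun f => EE (fun t : U × U → PF N =>
          ind (IsW (liftGraph (KK U) (sT t)) T f) * ind (2 ≤ exc f T))) := by
        rw [EE_sum]; apply sum_congr rfl; intro T _; rw [EE_SW]
    _ ≤ ∑ T ∈ range (L+1), (a * (L+1)^2) * (2 * Fintype.card U * (3 * Fintype.card U + 1)^L) := by
        apply sum_le_sum; intro T hT
        have hT : T ≤ L := by simpa [Nat.lt_succ_iff] using hT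
        refine (SW_mono fun f => key T hT f).trans ?_
        rw [SW_const_mul]
        have hU : (0:ℝ) ≤ Fintype.card U := Nat.cast_nonneg _
        refine mul_le_mul_of_nonneg_left ((Yw_bound ha0.le hb0.le hbk haN (by omega : T ≤ L+1)).trans ?_) (by positivity)
        gcongr
        linarith
    _ = (a * N) * (2 * Fintype.card U * (L+1)^3 * (3 * Fintype.card U + 1)^L / N) := by
        rw [sum_const, card_range, nsmul_eq_mul]; grind
    _ ≤ 2 * (2 * Fintype.card U * (L+1)^3 * (3 * Fintype.card U + 1)^L / N) := by
        gcongr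
    _ = _ := by ring
end

section
open Polynomial Polynomial.Chebyshev MeasureTheory

lemma cheb_exp (n : ℕ) : ∀ p : ℝ[X], p.natDegree ≤ n →
    ∃ a : ℕ → ℝ, p = ∑ k ∈ range (n+1), C (a k) * T ℝ k := by
  induction n with
  | zero =>
    intro p hp
    refine ⟨fun _ => p.coeff 0, ?_⟩
    simp [← Polynomial.eq_C_of_natDegree_le_zero hp]
  | succ n ih =>
    intro p hp
    have hd : (T ℝ ((n+1:ℕ):ℤ)).natDegree = n+1 := by
      rw [Polynomial.Chebyshev.natDegree_T, Int.natAbs_natCast]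
    have hl : (T ℝ ((n+1:ℕ):ℤ)).coeff (n+1) ≠ 0 := by
      have : (T ℝ ((n+1:ℕ):ℤ)).leadingCoeff ≠ 0 := by
        rw [Polynomial.leadingCoeff_ne_zero]; intro h; rw [h] at hd; simp at hd
      rwa [Polynomial.leadingCoeff, hd] at this
    set L := (T ℝ ((n+1:ℕ):ℤ)).coeff (n+1) with hL
    obtain ⟨a, ha⟩ := ih (p - C (p.coeff (n+1) / L) * T ℝ ((n+1:ℕ):ℤ)) (by
      rw [Polynomial.natDegree_le_iff_coeff_eq_zero]
      intro m hm
      rw [Polynomial.coeff_sub, Polynomial.coeff_C_mul]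
      rcases Nat.lt_or_ge (n+1) m with h | h
      · rw [Polynomial.coeff_eq_zero_of_natDegree_lt (by omega),
          Polynomial.coeff_eq_zero_of_natDegree_lt (p := T ℝ ((n+1:ℕ):ℤ)) (by grind)]; simp
      grind)
    refine ⟨fun k => if k = n+1 then p.coeff (n+1) / L else a k, ?_⟩
    rw [sum_range_succ]
    beta_reduce
    rw [if_pos rfl]
    rw [sum_congr rfl (g := fun k => C (a k) * T ℝ k)]
    · grind
    grind

lemma cheb_coeff {n : ℕ} {p : ℝ[X]} {a : ℕ → ℝ} {M : ℝ}
    (hp : p = ∑ k ∈ range (n+1), C (a k) * T ℝ k) (hM : ∀ x, |x| ≤ 1 → |p.eval x| ≤ M)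
    {j : ℕ} (hj : j ≤ n) : |a j| ≤ 2 * M := by
  have hM0 : 0 ≤ M := (abs_nonneg _).trans (hM 0 (by simp))
  have hi : ∀ k : ℕ, Integrable (fun x => (T ℝ k).eval x * (T ℝ j).eval x) measureT := fun k =>
    integrable_measureT (by fun_prop)
  have h1 : ∫ x, p.eval x * (T ℝ j).eval x ∂measureT =
      a j * ∫ x, (T ℝ j).eval x * (T ℝ j).eval x ∂measureT := by
    have : ∀ x, p.eval x * (T ℝ j).eval x =
        ∑ k ∈ range (n+1), a k * ((T ℝ k).eval x * (T ℝ j).eval x) := by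
      intro x; rw [hp, Polynomial.eval_finsetSum, sum_mul]
      apply sum_congr rfl; intros; simp; ring
    simp_rw [this]
    rw [integral_finsetSum _ (fun k _ => (hi k).const_mul _)]
    simp_rw [integral_const_mul]
    rw [sum_eq_single j]
    · intro k _ hk; rw [integral_eval_T_real_mul_eval_T_real_measureT_of_ne hk, mul_zero]
    · grind
  have h2 : |∫ x, p.eval x * (T ℝ j).eval x ∂measureT| ≤ M * Real.pi := by
    rw [integral_measureT_eq_integral_cos]
    have := intervalIntegral.norm_integral_le_of_norm_le_const (a := 0) (b := Real.pi) (C := M)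
      (f := fun θ => p.eval (Real.cos θ) * (T ℝ j).eval (Real.cos θ)) (by
        intro θ _
        rw [Real.norm_eq_abs, abs_mul]
        have h3 := hM _ (Real.abs_cos_le_one θ)
        have h4 := abs_eval_T_real_le_one j (Real.abs_cos_le_one θ)
        nlinarith [abs_nonneg (p.eval (Real.cos θ)), abs_nonneg ((T ℝ (j:ℤ)).eval (Real.cos θ))])
    rw [Real.norm_eq_abs, sub_zero, abs_of_pos Real.pi_pos] at this
    exact this
  have h3 : Real.pi/2 ≤ ∫ x, (T ℝ j).eval x * (T ℝ j).eval x ∂measureT := by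
    rcases Nat.eq_zero_or_pos j with h | h
    · subst h; rw [Nat.cast_zero, integral_eval_T_real_mul_self_measureT_zero]; linarith [Real.pi_pos]
    · rw [integral_T_real_mul_self_measureT_of_ne_zero (by omega)]
  rw [h1, abs_mul] at h2
  have h4 := le_abs_self (∫ x, (T ℝ j).eval x * (T ℝ j).eval x ∂measureT)
  have h5 : |a j| * (Real.pi/2) ≤ M * Real.pi :=
    le_trans (mul_le_mul_of_nonneg_left (h3.trans h4) (abs_nonneg _)) h2
  have := Real.pi_pos
  by_contra hc
  push Not at hc
  nlinarith

lemma markov {n : ℕ} {p : ℝ[X]} (hn : p.natDegree ≤ n) {M : ℝ}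
    (hM : ∀ x, |x| ≤ 1 → |p.eval x| ≤ M) {x : ℝ} (hx : |x| ≤ 1) :
    |p.derivative.eval x| ≤ 2 * (n+1)^3 * M := by
  have hM0 : 0 ≤ M := (abs_nonneg _).trans (hM 0 (by simp))
  obtain ⟨a, ha⟩ := cheb_exp n p hn
  have : p.derivative.eval x = ∑ k ∈ range (n+1), a k * (T ℝ (k:ℤ)).derivative.eval x := by
    rw [ha, Polynomial.derivative_sum, Polynomial.eval_finsetSum]
    apply sum_congr rfl; intros; simp
  rw [this]
  refine (abs_sum_le_sum_abs _ _).trans ?_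
  refine (sum_le_card_nsmul _ _ (2 * M * (n+1)^2) ?_).trans ?_
  · intro k hk
    have hk' : k ≤ n := by have := mem_range.1 hk; omega
    rw [abs_mul]
    have h1 := cheb_coeff ha hM hk'
    have h2 := abs_iterate_derivative_T_real_le k 1 hx
    rw [Function.iterate_one, derivative_T_eval_one] at h2
    have h3 : ((k:ℤ):ℝ)^2 ≤ (n+1)^2 := by
      have : (k:ℝ) ≤ n := by exact_mod_cast hk'
      push_cast; gcongr; linarith
    exact mul_le_mul h1 (h2.trans h3) (abs_nonneg _) (by linarith)
  · rw [card_range, nsmul_eq_mul]; grind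

lemma markov_c {n : ℕ} {p : ℝ[X]} (hn : p.natDegree ≤ n) {M c : ℝ} (hc : 0 < c)
    (hM : ∀ x, 0 ≤ x → x ≤ c → |p.eval x| ≤ M) {x : ℝ} (hx0 : 0 ≤ x) (hx : x ≤ c) :
    |p.derivative.eval x| ≤ 4 / c * (n+1)^3 * M := by
  set q := p.comp (C (c/2) * X + C (c/2)) with hq
  have hqd : q.natDegree ≤ n := by
    rw [hq]; refine Polynomial.natDegree_comp_le.trans ?_
    have : (C (c/2) * X + C (c/2)).natDegree ≤ 1 := Polynomial.natDegree_linear_le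
    nlinarith
  have h := markov (p := q) hqd (M := M) (by
    intro y hy
    rw [abs_le] at hy
    rw [hq, Polynomial.eval_comp]
    apply hM
    · simp; nlinarith
    · simp; nlinarith) (x := 2*x/c - 1) (by
      rw [abs_le]; constructor
      · have : 0 ≤ 2*x/c := by positivity
        linarith
      · have : 2*x/c ≤ 2 := by rw [div_le_iff₀ hc]; linarith
        linarith)
  rw [hq, Polynomial.derivative_comp, Polynomial.eval_mul, Polynomial.eval_comp] at h
  simp only [derivative_add, derivative_mul, derivative_C, zero_mul, derivative_X, mul_one, zero_add, add_zero,
    eval_C, eval_add, eval_mul, eval_X] at h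
  have e : c / 2 * (2 * x / c - 1) + c / 2 = x := by field_simp; ring
  rw [e, abs_mul, abs_of_pos (by positivity)] at h
  rw [div_mul_eq_mul_div, div_mul_eq_mul_div, le_div_iff₀ hc]
  linarith
end

section
open Polynomial

lemma mvt_poly (p : ℝ[X]) {c L : ℝ} (hL : ∀ x, 0 ≤ x → x ≤ c → |p.derivative.eval x| ≤ L)
    {x y : ℝ} (hx0 : 0 ≤ x) (hx : x ≤ c) (hy0 : 0 ≤ y) (hy : y ≤ c) :
    |p.eval x - p.eval y| ≤ L * |x - y| := by
  have := Convex.norm_image_sub_le_of_norm_hasDerivWithin_le (f := fun x => p.eval x)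
    (f' := fun x => p.derivative.eval x) (s := Set.Icc 0 c) (C := L)
    (fun z _ => (p.hasDerivAt z).hasDerivWithinAt) (fun z hz => hL z hz.1 hz.2) (convex_Icc 0 c)
    (x := y) (y := x) ⟨hy0, hy⟩ ⟨hx0, hx⟩
  exact this

lemma disc_sup {n : ℕ} {p : ℝ[X]} (hn : p.natDegree ≤ n) {M : ℝ} {N1 : ℕ}
    (hN1 : 8 * ((n:ℝ)+1)^3 ≤ N1) (hM : ∀ N' : ℕ, N1 ≤ N' → |p.eval (1/(N':ℝ))| ≤ M)
    {x : ℝ} (hx0 : 0 ≤ x) (hx : x ≤ 1/(N1:ℝ)) : |p.eval x| ≤ 2 * M := by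
  have hN1p : (0:ℝ) < N1 := lt_of_lt_of_le (by positivity) hN1
  have hN1n : 1 ≤ N1 := by exact_mod_cast hN1p
  obtain ⟨z, hz, hmax⟩ := (isCompact_Icc (a := (0:ℝ)) (b := 1/(N1:ℝ))).exists_isMaxOn
    ⟨0, le_rfl, by positivity⟩ (f := fun x => |p.eval x|) (by fun_prop)
  have hmax' : ∀ y, 0 ≤ y → y ≤ 1/(N1:ℝ) → |p.eval y| ≤ |p.eval z| := fun y h1 h2 => hmax ⟨h1, h2⟩
  refine (hmax' x hx0 hx).trans ?_
  have hy : ∃ N' : ℕ, N1 ≤ N' ∧ |z - 1/(N':ℝ)| ≤ 1/(N1:ℝ)^2 := by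
    rcases hz.1.eq_or_lt with h | h
    · refine ⟨N1^2, by nlinarith, ?_⟩
      rw [← h]; simp
    · have h1 := Nat.le_ceil (1/z)
      have h2 := Nat.ceil_lt_add_one (a := 1/z) (by positivity)
      set N' := ⌈1/z⌉₊
      have h3 : (N1:ℝ) ≤ 1/z := by
        rw [le_div_iff₀ h]
        have := hz.2
        rw [le_div_iff₀ hN1p] at this; linarith
      have hN' : (0:ℝ) < N' := by linarith
      refine ⟨N', by exact_mod_cast h3.trans h1, ?_⟩
      have h4 : 1/(N':ℝ) ≤ z := by
        rw [div_le_iff₀ hN']; rw [div_le_iff₀ h] at h1; linarith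
      rw [abs_of_nonneg (by linarith)]
      have h5 : z - 1/(N':ℝ) = z * (1/N') * (N' - 1/z) := by field_simp
      rw [h5]
      have h6 : z * (1/N') * (N' - 1/z) ≤ z * (1/N') * 1 := by
        apply mul_le_mul_of_nonneg_left _ (by positivity); linarith
      have h7 : z * (1/(N':ℝ)) ≤ (1/(N1:ℝ)) * (1/N1) :=
        mul_le_mul hz.2 (h4.trans hz.2) (by positivity) (by positivity)
      calc _ ≤ _ := h6
        _ ≤ (1/(N1:ℝ)) * (1/N1) := by grind
        _ = _ := by field_simp
  obtain ⟨N', h1, h2⟩ := hy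
  have hN' : (N1:ℝ) ≤ N' := by exact_mod_cast h1
  have h3 := mvt_poly p (c := 1/(N1:ℝ)) (L := 4/(1/(N1:ℝ)) * (n+1)^3 * |p.eval z|)
    (fun y hy0 hy => markov_c hn (by positivity) hmax' hy0 hy) hz.1 hz.2 (y := 1/(N':ℝ)) (by positivity)
    (one_div_le_one_div_of_le hN1p hN')
  have h4 := hM N' h1
  have h5 : 4/(1/(N1:ℝ)) * (n+1)^3 * |p.eval z| * |z - 1/(N':ℝ)| ≤ |p.eval z| / 2 := by
    calc _ ≤ 4/(1/(N1:ℝ)) * (n+1)^3 * |p.eval z| * (1/(N1:ℝ)^2) := by gcongr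
      _ = (8 * (n+1)^3) / N1 * (|p.eval z| / 2) := by grind
      _ ≤ 1 * (|p.eval z| / 2) := by
        gcongr; rw [div_le_one hN1p]; exact hN1
      _ = _ := one_mul _
  grind

lemma disc_taylor {n : ℕ} {p : ℝ[X]} (hn : p.natDegree ≤ n) {M : ℝ} {N1 : ℕ}
    (hN1 : 8 * ((n:ℝ)+1)^3 ≤ N1) (hM : ∀ N' : ℕ, N1 ≤ N' → |p.eval (1/(N':ℝ))| ≤ M)
    {N : ℕ} (hN : N1 ≤ N) :
    |p.eval (1/(N:ℝ))| ≤ |p.eval 0| + |p.derivative.eval 0| / N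
      + 32 * (N1:ℝ)^2 * (n+1)^6 * M / (N:ℝ)^2 := by
  have hN1p : (0:ℝ) < N1 := lt_of_lt_of_le (by positivity) hN1
  have hNN : (N1:ℝ) ≤ N := by exact_mod_cast hN
  have hNp : (0:ℝ) < N := by linarith
  have hx : 1/(N:ℝ) ≤ 1/(N1:ℝ) := one_div_le_one_div_of_le hN1p hNN
  have h0 : ∀ x, 0 ≤ x → x ≤ 1/(N1:ℝ) → |p.eval x| ≤ 2 * M := fun x a b => disc_sup hn hN1 hM a b
  have h1 : ∀ x, 0 ≤ x → x ≤ 1/(N1:ℝ) → |p.derivative.eval x| ≤ _ :=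
    fun x a b => markov_c hn (by positivity) h0 a b
  have h2 : ∀ x, 0 ≤ x → x ≤ 1/(N1:ℝ) → |p.derivative.derivative.eval x| ≤ _ :=
    fun x a b => markov_c ((p.natDegree_derivative_le.trans (by omega)).trans hn) (by positivity) h1 a b
  set L := 4 / (1 / (N1:ℝ)) * ((n:ℝ) + 1) ^ 3 * (4 / (1 / (N1:ℝ)) * ((n:ℝ) + 1) ^ 3 * (2 * M)) with hL
  have hM0 : 0 ≤ M := (abs_nonneg _).trans (hM _ le_rfl)
  have hL0 : 0 ≤ L := by positivity
  have h3 : ∀ x, 0 ≤ x → x ≤ 1/(N:ℝ) → |(p - C (p.derivative.eval 0) * X).derivative.eval x| ≤ L * (1/N) := by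
    intro x a b
    have := mvt_poly p.derivative h2 a (b.trans hx) le_rfl (by positivity)
    simp only [derivative_sub, derivative_mul, derivative_C, zero_mul, derivative_X, mul_one, zero_add, eval_sub, eval_C]
    refine this.trans ?_
    rw [sub_zero, abs_of_nonneg a]; gcongr
  have h4 := mvt_poly _ h3 (x := 1/(N:ℝ)) (by positivity) le_rfl (y := 0) le_rfl (by positivity)
  simp only [eval_sub, eval_mul, eval_C, eval_X, mul_zero, sub_zero] at h4
  rw [abs_of_nonneg (a := 1/(N:ℝ)) (by positivity)] at h4
  have h5 : L * (1/(N:ℝ)) * (1/N) = 32 * (N1:ℝ)^2 * (n+1)^6 * M / (N:ℝ)^2 := by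
    rw [hL]; field_simp; ring
  rw [h5] at h4
  have h6 : p.eval (1/(N:ℝ)) = (p.eval (1/(N:ℝ)) - p.derivative.eval 0 * (1/N) - p.eval 0) + p.eval 0
      + p.derivative.eval 0 * (1/N) := by ring
  rw [h6]
  refine (abs_add_le _ _).trans ?_
  have h7 := abs_add_le (p.eval (1/(N:ℝ)) - p.derivative.eval 0 * (1/N) - p.eval 0) (p.eval 0)
  have h8 : |p.derivative.eval 0 * (1/(N:ℝ))| = |p.derivative.eval 0| / N := by
    rw [abs_mul, abs_of_nonneg (a := 1/(N:ℝ)) (by positivity), mul_one_div]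
  rw [h8]
  linarith

lemma rp_T {D : ℝ} (hD : 0 < D) : ∀ k : ℕ, ∀ x : ℝ,
    (rp D k).eval x = 2 * (√D)^k * (Chebyshev.T ℝ k).eval (x / (2*√D)) := by
  have hs : 0 < √D := Real.sqrt_pos.2 hD
  have hs2 : √D * √D = D := Real.mul_self_sqrt hD.le
  intro k
  induction k using Nat.strong_induction_on with
  | _ k ih =>
    intro x
    match k with
    | 0 => simp [rp]
    | 1 => simp [rp]; field_simp
    | (k+2) =>
      have e : ((k+2:ℕ):ℤ) = (k:ℤ)+2 := by push_cast; ring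
      have e1 : ((k+1:ℕ):ℤ) = (k:ℤ)+1 := by push_cast; ring
      rw [show rp D (k+2) = X * rp D (k+1) - C D * rp D k from rfl, e, Chebyshev.T_add_two, ← e1]
      simp only [eval_sub, eval_mul, eval_X, eval_C]
      rw [ih (k+1) (by omega), ih k (by omega)]
      simp only [eval_ofNat]
      field_simp
      linear_combination (√D^(k) * √D * eval (x / (2 * √D)) (Chebyshev.T ℝ (k:ℤ))) * hs2

lemma rp_exp {D : ℝ} (hD : 0 < D) {n : ℕ} {h : ℝ[X]} (hn : h.natDegree ≤ n) {η : ℝ}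
    (hη : ∀ x, |x| ≤ 2*√D → |h.eval x| ≤ η) :
    ∃ a : ℕ → ℝ, h = ∑ k ∈ range (n+1), C (a k) * rp D k ∧
      ∀ k ≤ n, |a k| * (√D)^k ≤ η := by
  have hs : 0 < √D := Real.sqrt_pos.2 hD
  set q := h.comp (C (2*√D) * X) with hq
  have hqd : q.natDegree ≤ n := by
    rw [hq]; refine Polynomial.natDegree_comp_le.trans ?_
    have : (C (2*√D) * X : ℝ[X]).natDegree ≤ 1 := by
      simpa using Polynomial.natDegree_linear_le (a := 2*√D) (b := 0)
    nlinarith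
  obtain ⟨a, ha⟩ := cheb_exp n q hqd
  have hb := fun j (hj : j ≤ n) => cheb_coeff (M := η) ha (by
    intro x hx
    rw [hq, eval_comp]; simp only [eval_mul, eval_C, eval_X]
    apply hη
    rw [abs_mul, abs_of_pos (by positivity)]
    nlinarith) hj
  refine ⟨fun k => a k / (2 * (√D)^k), ?_, ?_⟩
  · apply Polynomial.funext
    intro x
    have h1 : h.eval x = q.eval (x / (2*√D)) := by
      rw [hq, eval_comp]; simp only [eval_mul, eval_C, eval_X]; congr 1; field_simp
    rw [h1, ha, eval_finsetSum, eval_finsetSum]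
    apply sum_congr rfl
    intro k _
    rw [eval_mul, eval_mul, rp_T hD, eval_C, eval_C]
    field_simp
  · intro k hk
    rw [abs_div, abs_of_pos (a := 2 * (√D)^k) (by positivity), div_mul_eq_mul_div, div_le_iff₀ (by positivity)]
    have := hb k hk
    have h2 : 0 < (√D)^k := by positivity
    nlinarith
end

section
open Matrix
variable {V : Type*} [Fintype V] {ℓ : ℕ}

lemma tr_nonneg {n : Type*} [Fintype n] [DecidableEq n] [Nonempty n] (B : Matrix n n ℝ) (hB : B.IsHermitian) (M : ℝ)
    (hM : ∀ f : n → ℝ, |f ⬝ᵥ (B *ᵥ f)| ≤ M * (f ⬝ᵥ f)) (h : Polynomial ℝ)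
    (h0 : ∀ x, |x| ≤ M → 0 ≤ h.eval x) : 0 ≤ (Polynomial.aeval B h).trace := by
  by_contra hc
  push Not at hc
  have := spec_lemma B hB M (-1) 0 hM h h0 (fun x _ hx => h0 x hx) hc (fun _ => 1)
  have h1 := (abs_nonneg _).trans this
  simp [dotProduct] at h1

def TN (G : SimpleGraph V) (s : V → V → PF ℓ) (h : Polynomial ℝ) : ℝ :=
  (Polynomial.aeval (Am (liftGraph G s)) h).trace - (Polynomial.aeval (Am G) h).trace

lemma new_bounds [Nonempty V] {G : SimpleGraph V} {D : ℝ} (hG : Reg G D) (hD : 0 ≤ D)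
    {s : V → V → PF ℓ} (hs : Anti s) (hl : 0 < ℓ) (h : Polynomial ℝ) (hz : h.eval 0 = 0)
    (h0 : ∀ x, |x| ≤ D+1 → 0 ≤ h.eval x) (h1 : ∀ x, |x| ≤ D+1 → h.eval x ≤ 1) :
    0 ≤ TN G s h ∧ TN G s h ≤ Fintype.card V * ℓ := by
  unfold TN
  have : Nonempty (Fin ℓ) := ⟨⟨0, hl⟩⟩
  rw [← trace_new G hs hl h hz]
  set A := Am (liftGraph G s) with hA
  set P := Pm V ℓ with hP
  have hPP : P * P = P := PP hl
  have hAP : A * P = P * A := AP G hs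
  have hPs : Pᵀ = P := Pm_symm
  have hAs : Aᵀ = A := Am_symm _
  set B := A * (1 - P) with hB
  have hBs : Bᵀ = B := by
    rw [hB, Matrix.transpose_mul, Matrix.transpose_sub, Matrix.transpose_one, hPs, hAs,
      Matrix.sub_mul, Matrix.mul_sub, hAP]; simp
  have hnorm : ∀ f : V × Fin ℓ → ℝ, f ⬝ᵥ f = (P *ᵥ f) ⬝ᵥ (P *ᵥ f) + (f - P *ᵥ f) ⬝ᵥ (f - P *ᵥ f) := by
    intro f
    have : f ⬝ᵥ (P *ᵥ f) = (P *ᵥ f) ⬝ᵥ (P *ᵥ f) := by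
      rw [← dot_symm hPs, mulVec_mulVec, hPP]
    simp only [sub_dotProduct, dotProduct_sub]
    rw [this, dotProduct_comm (P *ᵥ f) f, this]; ring
  have hBf : ∀ f : V × Fin ℓ → ℝ, f ⬝ᵥ (B *ᵥ f) = (f - P *ᵥ f) ⬝ᵥ (A *ᵥ (f - P *ᵥ f)) := by
    intro f
    have e1 : B *ᵥ f = A *ᵥ (f - P *ᵥ f) := by
      rw [hB, ← mulVec_mulVec, Matrix.sub_mulVec, one_mulVec]
    rw [e1, sub_dotProduct]
    have e2 : (P *ᵥ f) ⬝ᵥ (A *ᵥ (f - P *ᵥ f)) = 0 := by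
      rw [← dot_symm hPs, mulVec_mulVec, ← hAP, ← mulVec_mulVec, Matrix.mulVec_sub P, mulVec_mulVec, hPP]
      simp
    rw [e2, sub_zero]
  have hM : ∀ f : V × Fin ℓ → ℝ, |f ⬝ᵥ (B *ᵥ f)| ≤ (D+1) * (f ⬝ᵥ f) := by
    intro f
    rw [hBf, hnorm f]
    refine (Am_bound (Reg_lift hG hs) _).trans ?_
    have : 0 ≤ (P *ᵥ f) ⬝ᵥ (P *ᵥ f) := sum_nonneg fun i _ => mul_self_nonneg _
    nlinarith
  have hBh : B.IsHermitian := by rw [Matrix.IsHermitian, conjTranspose_eq_transpose_of_trivial, hBs]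
  refine ⟨tr_nonneg B hBh _ hM h h0, ?_⟩
  have := tr_nonneg B hBh _ hM (1 - h) (fun x hx => by simpa using h1 x hx)
  rw [map_sub, map_one, Matrix.trace_sub, Matrix.trace_one, Fintype.card_prod, Fintype.card_fin] at this
  grind

open Polynomial
def zc (D : ℝ) (n : ℕ) (a : ℕ → ℝ) : ℝ :=
  2 * a 0 - (D-1) * ∑ k ∈ range n, if Even (k+1) then a (k+1) else 0

lemma trace_exp [DecidableEq V] {G : SimpleGraph V} {D : ℝ} (hG : Reg G D) {n : ℕ} {h : ℝ[X]} {a : ℕ → ℝ}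
    (ha : h = ∑ k ∈ range (n+1), C (a k) * rp D k) :
    (Polynomial.aeval (Am G) h).trace = ∑ k ∈ range n, a (k+1) * CN G (k+1)
      + zc D n a * Fintype.card V := by
  rw [ha, map_sum, Matrix.trace_sum, sum_range_succ']
  have h1 : ∀ k, (Polynomial.aeval (Am G) (C (a k) * rp D k)).trace = a k * (Polynomial.aeval (Am G) (rp D k)).trace := by
    intro k
    rw [← Polynomial.smul_eq_C_mul, map_smul, Matrix.trace_smul, smul_eq_mul]
  simp only [h1, trace_rp hG]
  have h2 : (Polynomial.aeval (Am G) (rp D 0)).trace = 2 * Fintype.card V := by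
    have : rp D 0 = C 2 := by simp only [rp]; rfl
    rw [this, Polynomial.aeval_C, Algebra.algebraMap_eq_smul_one, Matrix.trace_smul, Matrix.trace_one, smul_eq_mul]
  rw [h2, zc]
  simp only [mul_sub, sum_sub_distrib]
  have h3 : ∑ k ∈ range n, a (k+1) * (if Even (k+1) then (D-1) * (Fintype.card V : ℝ) else 0) =
      (D-1) * (∑ k ∈ range n, if Even (k+1) then a (k+1) else 0) * Fintype.card V := by
    rw [mul_sum, sum_mul]
    apply sum_congr rfl; intro k _
    grind
  rw [h3]; ring

lemma TN_exp {G : SimpleGraph V} {D : ℝ} (hG : Reg G D) {s : V → V → PF ℓ} (hs : Anti s)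
    {n : ℕ} {h : ℝ[X]} {a : ℕ → ℝ} (ha : h = ∑ k ∈ range (n+1), C (a k) * rp D k) :
    TN G s h = ∑ k ∈ range n, a (k+1) * (CN (liftGraph G s) (k+1) - CN G (k+1))
      + zc D n a * (Fintype.card V * (ℓ - 1)) := by
  rw [TN, trace_exp (Reg_lift hG hs) ha, trace_exp hG ha, Fintype.card_prod, Fintype.card_fin]
  simp only [mul_sub, sum_sub_distrib]
  grind

lemma zc_bound {D η : ℝ} (hD : 1 ≤ D) {n : ℕ} {a : ℕ → ℝ} (ha : ∀ k ≤ n, |a k| * (√D)^k ≤ η) :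
    |zc D n a| ≤ (2 + D * n) * η := by
  have hs : 1 ≤ √D := Real.one_le_sqrt.2 hD
  have ha' : ∀ k ≤ n, |a k| ≤ η := fun k hk => le_trans
    (le_mul_of_one_le_right (abs_nonneg _) (one_le_pow₀ hs)) (ha k hk)
  have hη : 0 ≤ η := (abs_nonneg _).trans (ha' 0 (Nat.zero_le _))
  have h1 : |∑ k ∈ range n, if Even (k+1) then a (k+1) else 0| ≤ n * η := by
    refine (abs_sum_le_sum_abs _ _).trans ?_
    refine (sum_le_card_nsmul _ _ η ?_).trans (by simp)
    intro k hk
    have := mem_range.1 hk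
    split_ifs
    · grind
    · grind
  rw [zc]
  refine (abs_sub _ _).trans ?_
  rw [abs_mul, abs_mul, abs_of_nonneg (by linarith : 0 ≤ D - 1), abs_two]
  have h2 := ha' 0 (Nat.zero_le _)
  have h3 : (D-1) * |∑ k ∈ range n, if Even (k+1) then a (k+1) else 0| ≤ (D-1) * (n * η) :=
    mul_le_mul_of_nonneg_left h1 (by linarith)
  grind
end

section
open Polynomial
variable {U : Type*} [Fintype U] [LinearOrder U]

def gg (U : Type*) [Fintype U] (n : ℕ) : ℝ[X] := ∏ _e : U × U, Gp 0 n

lemma gg_deg (n : ℕ) : (gg U n).natDegree ≤ (Fintype.card U)^2 * n := by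
  unfold gg
  refine (Polynomial.natDegree_prod_le _ _).trans ?_
  refine (sum_le_card_nsmul _ _ n (fun e _ => (Gp_deg 0 n).trans (by omega))).trans ?_
  rw [card_univ, Fintype.card_prod, smul_eq_mul, sq]

lemma gg_zero (n : ℕ) : (gg U n).eval 0 = 1 := by
  unfold gg; rw [Polynomial.eval_prod]; simp [Gp_zero]

lemma gg_01 (n : ℕ) {x : ℝ} (h0 : 0 ≤ x) (h1 : x ≤ 1/((n:ℝ)+1)) : 0 ≤ (gg U n).eval x ∧ (gg U n).eval x ≤ 1 := by
  have h2 : 0 ≤ (Gp 0 n).eval x ∧ (Gp 0 n).eval x ≤ 1 := by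
    unfold Gp; rw [Polynomial.eval_prod]
    have : ∀ j ∈ Ico 0 n, 0 ≤ (1 - C (j:ℝ) * X).eval x ∧ (1 - C (j:ℝ) * X).eval x ≤ 1 := by
      intro j hj
      simp only [eval_sub, eval_one, eval_mul, eval_C, eval_X]
      have hj' : (j:ℝ) ≤ n := by exact_mod_cast (mem_Ico.1 hj).2.le
      rw [le_div_iff₀ (by positivity)] at h1
      have : (0:ℝ) ≤ j := by positivity
      constructor <;> nlinarith
    exact ⟨prod_nonneg fun j hj => (this j hj).1, prod_le_one (fun j hj => (this j hj).1) fun j hj => (this j hj).2⟩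
  unfold gg; rw [Polynomial.eval_prod]
  exact ⟨prod_nonneg fun _ _ => h2.1, prod_le_one (fun _ _ => h2.1) fun _ _ => h2.2⟩

lemma gg_der (n : ℕ) {x : ℝ} (h0 : 0 ≤ x) (h1 : x ≤ 1/((n:ℝ)+1)) :
    |(gg U n).derivative.eval x| ≤ 4 * (n+1) * ((Fintype.card U)^2 * n + 1)^3 := by
  have := markov_c (p := gg U n) (gg_deg n) (c := 1/((n:ℝ)+1)) (M := 1) (by positivity)
    (fun y a b => by rw [abs_of_nonneg (gg_01 n a b).1]; exact (gg_01 n a b).2) h0 h1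
  refine this.trans (le_of_eq ?_)
  push_cast
  field_simp

lemma gg_half {n N : ℕ} (hN : 8 * ((n:ℝ)+1) * ((Fintype.card U)^2 * n + 1)^3 ≤ N) :
    1/2 ≤ (gg U n).eval (1/(N:ℝ)) := by
  have hp : (1:ℝ) ≤ ((Fintype.card U)^2 * n + 1)^3 := one_le_pow₀ (by
    have : (0:ℝ) ≤ (Fintype.card U)^2 * n := by positivity
    linarith)
  have hn : (n:ℝ)+1 ≤ N := by nlinarith
  have hN0 : (0:ℝ) < N := by linarith [(Nat.cast_nonneg n : (0:ℝ) ≤ n)]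
  have := mvt_poly (gg U n) (fun x a b => gg_der n a b) (x := 0) (y := 1/(N:ℝ)) le_rfl (by positivity) (by positivity)
    (one_div_le_one_div_of_le (by positivity) hn)
  rw [gg_zero, zero_sub, abs_neg, abs_of_pos (a := 1/(N:ℝ)) (by positivity), mul_one_div] at this
  have h2 : 4 * ((n:ℝ)+1) * ((Fintype.card U)^2 * n + 1)^3 / N ≤ 1/2 := by
    rw [div_le_iff₀ hN0]; linarith
  have := (le_abs_self _).trans (this.trans h2)
  linarith

variable (U) in
def RR (D : ℝ) (n : ℕ) (a : ℕ → ℝ) : ℝ[X] :=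
  ∑ k ∈ range n, C (a (k+1)) * (Pk U (k+1) n - X * gg U n * C (CN (KK U) (k+1)))
    + C (zc D n a * Fintype.card U) * ((1 - X) * gg U n)

def mm (u n : ℕ) : ℕ := 2*n+1+u^2*n

lemma RR_deg (D : ℝ) (n : ℕ) (a : ℕ → ℝ) : (RR U D n a).natDegree ≤ mm (Fintype.card U) n := by
  unfold RR mm
  have hg := gg_deg (U := U) n
  refine Polynomial.natDegree_add_le_of_degree_le ?_ ?_
  · apply Polynomial.natDegree_sum_le_of_forall_le
    intro k hk
    have := mem_range.1 hk
    refine (Polynomial.natDegree_C_mul_le _ _).trans ?_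
    refine (Polynomial.natDegree_sub_le _ _).trans (max_le ?_ ?_)
    · refine (Pk_deg _ _).trans ?_; omega
    · refine (Polynomial.natDegree_mul_C_le _ _).trans ?_
      refine Polynomial.natDegree_mul_le.trans ?_
      rw [Polynomial.natDegree_X]; omega
  · refine (Polynomial.natDegree_C_mul_le _ _).trans ?_
    refine Polynomial.natDegree_mul_le.trans ?_
    have : (1 - X : ℝ[X]).natDegree ≤ 1 := by
      refine (Polynomial.natDegree_sub_le _ _).trans (by simp)
    omega

lemma RR_zero (D : ℝ) (n : ℕ) (a : ℕ → ℝ) : (RR U D n a).eval 0 = zc D n a * Fintype.card U := by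
  unfold RR
  rw [eval_add, eval_finsetSum, sum_eq_zero]
  · simp [gg_zero]
  · intro k _; simp [Pk_zero]

lemma RR_der (D : ℝ) (n : ℕ) (a : ℕ → ℝ) : (RR U D n a).derivative.eval 0 =
    ∑ k ∈ range n, a (k+1) * (Mk U (k+1) - CN (KK U) (k+1))
     + zc D n a * Fintype.card U * ((gg U n).derivative.eval 0 - 1) := by
  unfold RR
  rw [derivative_add, derivative_sum, eval_add, eval_finsetSum]
  congr 1
  · apply sum_congr rfl; intro k _
    rw [derivative_C_mul, derivative_sub, derivative_mul, derivative_mul]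
    simp [Pk_der, gg_zero]
  · rw [derivative_C_mul, derivative_mul]
    simp [gg_zero]; left; ring

lemma EE_TN {D : ℝ} (hG : Reg (KK U) D) {n N : ℕ} {h : ℝ[X]} {a : ℕ → ℝ}
    (ha : h = ∑ k ∈ range (n+1), C (a k) * rp D k) (hN : n < N) :
    N * (RR U D n a).eval (1/(N:ℝ)) = (gg U n).eval (1/(N:ℝ)) *
      EE (fun t : U × U → PF N => TN (KK U) (sT t) h) := by
  have hN0 : (N:ℝ) ≠ 0 := by have : 0 < N := by omega
                             positivity
  have hg : (gg U n).eval (1/(N:ℝ)) = ∏ _e : U × U, (Gp 0 n).eval (1 / (N:ℝ)) := by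
    unfold gg; rw [Polynomial.eval_prod]
  have h1 : EE (fun t : U × U → PF N => TN (KK U) (sT t) h) =
      ∑ k ∈ range n, a (k+1) * (EE (fun t : U × U → PF N =>
        CN (liftGraph (KK U) (sT t)) (k+1)) - CN (KK U) (k+1))
      + zc D n a * (Fintype.card U * (N - 1)) := by
    have e : (fun t : U × U → PF N => TN (KK U) (sT t) h) = fun t =>
        (∑ k ∈ range n, a (k+1) * (CN (liftGraph (KK U) (sT t)) (k+1) + (- CN (KK U) (k+1))))
         + zc D n a * (Fintype.card U * (N - 1)) := by
      funext t; rw [TN_exp hG (sT_anti t) ha]; simp only [sub_eq_add_neg]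
    rw [e, EE_add, EE_sum, EE_const]
    congr 1
    apply sum_congr rfl; intro k _
    rw [EE_const_mul, EE_add, EE_const, sub_eq_add_neg]
  rw [h1, RR, eval_add, eval_finsetSum, mul_add, mul_add, mul_sum, mul_sum]
  congr 1
  · apply sum_congr rfl; intro k hk
    have := Pk_eval (U := U) (k := k+1) (q := n) (N := N) (by omega) (by have := mem_range.1 hk; omega) hN
    simp only [eval_mul, eval_sub, eval_C, eval_X]
    rw [← hg] at this
    have e : (N:ℝ) * (1/N) = 1 := by field_simp
    linear_combination (a (k+1)) * this - a (k+1) * eval (1/(N:ℝ)) (gg U n) * CN (KK U) (k+1) * e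
  · simp only [eval_mul, eval_sub, eval_C, eval_X, eval_one]
    field_simp
end

section
open Polynomial
variable {U : Type*} [Fintype U] [LinearOrder U]

lemma F_bound [Nonempty U] {D : ℝ} (hG : Reg (KK U) D) (hD : 1 ≤ D) {n : ℕ} {h : ℝ[X]}
    (hn : h.natDegree ≤ n) (hz : h.eval 0 = 0)
    (h0 : ∀ x, |x| ≤ D+1 → 0 ≤ h.eval x) (h1 : ∀ x, |x| ≤ D+1 → h.eval x ≤ 1) {η : ℝ}
    (hη : ∀ x, |x| ≤ 2*√D → |h.eval x| ≤ η) {N : ℕ} (hN : 8 * (mm (Fintype.card U) n + 1)^4 ≤ N) :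
    EE (fun t : U × U → PF N => TN (KK U) (sT t) h) ≤
      5000 * Fintype.card U * (D+2) * ((mm (Fintype.card U) n : ℝ) + 1)^14 * (N * η + 1 / N) := by
  have hη0 : 0 ≤ η := (abs_nonneg _).trans (hη 0 (by simp))
  obtain ⟨a, ha, hab⟩ := rp_exp (by linarith) hn hη
  set u := Fintype.card U with hu
  set m := mm u n with hm
  have hu0 : (0:ℝ) ≤ u := by positivity
  have hmn : n ≤ m := by rw [hm, mm]; nlinarith [sq_nonneg u]
  have hmn2 : u^2*n+1 ≤ m + 1 := by rw [hm, mm]; omega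
  have hmnR : (n:ℝ) ≤ m := by exact_mod_cast hmn
  have hmn2R : (u:ℝ)^2*n+1 ≤ m + 1 := by exact_mod_cast hmn2
  have hm0 : (0:ℝ) ≤ m := by positivity
  have hm14 : ((m:ℝ)+1) ≤ (m+1)^14 := le_self_pow₀ (by linarith) (by norm_num)
  set F : ℕ → ℝ := fun N => EE (fun t : U × U → PF N => TN (KK U) (sT t) h) with hF
  have hbd : ∀ N' : ℕ, 8 * (m+1)^4 ≤ N' → n < N' ∧ 0 ≤ (gg U n).eval (1/(N':ℝ)) ∧ (gg U n).eval (1/(N':ℝ)) ≤ 1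
      ∧ 0 ≤ F N' ∧ F N' ≤ u * N' := by
    intro N' hN'
    have h2 : m + 1 ≤ (m+1)^4 := Nat.le_self_pow (by norm_num) _
    have h3 : n < N' := by omega
    have h4 : (n:ℝ)+1 ≤ N' := by exact_mod_cast h3
    have h5 := gg_01 (U := U) n (x := 1/(N':ℝ)) (by positivity) (one_div_le_one_div_of_le (by positivity) h4)
    have h6 := fun t : U × U → Equiv.Perm (Fin N') => new_bounds hG (by linarith) (sT_anti t) (by omega) h hz h0 h1
    refine ⟨h3, h5.1, h5.2, ?_, ?_⟩
    · rw [hF, ← EE_const (U := U) (N := N') 0]; exact EE_mono fun t => (h6 t).1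
    · rw [hF, ← EE_const (U := U) (N := N') (u * N')]; exact EE_mono fun t => (h6 t).2
  obtain ⟨k1, k2, k3, k4, k5⟩ := hbd N hN
  have hNp : (0:ℝ) < N := by have : 0 < N := by omega
                             positivity
  have hNR : 8 * ((m:ℝ)+1)^4 ≤ N := by exact_mod_cast hN
  have hT := disc_taylor (RR_deg (U := U) D n a) (M := u) (N1 := 8 * (m+1)^4) (by
      rw [← hu, ← hm]; push_cast
      have : ((m:ℝ)+1)^3 ≤ (m+1)^4 := pow_le_pow_right₀ (by linarith) (by norm_num)
      linarith) (by
      intro N' hN'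
      obtain ⟨l1, l2, l3, l4, l5⟩ := hbd N' hN'
      have e := EE_TN hG ha l1
      have hNp : (0:ℝ) < N' := by have : 0 < N' := by omega
                                  positivity
      have e2 : (RR U D n a).eval (1/(N':ℝ)) = (gg U n).eval (1/(N':ℝ)) * F N' / N' := by
        rw [eq_div_iff hNp.ne', mul_comm, e]
      rw [e2, abs_of_nonneg (by positivity), div_le_iff₀ hNp]
      nlinarith) hN
  rw [RR_zero, RR_der, ← hu, ← hm] at hT
  have hghalf : 1/2 ≤ (gg U n).eval (1/(N:ℝ)) := gg_half (by
    calc 8 * ((n:ℝ)+1) * ((Fintype.card U)^2 * n + 1)^3 ≤ 8 * ((m:ℝ)+1) * (m+1)^3 := by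
          rw [← hu]; gcongr
      _ = 8 * ((m:ℝ)+1)^4 := by ring
      _ ≤ N := hNR)
  have e := EE_TN hG ha k1
  have hFle : F N ≤ 2 * (N * |(RR U D n a).eval (1/(N:ℝ))|) := by
    have e3 : N * (RR U D n a).eval (1/(N:ℝ)) ≤ N * |(RR U D n a).eval (1/(N:ℝ))| := by
      gcongr; exact le_abs_self _
    rw [e] at e3
    change _ * F N ≤ _ at e3
    nlinarith
  have hzb := zc_bound hD hab
  set z := zc D n a with hzdef
  have hs1 : 1 ≤ √D := Real.one_le_sqrt.2 hD
  have hsum : |∑ k ∈ range n, a (k+1) * (Mk U (k+1) - CN (KK U) (k+1))| ≤ 2 * n^2 * u * η := by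
    refine (abs_sum_le_sum_abs _ _).trans ?_
    refine (sum_le_card_nsmul _ _ (2 * n * u * η) ?_).trans (by
      rw [card_range, nsmul_eq_mul]; grind)
    intro k hk
    have hk' : k + 1 ≤ n := by have := mem_range.1 hk; omega
    have hkR : ((k+1:ℕ):ℝ) ≤ n := by exact_mod_cast hk'
    have l1 := Mk_lower (U := U) (k := k+1) (by omega)
    have l2 := Mk_upper hD hG (k := k+1) (by omega)
    have l3 := hab (k+1) hk'
    rw [abs_mul, abs_of_nonneg (a := Mk U (k+1) - _) (by linarith)]
    rw [← hu] at l2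
    calc |a (k+1)| * (Mk U (k+1) - CN (KK U) (k+1)) ≤ |a (k+1)| * (((k+1:ℕ):ℝ) * (2 * u * (√D)^(k+1))) := by
          gcongr; linarith
      _ = ((k+1:ℕ):ℝ) * 2 * u * (|a (k+1)| * (√D)^(k+1)) := by ring
      _ ≤ n * 2 * u * η := by gcongr
      _ = _ := by ring
  have hgd := gg_der (U := U) n (x := 0) le_rfl (by positivity)
  have hgd2 : |(gg U n).derivative.eval 0 - 1| ≤ N := by
    refine (abs_sub _ _).trans ?_
    have : 4 * ((n:ℝ)+1) * ((Fintype.card U)^2 * n + 1)^3 ≤ 4 * ((m:ℝ)+1)^4 := by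
      calc _ ≤ 4 * ((m:ℝ)+1) * (m+1)^3 := by rw [← hu]; gcongr
        _ = _ := by ring
    have h4 : (1:ℝ) ≤ (m+1)^4 := one_le_pow₀ (by linarith)
    rw [abs_one]; linarith
  have hz2 : |z| ≤ (2+D) * (m+1) * η := by
    refine hzb.trans ?_
    gcongr
    nlinarith
  have hder : |∑ k ∈ range n, a (k+1) * (Mk U (k+1) - CN (KK U) (k+1)) +
      z * u * ((gg U n).derivative.eval 0 - 1)| ≤ 2 * N * u * η + |z| * u * N := by
    refine (abs_add_le _ _).trans (add_le_add (hsum.trans ?_) ?_)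
    · gcongr
      have : (m:ℝ)+1 ≤ (m+1)^2 := le_self_pow₀ (by linarith) (by norm_num)
      have h5 : (n:ℝ)^2 ≤ (m+1)^2 := by gcongr; linarith
      have h6 : ((m:ℝ)+1)^2 ≤ (m+1)^4 := pow_le_pow_right₀ (by linarith) (by norm_num)
      grind
    · rw [abs_mul, abs_mul, abs_of_nonneg hu0]; gcongr
  have hfin : F N ≤ 2 * (N * (|z| * u)) + 2 * (2 * N * u * η + |z| * u * N) + 4096 * (m+1)^14 * u / N := by
    have h8 := mul_le_mul_of_nonneg_left hT hNp.le
    rw [abs_mul, abs_of_nonneg hu0] at h8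
    have h9 : (N:ℝ) * (|z| * u + |∑ k ∈ range n, a (k+1) * (Mk U (k+1) - CN (KK U) (k+1)) +
      z * u * ((gg U n).derivative.eval 0 - 1)| / N + 32 * ((8 * (m+1)^4 : ℕ):ℝ)^2 * (m+1)^6 * u / (N:ℝ)^2) =
      N * (|z| * u) + |∑ k ∈ range n, a (k+1) * (Mk U (k+1) - CN (KK U) (k+1)) +
      z * u * ((gg U n).derivative.eval 0 - 1)| + 2048 * (m+1)^14 * u / N := by
      push_cast; field_simp; ring
    rw [h9] at h8
    have h10 : 4096 * ((m:ℝ)+1)^14 * u / N = 2 * (2048 * (m+1)^14 * u / N) := by ring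
    rw [h10]
    linarith
  refine hfin.trans ?_
  have hA : 0 ≤ (u:ℝ) * N * η := by positivity
  have hB : |z| * (u * N) ≤ (2+D)*(m+1)^14*η * (u*N) := by
    refine mul_le_mul_of_nonneg_right (hz2.trans ?_) (by positivity)
    gcongr
  have hC : (1:ℝ) ≤ (2+D)*(m+1)^14 :=
    one_le_mul_of_one_le_of_one_le (by linarith) (by linarith)
  have hC' : (u:ℝ) * N * η ≤ (2+D)*(m+1)^14 * (u * N * η) := le_mul_of_one_le_left hA hC
  have hE : 4096 * ((m:ℝ)+1)^14 * u / N ≤ 5000 * u * (D+2) * (m+1)^14 * (1/N) := by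
    rw [mul_one_div]
    apply div_le_div_of_nonneg_right _ hNp.le
    have e0 : 5000 * (u:ℝ) * (D+2) * (m+1)^14 = (5000 * (D+2)) * ((m+1)^14 * u) := by ring
    rw [e0, mul_assoc]
    apply mul_le_mul_of_nonneg_right _ (by positivity)
    linarith
  grind
end

section
open Polynomial

lemma exists_B {ρ b d : ℝ} (hρ : 0 ≤ ρ) (hb : ρ < b) : ∃ B : ℝ[X], B.eval 0 = 0 ∧
    (∀ x, |x| ≤ d → 0 ≤ B.eval x ∧ B.eval x ≤ 1) ∧ (∀ x, |x| ≤ d → |x| ≤ ρ → B.eval x ≤ (1/16)^10) ∧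
    (∀ x, |x| ≤ d → b < |x| → 1/16 ≤ B.eval x) := by
  by_cases hd : 0 ≤ d
  swap
  · exact ⟨0, by simp, fun x hx => absurd ((abs_nonneg x).trans hx) hd, fun x hx => absurd ((abs_nonneg x).trans hx) hd,
      fun x hx => absurd ((abs_nonneg x).trans hx) hd⟩
  set f : ℝ → ℝ := fun x => min (1/2) (max 0 ((|x| - ρ) / (b - ρ))) with hf
  have hfc : ContinuousOn f (Set.Icc (-d) d) := by
    apply Continuous.continuousOn; rw [hf]; fun_prop
  obtain ⟨p, hp⟩ := exists_polynomial_near_of_continuousOn (-d) d f hfc ((1/2)^21) (by positivity)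
  have hbρ : 0 < b - ρ := by linarith
  have hf0 : ∀ x, |x| ≤ ρ → f x = 0 := by
    intro x hx
    have : (|x| - ρ) / (b - ρ) ≤ 0 := div_nonpos_of_nonpos_of_nonneg (by linarith) hbρ.le
    simp only [hf]; rw [max_eq_left this]; norm_num
  have hf1 : ∀ x, b < |x| → f x = 1/2 := by
    intro x hx
    have : 1 ≤ (|x| - ρ) / (b - ρ) := by rw [le_div_iff₀ hbρ]; linarith
    simp only [hf]; rw [max_eq_right (by linarith), min_eq_left (by linarith)]
  have hf2 : ∀ x, 0 ≤ f x ∧ f x ≤ 1/2 := fun x =>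
    ⟨le_min (by norm_num) (le_max_left _ _), min_le_left _ _⟩
  have key : ∀ x, |x| ≤ d → |(p - C (p.eval 0)).eval x - f x| ≤ (1/2)^20 := by
    intro x hx
    have h1 := hp x (abs_le.1 hx)
    have h2 := hp 0 ⟨by linarith, hd⟩
    rw [hf0 0 (by grind), sub_zero] at h2
    rw [eval_sub, eval_C]
    rw [abs_lt] at h1 h2
    rw [abs_le]
    norm_num at *
    grind
  refine ⟨(p - C (p.eval 0))^2, by simp, ?_, ?_, ?_⟩
  · intro x hx
    have h1 := abs_le.1 (key x hx)
    have h2 := hf2 x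
    rw [eval_pow]
    generalize (p - C (p.eval 0)).eval x = y at *
    refine ⟨sq_nonneg _, ?_⟩
    norm_num at h1
    nlinarith
  · intro x hx hxρ
    have h1 := key x hx
    rw [hf0 x hxρ, sub_zero] at h1
    rw [eval_pow, ← sq_abs]
    calc _ ≤ ((1/2:ℝ)^20)^2 := by gcongr
      _ = _ := by norm_num
  · intro x hx hxb
    have h1 := abs_le.1 (key x hx)
    rw [hf1 x hxb] at h1
    rw [eval_pow]
    generalize (p - C (p.eval 0)).eval x = y at *
    norm_num at h1
    nlinarith

lemma growth (A : ℝ) : ∃ r0 : ℕ, ∀ r : ℕ, r0 ≤ r → A * ((r:ℝ)+1)^14 < 16^r := by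
  have h := tendsto_pow_const_div_const_pow_of_one_lt 14 (r := (16:ℝ)) (by norm_num)
  have h2 := (h.const_mul (16 * A)).eventually_lt_const (u := 1) (by simp)
  obtain ⟨r0, hr⟩ := Filter.eventually_atTop.1 h2
  refine ⟨r0, fun r hr' => ?_⟩
  have := hr (r+1) (by omega)
  push_cast at this
  rw [mul_div_assoc', div_lt_one (by positivity), pow_succ (16:ℝ) r] at this
  linarith

variable {U : Type*} [Fintype U] [LinearOrder U]

lemma snd_top {b : ℝ} (hb : 1 ≤ b) : SndEigLE (Am (KK U)) b := by
  intro f hf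
  have h1 : dotProduct f ((Am (KK U)).mulVec f) = - ∑ v, (f v)^2 := by
    have : ∀ u, (Am (KK U)).mulVec f u = - f u := by
      intro u
      simp only [Matrix.mulVec, dotProduct, Am, SimpleGraph.top_adj]
      have e : ∀ v, ind (u ≠ v) * f v = f v - ind (v = u) * f v := by
        intro v; unfold ind; grind
      simp only [e, sum_sub_distrib, hf]
      rw [sum_ind_mul u f]; ring
    simp only [dotProduct, this, ← sum_neg_distrib]
    apply sum_congr rfl; intros; ring
  rw [h1, abs_neg, abs_of_nonneg (sum_nonneg fun _ _ => sq_nonneg _)]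
  exact le_mul_of_one_le_left (sum_nonneg fun _ _ => sq_nonneg _) hb

lemma EE_exists {N : ℕ} {F : (U × U → PF N) → ℝ} {c : ℝ} (h : EE F < c) : ∃ t, F t < c := by
  by_contra hc
  push Not at hc
  have := EE_mono (F := fun _ => c) (F' := F) hc
  rw [EE_const] at this
  linarith

lemma arith1 {C0 M N : ℝ} {r : ℕ} (hC : 1 ≤ C0) (hM : 0 ≤ M) (hX : 514 * C0 * M < 16^r)
    (hN1 : (256:ℝ)^r ≤ N) (hN2 : N ≤ 256 * 256^r) :
    C0 * M * (N * ((1/16:ℝ)^10)^r + 1/N) < (1/16)^r / 2 := by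
  have eη : ((1/16:ℝ)^10)^r = ((1/16)^r)^10 := by rw [← pow_mul, ← pow_mul, mul_comm]
  have e16 : (16:ℝ)^r * (1/16)^r = 1 := by rw [← mul_pow]; norm_num
  have e256 : (256:ℝ)^r = 16^r * 16^r := by rw [← mul_pow]; norm_num
  have hc1 : (1/16:ℝ)^r ≤ 1 := pow_le_one₀ (by norm_num) (by norm_num)
  have hcpos : 0 < (1/16:ℝ)^r := by positivity
  have hN0 : 0 < N := lt_of_lt_of_le (by positivity) hN1
  rw [eη]
  rw [e256] at hN1 hN2
  have hP : 0 ≤ C0 * M := by positivity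
  generalize (1/16:ℝ)^r = c at *
  generalize (16:ℝ)^r = P at *
  have h2 : 1/N ≤ c^2 := by
    rw [div_le_iff₀ hN0]
    calc (1:ℝ) = c^2 * (P*P) := by grind
      _ ≤ c^2 * N := mul_le_mul_of_nonneg_left hN1 (by positivity)
  have h3 : N * c^10 ≤ 256 * c^2 := by
    calc N * c^10 ≤ 256 * (P*P) * c^10 := mul_le_mul_of_nonneg_right hN2 (by positivity)
      _ = 256 * c^8 := by grind
      _ ≤ 256 * c^2 := by linarith [pow_le_pow_of_le_one hcpos.le hc1 (show 2 ≤ 8 by norm_num)]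
  have h4 : C0 * M * (N * c^10 + 1/N) ≤ C0 * M * (257 * c^2) := mul_le_mul_of_nonneg_left (by linarith) hP
  have h5 : (514 * C0 * M) * c^2 < P * c^2 := mul_lt_mul_of_pos_right hX (by positivity)
  have h6 : P * c^2 = c := by linear_combination c * e16
  linarith

set_option maxHeartbeats 1000000 in
theorem stage1 [Nonempty U] {D : ℝ} (hG : Reg (KK U) D) (hD : 1 ≤ D) {b : ℝ} (hb : 2*√D < b) :
    ∃ N0 : ℕ, ∀ N : ℕ, N0 ≤ N → ∀ L : ℕ, 2*(L+1) ≤ N →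
      8 * (Fintype.card U:ℝ) * (L+1)^3 * (3*(Fintype.card U:ℝ)+1)^L < N →
      ∃ t : U × U → PF N, TF (liftGraph (KK U) (sT t)) L ∧
        SndEigLE (Am (liftGraph (KK U) (sT t))) b := by
  obtain ⟨B, hB0, hB1, hB2, hB3⟩ := exists_B (d := D+1) (by positivity) hb
  set u := Fintype.card U with hu
  have hu1 : (1:ℝ) ≤ u := by exact_mod_cast Fintype.card_pos
  set e := B.natDegree
  set C1 : ℕ := (u^2+2)*e+2 with hC1
  set C0 : ℝ := 5000 * u * (D+2) with hC0
  have hC01 : 1 ≤ C0 := by rw [hC0]; nlinarith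
  obtain ⟨r0, hr0⟩ := growth (514 * C0 * C1^14)
  refine ⟨256^r0, fun N hN L hL1 hL2 => ?_⟩
  have hNne : N ≠ 0 := by have : 0 < 256^r0 := by positivity
                          omega
  set r := Nat.log 256 N with hr
  have hrr : r0 ≤ r := Nat.le_log_of_pow_le (by norm_num) hN
  have hN1 : 256^r ≤ N := Nat.pow_log_le_self 256 hNne
  have hN2 : N < 256^(r+1) := Nat.lt_pow_succ_log_self (by norm_num) N
  have hg := hr0 r hrr
  have hN1R : (256:ℝ)^r ≤ N := by exact_mod_cast hN1
  have hN2R : (N:ℝ) ≤ 256 * 256^r := by rw [← pow_succ']; exact_mod_cast hN2.le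
  set h := B^r with hh
  have hdeg : h.natDegree ≤ r * e := Polynomial.natDegree_pow_le
  set m := mm u (r*e) with hm
  have hmC : m + 1 ≤ C1 * (r+1) := by
    rw [hm, mm, hC1]; ring_nf; nlinarith [Nat.zero_le e, Nat.zero_le (e*u^2), Nat.zero_le r]
  have hmR : (m:ℝ)+1 ≤ C1 * ((r:ℝ)+1) := by exact_mod_cast hmC
  have hm14 : ((m:ℝ)+1)^14 ≤ C1^14 * ((r:ℝ)+1)^14 := by
    rw [← mul_pow]; gcongr
  have hm1 : (1:ℝ) ≤ m+1 := by linarith [(Nat.cast_nonneg m : (0:ℝ) ≤ m)]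
  have hm1' : (1:ℝ) ≤ (m+1)^14 := one_le_pow₀ hm1
  have hX : 514 * C0 * ((m:ℝ)+1)^14 < 16^r := by
    refine lt_of_le_of_lt ?_ hg
    rw [mul_assoc (514*C0)]; gcongr
  have hNbig : 8 * (m + 1)^4 ≤ N := by
    have h1 : 8 * ((m:ℝ)+1)^4 ≤ N := by
      calc 8 * ((m:ℝ)+1)^4 ≤ 514 * C0 * ((m:ℝ)+1)^14 := by
            have : ((m:ℝ)+1)^4 ≤ (m+1)^14 := pow_le_pow_right₀ hm1 (by norm_num)
            nlinarith
        _ ≤ 16^r := hX.le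
        _ ≤ 256^r := by gcongr; norm_num
        _ ≤ N := hN1R
    exact_mod_cast h1
  have hrpos : r ≠ 0 := by
    intro h0; rw [h0] at hX; norm_num at hX; nlinarith
  have hz : h.eval 0 = 0 := by rw [hh, eval_pow, hB0, zero_pow hrpos]
  have h0 : ∀ x, |x| ≤ D+1 → 0 ≤ h.eval x := fun x hx => by
    simp_all
  have h1 : ∀ x, |x| ≤ D+1 → h.eval x ≤ 1 := fun x hx => by
    rw [hh, eval_pow]; exact pow_le_one₀ (hB1 x hx).1 (hB1 x hx).2
  have hsD : 2*√D ≤ D+1 := by nlinarith [sq_nonneg (√D-1), Real.sq_sqrt (by linarith : 0 ≤ D)]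
  have hF := F_bound hG hD hdeg hz h0 h1 (η := ((1/16:ℝ)^10)^r) (by
    intro x hx
    rw [abs_of_nonneg (h0 x (hx.trans hsD)), hh, eval_pow]
    exact pow_le_pow_left₀ (hB1 x (hx.trans hsD)).1 (hB2 x (hx.trans hsD) hx) _) hNbig
  rw [← hu, ← hm, ← hC0] at hF
  set c : ℝ := (1/16)^r with hc
  have hcpos : 0 < c := by positivity
  have hF2 : EE (fun t : U × U → PF N => TN (KK U) (sT t) h) < c/2 := by
    exact lt_of_le_of_lt hF (arith1 hC01 (by positivity) hX hN1R hN2R)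
  have hTF := EE_TF (U := U) (N := N) (L := L) hL1
  have hTF2 : EE (fun t : U × U → PF N => ind (¬ TF (liftGraph (KK U) (sT t)) L)) < 1/2 := by
    refine lt_of_le_of_lt hTF ?_
    rw [div_lt_iff₀ (by positivity)]
    linarith
  have hsum : EE (fun t : U × U → PF N => c⁻¹ * TN (KK U) (sT t) h +
      ind (¬ TF (liftGraph (KK U) (sT t)) L)) < 1 := by
    rw [EE_add, EE_const_mul]
    have : c⁻¹ * EE (fun t : U × U → PF N => TN (KK U) (sT t) h) < c⁻¹ * (c/2) := by gcongr
    have e2 : c⁻¹ * (c/2) = 1/2 := by field_simp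
    linarith
  obtain ⟨t, ht⟩ := EE_exists hsum
  have hNpos : 0 < N := Nat.pos_of_ne_zero hNne
  have hTN := (new_bounds hG (by linarith) (sT_anti t) hNpos h hz h0 h1).1
  have hTN' : 0 ≤ c⁻¹ * TN (KK U) (sT t) h := by positivity
  refine ⟨t, ?_, ?_⟩
  · by_contra hcon
    rw [ind_true hcon] at ht
    linarith
  · have hind : 0 ≤ ind (¬ TF (liftGraph (KK U) (sT t)) L) := by unfold ind; positivity
    have hlt : TN (KK U) (sT t) h < c := by
      have : c⁻¹ * TN (KK U) (sT t) h < 1 := by linarith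
      rwa [inv_mul_lt_iff₀ hcpos, mul_one] at this
    refine lift_snd hG (by linarith) (sT_anti t) hNpos b c h hz h0 ?_ hlt (snd_top ?_)
    · intro x hx1 hx2
      rw [hh, eval_pow, hc]
      exact pow_le_pow_left₀ (by norm_num) (hB3 x hx2 hx1) _
    · have : 1 ≤ √D := Real.one_le_sqrt.2 hD
      linarith
end

section
variable {V W' : Type*} [Fintype V] [Fintype W']

lemma tr_Reg (e : V ≃ W') {G : SimpleGraph V} {D : ℝ} (h : Reg G D) : Reg (G.comap e.symm) D := by
  intro v
  rw [← h (e.symm v)]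
  exact Equiv.sum_comp e.symm (fun u => ind (G.Adj (e.symm v) u))

lemma tr_exc (e : V ≃ W') (f : ℕ → W') (T : ℕ) : exc (fun i => e.symm (f i)) T = exc f T := by
  induction T with
  | zero => rfl
  | succ T ih =>
    simp only [exc, ih]
    congr 1
    have h1 : (e.symm (f (T+1)) ∈ vs (fun i => e.symm (f i)) T) ↔ f (T+1) ∈ vs f T := by
      simp [mem_vs]
    have h2 : ((e.symm (f T), e.symm (f (T+1))) ∈ ds (fun i => e.symm (f i)) T) ↔ (f T, f (T+1)) ∈ ds f T := by
      simp [ds]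
    grind

lemma tr_TF (e : V ≃ W') {G : SimpleGraph V} {L : ℕ} (h : TF G L) : TF (G.comap e.symm) L := by
  intro T hT f hf
  rw [← tr_exc e]
  exact h T hT _ hf

lemma tr_snd (e : V ≃ W') {G : SimpleGraph V} {b : ℝ} (h : SndEigLE (Am G) b) : SndEigLE (Am (G.comap e.symm)) b := by
  intro f hf
  have := h (fun v => f (e v)) (by rw [← hf]; exact Equiv.sum_comp e f)
  rw [← Equiv.sum_comp e (fun v => f v ^ 2)]
  convert this using 2
  simp only [dotProduct, Matrix.mulVec, Am]
  rw [← Equiv.sum_comp e]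
  apply sum_congr rfl; intro v _
  rw [← Equiv.sum_comp e]
  simp

lemma Reg_top {d : ℕ} : Reg (⊤ : SimpleGraph (Fin (d+1))) ((d:ℝ)-1) := by
  intro v
  simp only [SimpleGraph.top_adj]
  have e : ∀ u, ind (v ≠ u) = 1 - ind (u = v) := by
    intro u; unfold ind; grind
  simp only [e, sum_sub_distrib]
  rw [sum_congr rfl (fun u _ => (mul_one (ind (u = v))).symm), sum_ind_mul v (fun _ => 1)]
  simp

lemma Reg_deg {G : SimpleGraph V} {d : ℕ} (h : Reg G ((d:ℝ)-1)) [G.LocallyFinite] : G.IsRegularOfDegree d := by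
  intro v
  have := h v
  simp only [ind, sum_boole, sub_add_cancel] at this
  rw [← SimpleGraph.card_neighborFinset_eq_degree]
  rw [← Nat.cast_inj (R := ℝ), ← this]
  congr 2
  ext u; simp

lemma Am_adj (G : SimpleGraph V) [DecidableRel G.Adj] : G.adjMatrix ℝ = Am G := by
  ext a b; simp only [SimpleGraph.adjMatrix_apply, Am, ind]; congr

lemma pickQ (u : ℕ) (hu : 1 ≤ u) : ∃ Q : ℕ, 2 ≤ Q ∧ u ≤ Q ∧ ∀ K, 1 ≤ K → 2*(3*K+1) ≤ Q^K ∧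
    8*u*(3*K+1)^3*(3*u+1)^(3*K) < Q^K := by
  have h4 : ∀ K, 3*K+1 ≤ 4^K := by
    intro K; induction K with
    | zero => simp
    | succ K ih => grind
  have h3 : 1 ≤ (3*u+1)^3 := Nat.one_le_pow _ _ (by omega)
  refine ⟨8*u*64*(3*u+1)^3+1, by nlinarith, by nlinarith, fun K hK => ?_⟩
  have h5 : 8*u*(3*K+1)^3*(3*u+1)^(3*K) < (8*u*64*(3*u+1)^3+1)^K := by
    calc 8*u*(3*K+1)^3*(3*u+1)^(3*K) ≤ (8*u)^K*(4^K)^3*(3*u+1)^(3*K) := by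
          gcongr
          · exact Nat.le_self_pow (by omega) _
          · exact h4 K
      _ = (8*u*64*(3*u+1)^3)^K := by
          rw [mul_pow, mul_pow, ← pow_mul, ← pow_mul, mul_comm K 3, pow_mul 4 3 K, mul_pow (8*u) 64 K]; norm_num [mul_pow]
      _ < _ := Nat.pow_lt_pow_left (by omega) (by omega)
  refine ⟨le_trans ?_ h5.le, h5⟩
  have h6 : 3*K+1 ≤ (3*K+1)^3 := Nat.le_self_pow (by norm_num) _
  have h7 : 1 ≤ (3*u+1)^(3*K) := Nat.one_le_pow _ _ (by omega)
  calc 2*(3*K+1) ≤ 8*u*(3*K+1)^3*1 := by nlinarith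
    _ ≤ _ := by gcongr

lemma oddlog {Q N : ℕ} (hQ : 2 ≤ Q) (hN : Q ≤ N) : ∃ K, Odd K ∧ Q^K ≤ N ∧ N < Q^(K+2) := by
  have h1 : 1 ≤ Nat.log Q N := Nat.le_log_of_pow_le (by omega) (by grind)
  refine ⟨2*((Nat.log Q N - 1)/2)+1, ⟨_, rfl⟩, ?_, ?_⟩
  · exact le_trans (Nat.pow_le_pow_right (by omega) (by omega)) (Nat.pow_log_le_self Q (by omega))
  · exact lt_of_lt_of_le (Nat.lt_pow_succ_log_self (by omega) N) (Nat.pow_le_pow_right (by omega) (by omega))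

lemma ev1 {a : ℝ} (ha : 1 < a) (k : ℕ) (A : ℝ) : ∃ K0 : ℕ, ∀ K : ℕ, K0 ≤ K → A * ((K:ℝ)+1)^k < a^K := by
  have h := tendsto_pow_const_div_const_pow_of_one_lt k ha
  have h2 := (h.const_mul (a * A)).eventually_lt_const (u := 1) (by simp)
  obtain ⟨r0, hr⟩ := Filter.eventually_atTop.1 h2
  refine ⟨r0, fun r hr' => ?_⟩
  have := hr (r+1) (by omega)
  have ha0 : 0 < a := by linarith
  push_cast at this
  rw [mul_div_assoc', div_lt_one (by positivity), pow_succ a r] at this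
  nlinarith

lemma big {a : ℝ} (ha : 1 < a) {Q : ℝ} (hQ : 1 ≤ Q) : ∃ K0 : ℕ, ∀ K : ℕ, K0 ≤ K → ∃ m : ℕ, 1 ≤ m ∧
    ∀ E M D r: ℝ, 0 < D → r^2 = a^8 * D → 0 ≤ E → E ≤ Real.exp (a^(K+3)) → 0 ≤ M → M ≤ Q^(K+3) →
    E * (M * (D^(m*K) * (((2*m:ℕ)*K+1) * (20*(K+1)^4))^(2*m))) < r^(2*m*K) := by
  have ha0 : 0 < a := by linarith
  obtain ⟨K1, h1⟩ := ev1 ha 1 (3 * Real.log Q)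
  obtain ⟨K2, h2⟩ := ev1 (one_lt_pow₀ ha (by norm_num : 6 ≠ 0)) 10 (129600 * a^6)
  refine ⟨max K1 K2, fun K hK => ⟨⌈a^(K+3)⌉₊, Nat.one_le_ceil_iff.2 (by positivity), ?_⟩⟩
  intro E M D r hD hr hE0 hE hM0 hM
  have hm1 := Nat.le_ceil (a^(K+3))
  have hm2 := Nat.ceil_lt_add_one (show 0 ≤ a^(K+3) by positivity)
  have hA1 : 1 ≤ a^(K+3) := one_le_pow₀ ha.le
  have hmpos : 1 ≤ ⌈a^(K+3)⌉₊ := Nat.one_le_ceil_iff.2 (by positivity)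
  generalize ⌈a^(K+3)⌉₊ = m at *
  have h1 := h1 K (le_trans (le_max_left _ _) hK)
  have h2 := h2 K (le_trans (le_max_right _ _) hK)
  have hlog : 0 ≤ Real.log Q := Real.log_nonneg hQ
  have e3 : Real.exp m ≤ 3^m := by
    rw [← Real.exp_one_pow]
    gcongr; exact Real.exp_one_lt_three.le
  have hE3 : E ≤ 3^m := hE.trans ((Real.exp_le_exp.2 hm1).trans e3)
  have hM3 : M ≤ 3^m := by
    refine hM.trans (le_trans ?_ e3)
    rw [← Real.exp_log (show 0 < Q by linarith), ← Real.exp_nat_mul, Real.exp_le_exp]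
    have : a^K ≤ a^(K+3) := pow_le_pow_right₀ ha.le (by omega)
    push_cast
    nlinarith [mul_nonneg (Nat.cast_nonneg K : (0:ℝ) ≤ K) hlog]
  have hK0 : (0:ℝ) ≤ K := Nat.cast_nonneg K
  have hX : ((2*m:ℕ):ℝ)*K+1 ≤ 6 * a^(K+3) * (K+1) := by
    push_cast
    have : (m:ℝ) ≤ 2 * a^(K+3) := by linarith
    nlinarith
  have hY : 9 * ((((2*m:ℕ):ℝ)*K+1) * (20*((K:ℝ)+1)^4))^2 < a^(8*K) := by
    calc 9 * ((((2*m:ℕ):ℝ)*K+1) * (20*((K:ℝ)+1)^4))^2 ≤ 9 * ((6 * a^(K+3) * (K+1)) * (20*((K:ℝ)+1)^4))^2 := by gcongr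
      _ = (129600 * a^6 * ((K:ℝ)+1)^10) * a^(2*K) := by ring
      _ < (a^6)^K * a^(2*K) := by gcongr
      _ = _ := by rw [← pow_mul, ← pow_add]; congr 1; ring
  generalize (((2*m:ℕ):ℝ)*K+1) * (20*((K:ℝ)+1)^4) = Z at *
  have hr2 : r^(2*m*K) = (a^(8*K))^m * D^(m*K) := by
    rw [mul_assoc, pow_mul, hr, mul_pow, ← pow_mul, ← pow_mul]; congr 2; ring
  rw [hr2]
  have hZ : (9 * Z^2)^m < (a^(8*K))^m := pow_lt_pow_left₀ hY (by positivity) (by omega)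
  have hZ2 : 0 ≤ Z^(2*m) := by rw [pow_mul]; positivity
  calc E * (M * (D^(m*K) * Z^(2*m))) ≤ 3^m * (3^m * (D^(m*K) * Z^(2*m))) := by gcongr
    _ = (9*Z^2)^m * D^(m*K) := by rw [mul_pow, ← pow_mul, show (9:ℝ) = 3*3 by norm_num, mul_pow]; ring
    _ < _ := by gcongr

theorem main (d : ℕ) (hd : 3 ≤ d) (ε : ℝ) (hε0 : 0 < ε) (hε1 : ε < 1) :
    ∃ δ : ℝ, 0 < δ ∧ ∃ N : ℕ, ∀ n : ℕ, N ≤ n →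
      ∀ ℓ : ℕ, 2 ≤ ℓ → (ℓ : ℝ) ≤ Real.exp ((n : ℝ) ^ δ) →
        ∀ H : Subgroup (PF ℓ),
          (∀ i j : Fin ℓ, ∃ h ∈ H, h i = j) →
          ∃ n' : ℕ, n ≤ n' ∧ n' ≤ 2 * n ∧
            ∃ G₀ : SimpleGraph (Fin n'), Reg G₀ ((d:ℝ)-1) ∧
              ∃ t : Fin n' → Fin n' → H,
                SndEigLE (Am (liftGraph G₀ (sgp H t))) (2 * Real.sqrt ((d : ℝ) - 1) + ε) := by
  have hD : (2:ℝ) ≤ (d:ℝ) - 1 := by have : (3:ℝ) ≤ d := by exact_mod_cast hd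
                                    linarith
  have hT := Reg_top (d := d)
  generalize (d:ℝ) - 1 = D at *
  obtain ⟨N0, hS1⟩ := stage1 hT (by linarith) (show 2*√D < 2*√D + ε by linarith)
  obtain ⟨Q, hQ2, huQ, hQ⟩ := pickQ (d+1) (by omega)
  have hsD : (1.4:ℝ) ≤ √D := Real.le_sqrt_of_sq_le (by grind)
  have hss : √D * √D = D := Real.mul_self_sqrt (by linarith)
  set r := √D + ε/4 with hr
  have hrpos : 0 < r := by linarith
  have hrD : r ≤ D := by nlinarith
  have hrb : r + D / r ≤ 2*√D + ε := by
    have : D / r ≤ √D := by rw [div_le_iff₀ hrpos]; nlinarith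
    linarith
  have hq : 1 < r^2/D := by rw [one_lt_div (by linarith)]; nlinarith
  set a : ℝ := (r^2/D)^((8:ℕ):ℝ)⁻¹ with ha
  have ha8 : a^8 = r^2/D := Real.rpow_inv_natCast_pow (by linarith) (by norm_num)
  have ha1 : 1 < a := Real.one_lt_rpow hq (by norm_num)
  have hQR : (2:ℝ) ≤ Q := by exact_mod_cast hQ2
  have hlQ : 0 < Real.log Q := Real.log_pos (by linarith)
  have hla : 0 < Real.log a := Real.log_pos ha1
  obtain ⟨K0, hK0⟩ := big ha1 (show (1:ℝ) ≤ Q by linarith)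
  refine ⟨Real.log a / Real.log Q, by positivity, Q^(K0+3) + (d+1)*N0 + (d+1)*Q, fun n hn ℓ hℓ hℓe H htr => ?_⟩
  have hQδ : (Q:ℝ)^(Real.log a / Real.log Q) = a := by
    rw [Real.rpow_def_of_pos (by linarith), mul_div_cancel₀ _ hlQ.ne', Real.exp_log (by linarith)]
  have hp : 0 < Q^(K0+3) := by positivity
  obtain ⟨N, hN1, hN2⟩ : ∃ N, n ≤ (d+1)*N ∧ (d+1)*N < n + (d+1) := by
    refine ⟨(n+d)/(d+1), ?_, ?_⟩
    · have := Nat.div_add_mod (n+d) (d+1)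
      have := Nat.mod_lt (n+d) (show d+1 > 0 by omega)
      omega
    · have := Nat.mul_div_le (n+d) (d+1)
      omega
  have hNN0 : N0 ≤ N := Nat.le_of_mul_le_mul_left (show (d+1)*N0 ≤ (d+1)*N by omega) (by omega)
  have hNQ : Q ≤ N := Nat.le_of_mul_le_mul_left (show (d+1)*Q ≤ (d+1)*N by omega) (by omega)
  have hdQ : d+1 ≤ (d+1)*Q := Nat.le_mul_of_pos_right _ (by omega)
  obtain ⟨K, hKo, hKN, hNK⟩ := oddlog hQ2 hNQ
  have hcard : (d+1)*N < Q^(K+3) := by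
    calc (d+1)*N ≤ Q*N := Nat.mul_le_mul_right _ huQ
      _ < Q * Q^(K+2) := Nat.mul_lt_mul_of_pos_left hNK (by omega)
      _ = _ := by ring
  have hK1 : 1 ≤ K := by obtain ⟨j, rfl⟩ := hKo; omega
  have hKK : K0 ≤ K := by
    by_contra hc
    have : Q^(K+3) ≤ Q^(K0+3) := Nat.pow_le_pow_right (by omega) (by omega)
    omega
  obtain ⟨m, hm, hbig⟩ := hK0 K hKK
  obtain ⟨hq1, hq2⟩ := hQ K hK1
  obtain ⟨t1, hTF, hS⟩ := hS1 N hNN0 (3*K) (hq1.trans hKN) (by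
    have := lt_of_lt_of_le hq2 hKN
    rw [Fintype.card_fin]
    exact_mod_cast this)
  have e : (Fin (d+1) × Fin N) ≃ Fin ((d+1)*N) := finProdFinEquiv
  have hR := tr_Reg e (Reg_lift hT (sT_anti t1))
  refine ⟨(d+1)*N, hN1, by omega, _, hR, ?_⟩
  refine stage2 H htr (by omega) hR (r := r) (by linarith) hrD hrb hKo hm (tr_TF e hTF) (tr_snd e hS) ?_
  refine hbig _ _ D r (by linarith) ?_ (by positivity) ?_ (by positivity) ?_
  · rw [ha8]; field_simp
  · refine hℓe.trans (Real.exp_le_exp.2 ?_)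
    have hn : (n:ℝ) ≤ (Q:ℝ)^(K+3) := by exact_mod_cast hN1.trans hcard.le
    calc (n:ℝ)^(Real.log a / Real.log Q) ≤ ((Q:ℝ)^(K+3))^(Real.log a / Real.log Q) :=
          Real.rpow_le_rpow (by positivity) hn (by positivity)
      _ = a^(K+3) := by
        rw [← Real.rpow_natCast, ← Real.rpow_mul (by positivity), mul_comm, Real.rpow_mul (by positivity), hQδ,
          Real.rpow_natCast]
  · rw [Fintype.card_fin]; exact_mod_cast hcard.le
end


end W

/-- Sub-exponential regime: explicit near-Ramanujan abelian lifts. -/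
theorem stmt0 (d : ℕ) (hd : 3 ≤ d) (ε : ℝ) (hε0 : 0 < ε) (hε1 : ε < 1) :
    ∃ δ : ℝ, 0 < δ ∧ ∃ N : ℕ, ∀ n : ℕ, N ≤ n →
      ∀ ℓ : ℕ, 2 ≤ ℓ → (ℓ : ℝ) ≤ Real.exp ((n : ℝ) ^ δ) →
        ∀ H : Subgroup (Equiv.Perm (Fin ℓ)),
          (∀ i j : Fin ℓ, ∃ h ∈ H, h i = j) →
          (∀ a b : H, a * b = b * a) →
          ∃ n' : ℕ, n ≤ n' ∧ n' ≤ 2 * n ∧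
            ∃ G₀ : SimpleGraph (Fin n'), G₀.IsRegularOfDegree d ∧
              ∃ s : Fin n' → Fin n' → H,
                (∀ u v, s v u = (s u v)⁻¹) ∧
                (liftGraph G₀ (fun u v => (s u v : Equiv.Perm (Fin ℓ)))).IsRegularOfDegree d ∧
                SndEigLE
                  ((liftGraph G₀ (fun u v => (s u v : Equiv.Perm (Fin ℓ)))).adjMatrix ℝ)
                  (2 * Real.sqrt ((d : ℝ) - 1) + ε) := by
  obtain ⟨δ, hδ, N, h⟩ := W.main d hd ε hε0 hε1
  refine ⟨δ, hδ, N, fun n hn ℓ hℓ hle H htr _ => ?_⟩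
  obtain ⟨n', h1, h2, G, hG, t, ht⟩ := h n hn ℓ hℓ hle H htr
  refine ⟨n', h1, h2, G, W.Reg_deg hG, W.sg H t, W.sg_anti H t, W.Reg_deg (W.Reg_lift hG (W.sgp_anti H t)), ?_⟩
  rw [W.Am_adj]
  exact ht
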